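/- Let m ∈ ℕ. For i = 1,…,r let χ_i be a quadratic Dirichlet character modulo q_i and let ε_i ∈ {1,−1}. Assume that for every non-empty subset I ⊆ {1,…,r}, the product character ∏_{i∈I} χ_i does not have conductor dividing m. Then for every ε > 0 there is a constant C depending only on m and ε such that there exists a squarefree positive integer n with at most r prime factors, each prime factor p of n satisfying p ≡ 1 (mod m) and p ≤ C · (q₁⋯q_r)^{φ(m)/(4√e)+ε}, such that χ_i(n) = ε_i for all i = 1,…,r. Here φ is Euler's totient function and e is Euler's number. -/

import Mathlib

section Stepanov

open Polynomial Finset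

variable {F : Type*} [Field F]

/-- The operator `q ↦ f q' + e f' q`. -/
noncomputable def twistedDerivative (f : F[X]) (e : F) : F[X] →ₗ[F] F[X] :=
  (LinearMap.mulLeft F f).comp derivative + LinearMap.mulLeft F (C e * derivative f)

lemma twistedDerivative_apply (f : F[X]) (e : F) (q : F[X]) :
    twistedDerivative f e q = f * derivative q + C e * derivative f * q := rfl

lemma natDegree_twistedDerivative_le (f : F[X]) (e : F) {q : F[X]} {d m : ℕ}
    (hf : f.natDegree ≤ m) (hq : q.natDegree ≤ d) :
    (twistedDerivative f e q).natDegree ≤ d + m := by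
  rw [twistedDerivative_apply]
  refine (natDegree_add_le _ _).trans (max_le ?_ ?_)
  · have := natDegree_derivative_le q
    exact natDegree_mul_le.trans (by omega)
  · have := natDegree_derivative_le f
    have h2 := natDegree_C_mul_le e (derivative f)
    exact natDegree_mul_le.trans (by omega)

/-- The composition of the operators `twistedDerivative f (b - i)` for `i < k`. -/
noncomputable def iteratedTwist (f : F[X]) (b : F) : ℕ → (F[X] →ₗ[F] F[X])
  | 0 => LinearMap.id
  | k + 1 => (twistedDerivative f (b - k)).comp (iteratedTwist f b k)

lemma natDegree_iteratedTwist_le (f : F[X]) (b : F) {q : F[X]} {d m : ℕ}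
    (hf : f.natDegree ≤ m) (hq : q.natDegree ≤ d) (k : ℕ) :
    (iteratedTwist f b k q).natDegree ≤ d + k * m := by
  induction k with
  | zero => simpa [iteratedTwist] using hq
  | succ k ih =>
    have := natDegree_twistedDerivative_le f (b - k) hf ih
    rw [iteratedTwist, LinearMap.comp_apply]
    exact this.trans (by ring_nf; rfl)

/-- The auxiliary polynomial of Stepanov's method. -/
noncomputable def stepanovPoly (f : F[X]) (p c J : ℕ) (r s : ℕ → F[X]) : F[X] :=
  ∑ j ∈ range J, (r j + s j * f ^ c) * X ^ (j * p)

lemma pow_mul_iterate_derivative_stepanovPoly (f : F[X]) (p : ℕ) [CharP F p] (c J : ℕ)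
    (r s : ℕ → F[X]) (k : ℕ) :
    f ^ k * derivative^[k] (stepanovPoly f p c J r s) =
      stepanovPoly f p c J (fun j => iteratedTwist f 0 k (r j))
        (fun j => iteratedTwist f c k (s j)) := by
  induction k with
  | zero => simp [iteratedTwist]
  | succ k ih =>
    have h := congrArg derivative ih
    have h1 : f ^ (k + 1) * derivative^[k + 1] (stepanovPoly f p c J r s) =
        f * derivative (f ^ k * derivative^[k] (stepanovPoly f p c J r s)) -
          k * derivative f * (f ^ k * derivative^[k] (stepanovPoly f p c J r s)) := by
      rw [Function.iterate_succ_apply', derivative_mul, derivative_pow]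
      rcases k with _ | k
      · simp
      · simp; ring
    rw [h1, ih]
    simp only [stepanovPoly, derivative_sum, mul_sum, ← sum_sub_distrib]
    refine sum_congr rfl fun j _ => ?_
    have hX : derivative (X ^ (j * p) : F[X]) = 0 := by
      rw [derivative_X_pow]; simp
    have hg : f * derivative (f ^ c) = C (c : F) * derivative f * f ^ c := by
      rw [derivative_pow]
      rcases c with _ | c
      · simp
      · simp; ring
    simp only [iteratedTwist, LinearMap.comp_apply, twistedDerivative_apply, derivative_mul,
      derivative_add, hX, mul_zero, add_zero]
    set u := iteratedTwist f 0 k (r j)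
    set v := iteratedTwist f c k (s j)
    simp only [C_sub, map_natCast, C_0] at hg ⊢
    linear_combination (X ^ (j * p) * v) * hg

lemma eq_zero_of_X_pow_dvd {p : ℕ} [Fact p.Prime] (hp2 : p ≠ 2) {f : (ZMod p)[X]} {d m : ℕ}
    (hm : f.natDegree = m) (hodd : Odd m) (h0 : f.eval 0 ≠ 0) (hd : 2 * d + m < p)
    {r s : (ZMod p)[X]} (hr : r.natDegree ≤ d) (hs : s.natDegree ≤ d)
    (h : X ^ p ∣ r + s * f ^ (p / 2)) : r = 0 ∧ s = 0 := by
  have hpo : p / 2 * 2 + 1 = p := by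
    have := (Fact.out : p.Prime).eq_two_or_odd
    omega
  have hfp : (X ^ p : (ZMod p)[X]) ∣ f ^ p - C (f.eval 0) := by
    rw [← ZMod.expand_card f, ← Polynomial.coeff_zero_eq_eval_zero]
    obtain ⟨g, hg⟩ : (X : (ZMod p)[X]) ∣ f - C (f.coeff 0) := by simp [X_dvd_iff]
    refine ⟨expand _ p g, ?_⟩
    have := congrArg (expand (ZMod p) p) hg
    rwa [map_sub, map_mul, expand_C, expand_X] at this
  have key : (X ^ p : (ZMod p)[X]) ∣ r ^ 2 * f - C (f.eval 0) * s ^ 2 := by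
    have e : r ^ 2 * f - C (f.eval 0) * s ^ 2 =
        (r + s * f ^ (p / 2)) * ((r - s * f ^ (p / 2)) * f) + (f ^ p - C (f.eval 0)) * s ^ 2 := by
      have : f ^ p = f ^ (p / 2) * f ^ (p / 2) * f := by
        rw [← pow_add, ← pow_succ]
        congr 1
        omega
      rw [this]; ring
    rw [e]
    exact dvd_add (h.mul_right _) (hfp.mul_right _)
  have hz : r ^ 2 * f - C (f.eval 0) * s ^ 2 = 0 := by
    by_contra hne
    have h1 := natDegree_le_of_dvd key hne
    rw [natDegree_X_pow] at h1
    have h2 : (r ^ 2 * f).natDegree ≤ 2 * d + m :=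
      natDegree_mul_le.trans (by
        have := natDegree_pow_le (p := r) (n := 2)
        omega)
    have h3 : (C (f.eval 0) * s ^ 2).natDegree ≤ 2 * d :=
      (natDegree_C_mul_le _ _).trans (natDegree_pow_le.trans (by omega))
    have h4 := natDegree_sub_le (r ^ 2 * f) (C (f.eval 0) * s ^ 2)
    have h5 := max_le h2 (h3.trans (by omega : 2 * d ≤ 2 * d + m))
    omega
  have hf0 : f ≠ 0 := by rintro rfl; simp at h0
  have hr0 : r = 0 := by
    by_contra hr0
    have e := sub_eq_zero.mp hz
    have hs0 : s ≠ 0 := by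
      rintro rfl
      simp [hr0, hf0] at e
    have h1 := congrArg natDegree e
    rw [natDegree_mul (pow_ne_zero 2 hr0) hf0, natDegree_C_mul h0, natDegree_pow, natDegree_pow,
      hm] at h1
    obtain ⟨t, rfl⟩ := hodd
    omega
  refine ⟨hr0, ?_⟩
  subst hr0
  simpa [h0] using hz

lemma stepanovPoly_eq_zero {p : ℕ} [Fact p.Prime] (hp2 : p ≠ 2) {f : (ZMod p)[X]} {d m : ℕ}
    (hm : f.natDegree = m) (hodd : Odd m) (h0 : f.eval 0 ≠ 0) (hd : 2 * d + m < p) (J : ℕ)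
    (r s : ℕ → (ZMod p)[X]) (hr : ∀ j, (r j).natDegree ≤ d) (hs : ∀ j, (s j).natDegree ≤ d)
    (h : stepanovPoly f p (p / 2) J r s = 0) : ∀ j < J, r j = 0 ∧ s j = 0 := by
  induction J generalizing r s with
  | zero => simp
  | succ J ih =>
    have e : stepanovPoly f p (p / 2) (J + 1) r s = (r 0 + s 0 * f ^ (p / 2)) +
        X ^ p * stepanovPoly f p (p / 2) J (fun j => r (j + 1)) (fun j => s (j + 1)) := by
      simp only [stepanovPoly, sum_range_succ', mul_sum]
      rw [add_comm]
      congr 1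
      · simp
      · exact sum_congr rfl fun j _ => by ring
    rw [e] at h
    have hdvd : X ^ p ∣ r 0 + s 0 * f ^ (p / 2) := by
      rw [eq_neg_of_add_eq_zero_left h]
      exact (dvd_mul_right _ _).neg_right
    have hz := eq_zero_of_X_pow_dvd hp2 hm hodd h0 hd (hr 0) (hs 0) hdvd
    rw [hz.1, hz.2] at h
    simp only [zero_mul, add_zero, zero_add, mul_eq_zero, pow_eq_zero_iff', X_ne_zero,
      false_and, false_or] at h
    have := ih _ _ (fun j => hr (j + 1)) (fun j => hs (j + 1)) h
    rintro (_ | j) hj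
    · exact hz
    · exact this j (by omega)

lemma stepanov_count {p : ℕ} [Fact p.Prime] (hp2 : p ≠ 2) {f : (ZMod p)[X]} {d m : ℕ}
    (hm : f.natDegree = m) (hodd : Odd m) (h0 : f.eval 0 ≠ 0) (hd : 2 * d + m < p)
    (J l : ℕ) (hl : l ≤ p) (hcount : l * (d + l * m + J) < 2 * J * (d + 1))
    (a : ZMod p) (ha : a ≠ 0) :
    l * #{x : ZMod p | f.eval x ^ (p / 2) = a} ≤ d + p / 2 * m + J * p := by
  classical
  have hpr : p.Prime := Fact.out
  set e := d + l * m + J with he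
  let V := (Fin J → degreeLT (ZMod p) (d + 1)) × (Fin J → degreeLT (ZMod p) (d + 1))
  let rs : V → ℕ → (ZMod p)[X] := fun v j => if h : j < J then (v.1 ⟨j, h⟩ : (ZMod p)[X]) else 0
  let ss : V → ℕ → (ZMod p)[X] := fun v j => if h : j < J then (v.2 ⟨j, h⟩ : (ZMod p)[X]) else 0
  let poly : V → ℕ → (ZMod p)[X] := fun v k => ∑ j : Fin J,
    (iteratedTwist f 0 k (v.1 j) + C a * iteratedTwist f ((p / 2 : ℕ) : ZMod p) k (v.2 j)) *
      X ^ (j : ℕ)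
  let φ : V →ₗ[ZMod p] (Fin l → Fin e → ZMod p) :=
    { toFun := fun v k i => (poly v k).coeff i
      map_add' := by
        intro v w
        funext k i
        simp only [poly, Pi.add_apply, ← coeff_add, ← sum_add_distrib]
        congr 1
        refine sum_congr rfl fun j _ => ?_
        change (iteratedTwist f 0 k ((v.1 j : (ZMod p)[X]) + (w.1 j : (ZMod p)[X])) +
          C a * iteratedTwist f ((p / 2 : ℕ) : ZMod p) k
            ((v.2 j : (ZMod p)[X]) + (w.2 j : (ZMod p)[X]))) * X ^ (j : ℕ) = _
        rw [map_add, map_add]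
        ring
      map_smul' := by
        intro t v
        funext k i
        simp only [poly, Pi.smul_apply, RingHom.id_apply, ← coeff_smul, smul_sum]
        congr 1
        refine sum_congr rfl fun j _ => ?_
        change (iteratedTwist f 0 k (t • (v.1 j : (ZMod p)[X])) +
          C a * iteratedTwist f ((p / 2 : ℕ) : ZMod p) k (t • (v.2 j : (ZMod p)[X]))) *
            X ^ (j : ℕ) = _
        rw [map_smul, map_smul]
        simp only [smul_eq_C_mul]
        ring }
  have hfin : Module.finrank (ZMod p) (Fin l → Fin e → ZMod p) < Module.finrank (ZMod p) V := by
    have h1 : Module.finrank (ZMod p) (degreeLT (ZMod p) (d + 1)) = d + 1 := by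
      rw [(degreeLTEquiv (ZMod p) (d + 1)).finrank_eq]; simp
    have h2 : Module.finrank (ZMod p) V = J * (d + 1) + J * (d + 1) := by
      rw [Module.finrank_prod, Module.finrank_pi_fintype]
      simp [h1]
    rw [h2, Module.finrank_pi_fintype]
    simp only [Module.finrank_fintype_fun_eq_card, Fintype.card_fin, sum_const, card_univ,
      smul_eq_mul]
    linarith
  have : FiniteDimensional (ZMod p) (degreeLT (ZMod p) (d + 1)) :=
    Module.Finite.equiv (degreeLTEquiv (ZMod p) (d + 1)).symm
  obtain ⟨v, hv, hv0⟩ := (Submodule.ne_bot_iff _).mp (LinearMap.ker_ne_bot_of_finrank_lt (f := φ) hfin)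
  have hdeg : ∀ q : degreeLT (ZMod p) (d + 1), (q : (ZMod p)[X]).natDegree ≤ d := by
    intro q
    have := mem_degreeLT.mp q.2
    rw [natDegree_le_iff_degree_le]
    exact Order.lt_succ_iff.mp (by exact_mod_cast this)
  have hrd : ∀ j, (rs v j).natDegree ≤ d := by
    intro j; simp only [rs]; split_ifs
    · exact hdeg _
    · simp
  have hsd : ∀ j, (ss v j).natDegree ≤ d := by
    intro j; simp only [ss]; split_ifs
    · exact hdeg _
    · simp
  set P := stepanovPoly f p (p / 2) J (rs v) (ss v) with hP
  have hP0 : P ≠ 0 := by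
    intro hP0
    have := stepanovPoly_eq_zero hp2 hm hodd h0 hd J _ _ hrd hsd hP0
    apply hv0
    ext1 <;> funext j <;> have hj := this j j.2 <;> simp [rs, ss] at hj
    · simp [hj.1]
    · simp [hj.2]
  have hpoly : ∀ k < l, poly v k = 0 := by
    intro k hk
    ext i
    rw [coeff_zero]
    by_cases hi : i < e
    · exact congrFun (congrFun (LinearMap.mem_ker.mp hv) ⟨k, hk⟩) ⟨i, hi⟩
    · apply coeff_eq_zero_of_natDegree_lt
      refine lt_of_le_of_lt (natDegree_sum_le_of_forall_le (n := d + k * m + (J - 1)) _ _ ?_) ?_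
      · intro j _
        refine natDegree_mul_le.trans ?_
        rw [natDegree_X_pow]
        have h1 := natDegree_iteratedTwist_le f 0 hm.le (hdeg (v.1 j)) k
        have h2 := (natDegree_C_mul_le a _).trans
          (natDegree_iteratedTwist_le f ((p / 2 : ℕ) : ZMod p) hm.le (hdeg (v.2 j)) k)
        have h3 := (natDegree_add_le _ _).trans (max_le h1 h2)
        have := j.2
        omega
      · have hJ : 0 < J := by
          rcases Nat.eq_zero_or_pos J with h | h
          · simp [h] at hcount
          · exact h
        have : k * m ≤ l * m := Nat.mul_le_mul_right _ hk.le
        omega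
  have hmult : ∀ x ∈ ({x : ZMod p | f.eval x ^ (p / 2) = a} : Finset (ZMod p)),
      l ≤ P.rootMultiplicity x := by
    intro x hx
    have hx : f.eval x ^ (p / 2) = a := by simpa using hx
    have hfx : f.eval x ≠ 0 := by
      intro h
      rw [h, zero_pow] at hx
      · exact ha hx.symm
      · have := hpr.two_le
        omega
    rcases Nat.eq_zero_or_pos l with hl0 | hl0
    · omega
    have : l - 1 < P.rootMultiplicity x := by
      rw [lt_rootMultiplicity_iff_isRoot_iterate_derivative_of_mem_nonZeroDivisors hP0]
      · intro k hk
        have h1 := congrArg (eval x) (pow_mul_iterate_derivative_stepanovPoly f p (p / 2) J (rs v) (ss v) k)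
        have h2 : eval x (stepanovPoly f p (p / 2) J (fun j => iteratedTwist f 0 k (rs v j))
            (fun j => iteratedTwist f ((p / 2 : ℕ) : ZMod p) k (ss v j))) = eval x (poly v k) := by
          simp only [stepanovPoly, poly, eval_finsetSum]
          rw [← Fin.sum_univ_eq_sum_range
            (fun j => eval x ((iteratedTwist f 0 k (rs v j) +
              iteratedTwist f ((p / 2 : ℕ) : ZMod p) k (ss v j) * f ^ (p / 2)) * X ^ (j * p)))]
          refine sum_congr rfl fun j _ => ?_
          simp only [rs, ss, j.2, dif_pos, eval_mul, eval_add, eval_pow, eval_X, eval_C, hx]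
          rw [mul_comm (j : ℕ) p, pow_mul, ZMod.pow_card]
          ring
        rw [h2, hpoly k (by omega), eval_zero, eval_mul, eval_pow] at h1
        exact (mul_eq_zero.mp h1).resolve_left (pow_ne_zero _ hfx)
      · rw [mem_nonZeroDivisors_iff_ne_zero]
        intro h
        rw [ZMod.natCast_eq_zero_iff] at h
        have := (hpr.dvd_factorial).mp h
        omega
    omega
  have hPdeg : P.natDegree ≤ d + p / 2 * m + J * p := by
    refine natDegree_sum_le_of_forall_le _ _ ?_
    intro j hj
    have hj := mem_range.mp hj
    refine natDegree_mul_le.trans ?_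
    rw [natDegree_X_pow]
    have h1 : (ss v j * f ^ (p / 2)).natDegree ≤ d + p / 2 * m := natDegree_mul_le.trans
      (add_le_add (hsd j) (natDegree_pow_le.trans (by rw [hm])))
    have h3 := (natDegree_add_le _ _).trans (max_le ((hrd j).trans (Nat.le_add_right d (p / 2 * m))) h1)
    have : j * p ≤ J * p := Nat.mul_le_mul_right _ hj.le
    omega
  calc l * #{x : ZMod p | f.eval x ^ (p / 2) = a}
      = ∑ x ∈ ({x : ZMod p | f.eval x ^ (p / 2) = a} : Finset (ZMod p)), l := by
        rw [sum_const, smul_eq_mul, mul_comm]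
    _ ≤ ∑ x ∈ ({x : ZMod p | f.eval x ^ (p / 2) = a} : Finset (ZMod p)), P.roots.count x :=
        sum_le_sum fun x hx => by rw [count_roots]; exact hmult x hx
    _ ≤ ∑ x, P.roots.count x := sum_le_sum_of_subset (subset_univ _)
    _ = P.roots.card := by
        rw [Multiset.sum_count_eq_card (s := univ) (by simp)]
    _ ≤ _ := (card_roots' P).trans hPdeg

end Stepanov

section Weil

open Polynomial Finset

lemma stepanov_count_le {p : ℕ} [Fact p.Prime] (hp2 : p ≠ 2) {f : (ZMod p)[X]} {m : ℕ}
    (hm : f.natDegree = m) (hodd : Odd m) (h0 : f.eval 0 ≠ 0) (hbig : 4 * (m + 2) ^ 2 ≤ p)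
    (a : ZMod p) (ha : a ≠ 0) :
    (#{x : ZMod p | f.eval x ^ (p / 2) = a} : ℝ) ≤ p / 2 + (10 * m + 14) * √p := by
  have hpo : p % 2 = 1 := (Fact.out : p.Prime).eq_two_or_odd.resolve_left hp2
  obtain ⟨t, ht1, ht2⟩ : ∃ t : ℕ, 4 * t ^ 2 ≤ p ∧ p < 4 * (t + 1) ^ 2 := by
    refine ⟨Nat.sqrt (p / 4), ?_, ?_⟩
    · have := Nat.sqrt_le' (p / 4); omega
    · have := Nat.lt_succ_sqrt' (p / 4)
      simp only [Nat.succ_eq_add_one] at this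
      omega
  have htm : m + 2 ≤ t := by
    by_contra h
    push Not at h
    have : (t + 1) ^ 2 ≤ (m + 2) ^ 2 := Nat.pow_le_pow_left (by omega) 2
    omega
  obtain ⟨d, hd⟩ : ∃ d, 2 * (d + 1) + m = p := by
    obtain ⟨u, hu⟩ := hodd
    have : m + 2 ≤ p := by nlinarith
    exact ⟨(p - m) / 2 - 1, by omega⟩
  have hc := stepanov_count hp2 hm hodd h0 (d := d) (by omega) (t + (2 * m + 3)) (2 * t)
    (by nlinarith) (by
      have : 2 * (d + 1) * (2 * m + 3) + m * (2 * m + 3) = p * (2 * m + 3) := by rw [← hd]; ring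
      nlinarith [mul_le_mul ht1 (le_refl (2 * m + 3)) (by omega) (by omega)]) a ha
  set N := #{x : ZMod p | f.eval x ^ (p / 2) = a}
  have hcR : (2 * t * N : ℝ) ≤ d + (p / 2 : ℕ) * m + (t + (2 * m + 3)) * p := by exact_mod_cast hc
  have hdp : (d : ℝ) ≤ p / 2 := by
    have : ((2 * (d + 1) + m : ℕ) : ℝ) = p := by rw [hd]
    push_cast at this
    have : (0 : ℝ) ≤ m := m.cast_nonneg
    linarith
  have hp2' : ((p / 2 : ℕ) : ℝ) ≤ p / 2 := by exact_mod_cast Nat.cast_div_le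
  have ht0 : (2 : ℝ) ≤ t := by exact_mod_cast (by omega : 2 ≤ t)
  have hs1 : 2 * (t : ℝ) ≤ √p := by
    apply Real.le_sqrt_of_sq_le
    have : ((4 * t ^ 2 : ℕ) : ℝ) ≤ p := by exact_mod_cast ht1
    push_cast at this; linarith
  have hpt : (p : ℝ) ≤ 16 * t ^ 2 := by
    have : (p : ℝ) ≤ ((4 * (t + 1) ^ 2 : ℕ) : ℝ) := by exact_mod_cast ht2.le
    push_cast at this; nlinarith
  have hm0 : (0 : ℝ) ≤ m := m.cast_nonneg
  have h1 : 2 * t * (N : ℝ) ≤ 2 * t * (p / 2 + (10 * m + 14) * (2 * t)) := by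
    have e1 : ((p / 2 : ℕ) : ℝ) * m ≤ p / 2 * m := mul_le_mul_of_nonneg_right hp2' hm0
    have e2 : (p : ℝ) * (5 / 2 * m + 7 / 2) ≤ 16 * t ^ 2 * (5 / 2 * m + 7 / 2) :=
      mul_le_mul_of_nonneg_right hpt (by positivity)
    nlinarith
  have h2 := le_of_mul_le_mul_left h1 (by positivity)
  refine h2.trans ?_
  gcongr

/-- The translation of a finite set of residues used to move roots. -/
lemma abs_sum_quadraticChar_le_of_zero_notMem {p : ℕ} [Fact p.Prime] (hp2 : p ≠ 2)
    (T : Finset (ZMod p)) (hT : Odd #T) (h0 : 0 ∉ T) :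
    |((∑ x, quadraticChar (ZMod p) (∏ b ∈ T, (x + b)) : ℤ) : ℝ)| ≤ (21 * #T + 28) * √p := by
  classical
  have hpp : p.Prime := Fact.out
  have hp1 : (1 : ℝ) ≤ p := by exact_mod_cast hpp.one_le
  have hs1 : 1 ≤ √(p : ℝ) := Real.one_le_sqrt.mpr hp1
  have hss : √(p : ℝ) * √p = p := Real.mul_self_sqrt (by positivity)
  have hm0 : (0 : ℝ) ≤ #T := Nat.cast_nonneg _
  have htriv : |((∑ x, quadraticChar (ZMod p) (∏ b ∈ T, (x + b)) : ℤ) : ℝ)| ≤ p := by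
    rw [← Int.cast_abs]
    have : |∑ x, quadraticChar (ZMod p) (∏ b ∈ T, (x + b))| ≤ ∑ x : ZMod p, (1 : ℤ) := by
      refine (abs_sum_le_sum_abs _ _).trans (sum_le_sum fun x _ => ?_)
      rcases quadraticChar_isQuadratic (ZMod p) (∏ b ∈ T, (x + b)) with h | h | h <;> simp [h]
    rw [sum_const, card_univ, ZMod.card] at this
    exact_mod_cast this.trans (by simp)
  rcases lt_or_ge p (4 * (#T + 2) ^ 2) with hlt | hbig
  · refine htriv.trans ?_
    have h1 : √(p : ℝ) ≤ 2 * (#T + 2) := by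
      apply Real.sqrt_le_iff.mpr ⟨by positivity, ?_⟩
      have : (p : ℝ) ≤ ((4 * (#T + 2) ^ 2 : ℕ) : ℝ) := by exact_mod_cast hlt.le
      push_cast at this; linarith
    nlinarith
  set f : (ZMod p)[X] := ∏ b ∈ T, (X + C b) with hf
  have hfe : ∀ x, f.eval x = ∏ b ∈ T, (x + b) := fun x => by simp [hf, eval_prod]
  have hdeg : f.natDegree = #T := by
    rw [hf, natDegree_prod_of_monic _ _ fun b _ => monic_X_add_C b]; simp
  have hf0 : f.eval 0 ≠ 0 := by
    rw [hfe, prod_ne_zero_iff]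
    intro b hb; rw [zero_add]; rintro rfl; exact h0 hb
  have hchar : ringChar (ZMod p) ≠ 2 := by rwa [ZMod.ringChar_zmod_n]
  have hcard : ∀ a : ZMod p, (quadraticChar (ZMod p) a : ZMod p) = a ^ (p / 2) := by
    intro a
    have := quadraticChar_eq_pow_of_char_ne_two' hchar a
    rwa [ZMod.card] at this
  have h1ne : (1 : ZMod p) ≠ -1 := by
    have : Fact (2 < p) := ⟨lt_of_le_of_ne hpp.two_le (Ne.symm hp2)⟩
    exact (ZMod.neg_one_ne_one).symm
  have hval : ∀ x : ZMod p, quadraticChar (ZMod p) (f.eval x) =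
      (if f.eval x ^ (p / 2) = 1 then 1 else 0) - (if f.eval x ^ (p / 2) = -1 then 1 else 0) := by
    intro x
    rw [← hcard]
    rcases quadraticChar_isQuadratic (ZMod p) (f.eval x) with h | h | h <;> rw [h]
    · simp
    · simp [h1ne]
    · simp [h1ne.symm]
  have hsum : (∑ x, quadraticChar (ZMod p) (∏ b ∈ T, (x + b)) : ℤ) =
      #{x : ZMod p | f.eval x ^ (p / 2) = 1} - #{x : ZMod p | f.eval x ^ (p / 2) = -1} := by
    simp_rw [← hfe, hval, sum_sub_distrib, sum_boole]
  have hcover : p ≤ #{x : ZMod p | f.eval x ^ (p / 2) = 1} +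
      #{x : ZMod p | f.eval x ^ (p / 2) = -1} + #T := by
    have : (univ : Finset (ZMod p)) ⊆ (({x : ZMod p | f.eval x ^ (p / 2) = 1} : Finset (ZMod p)) ∪
        ({x : ZMod p | f.eval x ^ (p / 2) = -1} : Finset (ZMod p))) ∪ T.image (fun b => -b) := by
      intro x _
      simp only [mem_union, mem_filter, mem_univ, true_and, mem_image]
      rw [← hcard]
      rcases quadraticChar_isQuadratic (ZMod p) (f.eval x) with h | h | h
      · right
        rw [quadraticChar_eq_zero_iff, hfe, prod_eq_zero_iff] at h
        obtain ⟨b, hb, hb'⟩ := h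
        exact ⟨b, hb, (eq_neg_of_add_eq_zero_left hb').symm⟩
      · left; left; rw [h]; simp
      · left; right; rw [h]; simp
    have h2 := card_le_card this
    rw [card_univ, ZMod.card] at h2
    refine h2.trans ((card_union_le _ _).trans (add_le_add (card_union_le _ _) card_image_le))
  have hA := stepanov_count_le hp2 hdeg hT hf0 hbig 1 one_ne_zero
  have hB := stepanov_count_le hp2 hdeg hT hf0 hbig (-1) (neg_ne_zero.mpr one_ne_zero)
  rw [hsum]
  have hcR : (p : ℝ) ≤ #{x : ZMod p | f.eval x ^ (p / 2) = 1} +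
      #{x : ZMod p | f.eval x ^ (p / 2) = -1} + #T := by exact_mod_cast hcover
  push_cast
  have : (#T : ℝ) ≤ #T * √p := by nlinarith
  rw [abs_le]
  constructor <;> nlinarith

lemma sum_quadraticChar_translate {p : ℕ} [Fact p.Prime] (T : Finset (ZMod p)) (t : ZMod p) :
    ∑ x, quadraticChar (ZMod p) (∏ b ∈ T.image (fun b => t + b), (x + b)) =
      ∑ x, quadraticChar (ZMod p) (∏ b ∈ T, (x + b)) := by
  classical
  rw [← Equiv.sum_comp (Equiv.addRight t) (fun x => quadraticChar (ZMod p) (∏ b ∈ T, (x + b)))]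
  refine sum_congr rfl fun x _ => ?_
  rw [prod_image fun a _ b _ h => add_left_cancel h]
  simp [add_assoc]

lemma abs_sum_quadraticChar_le_of_odd {p : ℕ} [Fact p.Prime] (hp2 : p ≠ 2)
    (T : Finset (ZMod p)) (hT : Odd #T) :
    |((∑ x, quadraticChar (ZMod p) (∏ b ∈ T, (x + b)) : ℤ) : ℝ)| ≤ (21 * #T + 28) * √p := by
  classical
  have hpp : p.Prime := Fact.out
  by_cases hU : T = univ
  · have hp1 : (1 : ℝ) ≤ p := by exact_mod_cast hpp.one_le
    have hs1 : 1 ≤ √(p : ℝ) := Real.one_le_sqrt.mpr hp1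
    have hz : ∀ x, quadraticChar (ZMod p) (∏ b ∈ T, (x + b)) = 0 := by
      intro x
      rw [quadraticChar_eq_zero_iff, prod_eq_zero_iff]
      exact ⟨-x, by simp [hU], by simp⟩
    simp only [hz, sum_const_zero, Int.cast_zero, abs_zero]
    positivity
  · obtain ⟨t, ht⟩ : ∃ t, t ∉ T := by
      by_contra h; push Not at h
      exact hU (eq_univ_iff_forall.mpr h)
    have hcard : #(T.image (fun b => -t + b)) = #T :=
      card_image_of_injective _ fun a b h => add_left_cancel h
    have := abs_sum_quadraticChar_le_of_zero_notMem hp2 (T.image (fun b => -t + b))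
      (by rwa [hcard]) (by
        simp only [mem_image, not_exists, not_and]
        intro b hb h
        apply ht
        have : b = t := by linear_combination h
        rwa [← this])
    rwa [sum_quadraticChar_translate, hcard] at this

/-- The Weil bound for quadratic character sums over products of distinct linear factors. -/
theorem abs_sum_quadraticChar_le {p : ℕ} [Fact p.Prime] (hp2 : p ≠ 2)
    (T : Finset (ZMod p)) (hT : T.Nonempty) :
    |((∑ x, quadraticChar (ZMod p) (∏ b ∈ T, (x + b)) : ℤ) : ℝ)| ≤ 28 * (#T + 1) * √p := by
  classical
  have hpp : p.Prime := Fact.out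
  have hs0 : 0 ≤ √(p : ℝ) := Real.sqrt_nonneg _
  have hs1 : 1 ≤ √(p : ℝ) := Real.one_le_sqrt.mpr (by exact_mod_cast hpp.one_le)
  rcases Nat.even_or_odd #T with hev | hodd
  swap
  · refine (abs_sum_quadraticChar_le_of_odd hp2 T hodd).trans ?_
    gcongr
    have : (0 : ℝ) ≤ #T := Nat.cast_nonneg _
    linarith
  obtain ⟨c, hc⟩ := hT
  set T' := (T.erase c).image (fun b => (b - c)⁻¹) with hT'
  have hinj : Function.Injective fun b : ZMod p => (b - c)⁻¹ :=
    fun a b h => sub_left_injective (inv_injective h)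
  have hcard : #T' + 1 = #T := by
    rw [hT', card_image_of_injective _ hinj, card_erase_add_one hc]
  set κ := ∏ b ∈ T.erase c, (b - c) with hκ
  set χ := quadraticChar (ZMod p)
  have key : ∀ u : ZMod p, u ≠ 0 → χ (∏ b ∈ T, ((u⁻¹ - c) + b)) =
      χ κ * χ (∏ b ∈ T', (u + b)) := by
    intro u hu
    rw [← map_mul, hT', prod_image fun a _ b _ h => hinj h, hκ, ← prod_mul_distrib,
      ← mul_prod_erase T _ hc]
    have h1 : ∏ b ∈ T.erase c, (u⁻¹ - c + b) =
        (u⁻¹) ^ #(T.erase c) * ∏ b ∈ T.erase c, ((b - c) * (u + (b - c)⁻¹)) := by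
      rw [← prod_const, ← prod_mul_distrib]
      refine prod_congr rfl fun b hb => ?_
      have : b - c ≠ 0 := sub_ne_zero.mpr (ne_of_mem_erase hb)
      field_simp
      ring
    rw [h1, sub_add_cancel, ← mul_assoc, ← pow_succ', card_erase_add_one hc, map_mul]
    obtain ⟨w, hw⟩ := hev
    rw [hw, ← two_mul, pow_mul, map_pow, map_pow, ← map_pow]
    rw [quadraticChar_sq_one' (inv_ne_zero hu)]
    simp
  have hsum : ∑ x, χ (∏ b ∈ T, (x + b)) =
      χ κ * ∑ u, χ (∏ b ∈ T', (u + b)) - χ κ * χ (∏ b ∈ T', (0 + b)) := by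
    have e1 : ∑ x, χ (∏ b ∈ T, (x + b)) = ∑ u, χ (∏ b ∈ T, ((u⁻¹ - c) + b)) := by
      rw [← Equiv.sum_comp ((Equiv.inv (ZMod p)).trans (Equiv.subRight c))
        (fun x => χ (∏ b ∈ T, (x + b)))]
      rfl
    rw [e1, ← add_sum_erase univ _ (mem_univ 0), ← add_sum_erase univ
      (fun u => χ (∏ b ∈ T', (u + b))) (mem_univ 0), mul_add, mul_sum]
    have h0 : χ (∏ b ∈ T, (((0 : ZMod p)⁻¹ - c) + b)) = 0 := by
      rw [quadraticChar_eq_zero_iff, prod_eq_zero_iff]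
      exact ⟨c, hc, by simp⟩
    rw [h0, zero_add, add_sub_cancel_left]
    exact sum_congr rfl fun u hu => key u (ne_of_mem_erase hu)
  have habs : ∀ a : ZMod p, |(χ a : ℝ)| ≤ 1 := by
    intro a
    rcases quadraticChar_isQuadratic (ZMod p) a with h | h | h <;> simp [χ, h]
  have hT'odd : Odd #T' := by
    rw [← hcard] at hev
    exact Nat.not_even_iff_odd.mp (fun h => by
      rw [Nat.even_add_one] at hev; exact hev h)
  have hb := abs_sum_quadraticChar_le_of_odd hp2 T' hT'odd
  rw [hsum, Int.cast_sub, Int.cast_mul, Int.cast_mul]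
  have hcR : (#T' : ℝ) + 1 = #T := by exact_mod_cast hcard
  have h0 : (0 : ℝ) ≤ #T' := Nat.cast_nonneg _
  calc |(χ κ : ℝ) * ((∑ u, χ (∏ b ∈ T', (u + b)) : ℤ) : ℝ) - χ κ * χ (∏ b ∈ T', (0 + b))|
      ≤ |(χ κ : ℝ)| * |((∑ u, χ (∏ b ∈ T', (u + b)) : ℤ) : ℝ)| +
        |(χ κ : ℝ)| * |(χ (∏ b ∈ T', (0 + b)) : ℝ)| := by
        rw [← abs_mul, ← abs_mul]; exact abs_sub _ _
    _ ≤ 1 * ((21 * #T' + 28) * √p) + 1 * 1 := by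
        gcongr
        · exact habs _
        · exact habs _
        · exact habs _
    _ ≤ _ := by
        rw [← hcR]; nlinarith

end Weil

section divisorBounds

open Finset

/-- `c ^ ω(D)` grows slower than any power of `D`. -/
theorem exists_pow_card_primeFactors_le (c η : ℝ) (hc : 1 ≤ c) (hη : 0 < η) :
    ∃ K : ℝ, 1 ≤ K ∧ ∀ D : ℕ, D ≠ 0 → c ^ #D.primeFactors ≤ K * (D : ℝ) ^ η := by
  set P : ℕ := ⌈c ^ (1 / η)⌉₊ with hP
  refine ⟨c ^ P, one_le_pow₀ hc, fun D hD => ?_⟩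
  have hc0 : 0 < c := by linarith
  have h1 : #D.primeFactors = #(D.primeFactors.filter (· ≤ P)) +
      #(D.primeFactors.filter (¬ · ≤ P)) := (card_filter_add_card_filter_not _).symm
  rw [h1, pow_add]
  gcongr
  · calc #(D.primeFactors.filter (· ≤ P)) ≤ #(Icc 1 P) := card_le_card fun p hp => by
          rw [mem_filter] at hp
          exact mem_Icc.2 ⟨(Nat.prime_of_mem_primeFactors hp.1).one_le, hp.2⟩
      _ = P := by simp
  · calc c ^ #(D.primeFactors.filter (¬ · ≤ P))
        = ∏ p ∈ D.primeFactors.filter (¬ · ≤ P), c := by rw [prod_const]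
      _ ≤ ∏ p ∈ D.primeFactors.filter (¬ · ≤ P), (p : ℝ) ^ η := by
          refine prod_le_prod (fun _ _ => hc0.le) fun p hp => ?_
          have h2 : c ^ (1 / η) ≤ p := (Nat.le_ceil _).trans
            (by rw [mem_filter] at hp; exact_mod_cast (not_le.1 hp.2).le)
          calc c = (c ^ (1 / η)) ^ η := by
                rw [← Real.rpow_mul hc0.le, one_div_mul_cancel hη.ne', Real.rpow_one]
            _ ≤ _ := by gcongr
      _ = ((∏ p ∈ D.primeFactors.filter (¬ · ≤ P), p : ℕ) : ℝ) ^ η := by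
          rw [Nat.cast_prod, Real.finsetProd_rpow _ _ (fun _ _ => by positivity)]
      _ ≤ (D : ℝ) ^ η := by
          gcongr
          refine Nat.le_of_dvd (Nat.pos_of_ne_zero hD) ?_
          exact (prod_dvd_prod_of_subset _ _ _ (filter_subset _ _)).trans
            (Nat.prod_primeFactors_dvd D)

/-- The divisor bound `τ(n) ≪ n ^ η`. -/
theorem exists_card_divisors_le (η : ℝ) (hη : 0 < η) :
    ∃ K : ℝ, 1 ≤ K ∧ ∀ n : ℕ, n ≠ 0 → (#n.divisors : ℝ) ≤ K * (n : ℝ) ^ η := by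
  have hl2 : 0 < Real.log 2 := Real.log_pos one_lt_two
  set c : ℝ := max 1 (1 / (η / 2 * Real.log 2)) with hc
  have hc1 : 1 ≤ c := le_max_left _ _
  obtain ⟨K, hK1, hK⟩ := exists_pow_card_primeFactors_le c (η / 2) hc1 (by positivity)
  refine ⟨K, hK1, fun n hn => ?_⟩
  have key : ∀ p ∈ n.primeFactors, ((n.factorization p + 1 : ℕ) : ℝ) ≤
      c * ((p ^ n.factorization p : ℕ) : ℝ) ^ (η / 2) := fun p hp => by
    set a := n.factorization p
    have hp2 : (2 : ℝ) ≤ p := by exact_mod_cast (Nat.prime_of_mem_primeFactors hp).two_le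
    have h1 : ((2 : ℝ) ^ a) ^ (η / 2) ≤ ((p ^ a : ℕ) : ℝ) ^ (η / 2) := by
      push_cast
      gcongr
    have h2 : 1 + a * (η / 2 * Real.log 2) ≤ ((2 : ℝ) ^ a) ^ (η / 2) := by
      rw [← Real.rpow_natCast, ← Real.rpow_mul two_pos.le, Real.rpow_def_of_pos two_pos]
      refine le_trans ?_ (Real.add_one_le_exp _)
      linarith
    have h3 : 1 ≤ c * (η / 2 * Real.log 2) := by
      rw [← div_le_iff₀ (by positivity)]
      exact le_max_right _ _
    calc ((a + 1 : ℕ) : ℝ) ≤ c * (1 + a * (η / 2 * Real.log 2)) := by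
          push_cast
          nlinarith [(Nat.cast_nonneg a : (0 : ℝ) ≤ a)]
      _ ≤ c * ((p ^ a : ℕ) : ℝ) ^ (η / 2) := by gcongr; exact h2.trans h1
  calc (#n.divisors : ℝ) = ∏ p ∈ n.primeFactors, ((n.factorization p + 1 : ℕ) : ℝ) := by
        rw [Nat.card_divisors hn, Nat.cast_prod]
    _ ≤ ∏ p ∈ n.primeFactors, c * ((p ^ n.factorization p : ℕ) : ℝ) ^ (η / 2) :=
        prod_le_prod (fun _ _ => by positivity) key
    _ = c ^ #n.primeFactors * (n : ℝ) ^ (η / 2) := by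
        rw [prod_mul_distrib, prod_const, Real.finsetProd_rpow _ _ (fun _ _ => by positivity),
          ← Nat.cast_prod]
        congr
        exact Nat.prod_factorization_pow_eq_self hn
    _ ≤ K * (n : ℝ) ^ (η / 2) * (n : ℝ) ^ (η / 2) := by gcongr; exact hK n hn
    _ = K * (n : ℝ) ^ η := by
        rw [mul_assoc, ← Real.rpow_add (by positivity), add_halves]

end divisorBounds

section jacobiTuples

open Finset

theorem sum_range_mul_of_periodic {D₁ D₂ : ℕ} (h : D₁.Coprime D₂) (h₁ : 0 < D₁) (h₂ : 0 < D₂)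
    (f g : ℕ → ℤ)
    (hf : ∀ x, f (x % D₁) = f x) (hg : ∀ x, g (x % D₂) = g x) :
    ∑ x ∈ range (D₁ * D₂), f x * g x = (∑ x ∈ range D₁, f x) * ∑ x ∈ range D₂, g x := by
  rw [sum_mul_sum, ← sum_product']
  refine sum_nbij (fun x => (x % D₁, x % D₂)) ?_ ?_ ?_ ?_
  · intro x _
    simp [Nat.mod_lt _ h₁, Nat.mod_lt _ h₂]
  · intro x hx y hy hxy
    simp only [Prod.mk.injEq, coe_range, Set.mem_Iio] at hx hy hxy
    have := (Nat.modEq_and_modEq_iff_modEq_mul h).1 hxy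
    exact Nat.ModEq.eq_of_lt_of_lt this hx hy
  · rintro ⟨a, b⟩ hab
    simp only [coe_product, coe_range, Set.mem_prod, Set.mem_Iio] at hab
    refine ⟨Nat.chineseRemainder h a b, ?_, ?_⟩
    · simpa using Nat.chineseRemainder_lt_mul h a b h₁.ne' h₂.ne'
    · have := (Nat.chineseRemainder h a b).2
      simp only [Prod.mk.injEq]
      exact ⟨Eq.trans this.1 (Nat.mod_eq_of_lt hab.1), Eq.trans this.2 (Nat.mod_eq_of_lt hab.2)⟩
  · intro x _
    simp [hf, hg]

variable {ι : Type*} [Fintype ι]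

theorem jacobiSym_prod_add_mod (b : ι → ℤ) (D : ℕ) (x : ℕ) :
    jacobiSym (∏ j, (((x % D : ℕ) : ℤ) + b j)) D = jacobiSym (∏ j, ((x : ℤ) + b j)) D := by
  refine jacobiSym.mod_left' ?_
  change _ ≡ _ [ZMOD D]
  refine Int.ModEq.prod fun j _ => Int.ModEq.add_right _ ?_
  push_cast
  exact Int.mod_modEq _ _

theorem abs_sum_jacobiSym_prime_le {p : ℕ} [Fact p.Prime] (hp2 : p ≠ 2) (b : ι → ℤ) (i : ι)
    (hodd : Odd #{j | b j = b i}) (hne : ∀ j, b j ≠ b i → ¬ (p : ℤ) ∣ b i - b j) :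
    |((∑ x ∈ range p, jacobiSym (∏ j, ((x : ℤ) + b j)) p : ℤ) : ℝ)| ≤
      28 * (2 * Fintype.card ι + 1) * √p := by
  classical
  set χ := quadraticChar (ZMod p)
  set β : ι → ZMod p := fun j => (b j : ZMod p)
  set T : Finset (ZMod p) := (univ.image β).filter fun c => Odd #{j | β j = c}
  have hβ : ∀ j, β j = β i ↔ b j = b i := fun j => by
    constructor
    · intro h
      by_contra h'
      refine hne j h' ?_
      rw [← ZMod.intCast_zmod_eq_zero_iff_dvd, Int.cast_sub]
      exact sub_eq_zero.2 h.symm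
    · intro h
      simp only [β, h]
  have hiT : β i ∈ T := by
    simp only [T, mem_filter, mem_image, mem_univ, true_and]
    refine ⟨⟨i, rfl⟩, ?_⟩
    simpa only [hβ] using hodd
  have hsum : ∑ x ∈ range p, jacobiSym (∏ j, ((x : ℤ) + b j)) p =
      ∑ x : ZMod p, χ (∏ j, (x + β j)) := by
    refine sum_bij' (fun x _ => (x : ZMod p)) (fun x _ => x.val) ?_ ?_ ?_ ?_ ?_
    · simp
    · intro x _
      simpa using ZMod.val_lt x
    · intro x hx
      exact ZMod.val_cast_of_lt (mem_range.1 hx)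
    · intro x _
      exact ZMod.natCast_zmod_val x
    · intro x _
      rw [← jacobiSym.legendreSym.to_jacobiSym, legendreSym]
      push_cast
      rfl
  have hT := abs_sum_quadraticChar_le hp2 T ⟨_, hiT⟩
  have hTc : #T ≤ Fintype.card ι := (card_filter_le _ _).trans card_image_le
  set E : Finset (ZMod p) := univ.image fun j => -β j
  have hEc : #E ≤ Fintype.card ι := card_image_le
  have hgood : ∀ x, x ∉ E → χ (∏ j, (x + β j)) = χ (∏ c ∈ T, (x + c)) := fun x hx => by
    have hx0 : ∀ c ∈ univ.image β, x + c ≠ 0 := fun c hc h => by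
      obtain ⟨j, -, rfl⟩ := mem_image.1 hc
      exact hx (mem_image.2 ⟨j, mem_univ _, (eq_neg_of_add_eq_zero_left h).symm⟩)
    rw [map_prod, map_prod, prod_comp (fun c => χ (x + c)) β, prod_filter]
    refine prod_congr rfl fun c hc => ?_
    have hsq : χ (x + c) ^ 2 = 1 := quadraticChar_sq_one (hx0 c hc)
    split_ifs with h
    · obtain ⟨w, hw⟩ := h
      rw [hw, pow_succ, pow_mul, hsq, one_pow, one_mul]
    · obtain ⟨w, hw⟩ := Nat.not_odd_iff_even.1 h
      rw [hw, ← two_mul, pow_mul, hsq, one_pow]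
  have hbad : ∀ x ∈ E, χ (∏ j, (x + β j)) = 0 := fun x hx => by
    obtain ⟨j, -, rfl⟩ := mem_image.1 hx
    rw [quadraticChar_eq_zero_iff]
    exact prod_eq_zero (mem_univ j) (by simp)
  have hle1 : ∀ y, |((χ y : ℤ) : ℝ)| ≤ 1 := fun y => by
    rcases eq_or_ne y 0 with rfl | hy
    · simp [χ]
    · rcases quadraticChar_dichotomy hy with h | h <;> simp [χ, h]
  have hdiff : ∑ x, χ (∏ j, (x + β j)) =
      ∑ x, χ (∏ c ∈ T, (x + c)) - ∑ x ∈ E, χ (∏ c ∈ T, (x + c)) := by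
    rw [← sum_add_sum_compl E, ← sum_add_sum_compl E (fun x => χ (∏ c ∈ T, (x + c))),
      sum_eq_zero hbad, zero_add, add_sub_cancel_left]
    exact sum_congr rfl fun x hx => hgood x (mem_compl.1 hx)
  have hE : |((∑ x ∈ E, χ (∏ c ∈ T, (x + c)) : ℤ) : ℝ)| ≤ Fintype.card ι := by
    rw [Int.cast_sum]
    refine (abs_sum_le_sum_abs _ _).trans ?_
    calc _ ≤ ∑ x ∈ E, (1 : ℝ) := sum_le_sum fun x _ => hle1 _
      _ ≤ _ := by simpa using hEc
  have hp1 : 1 ≤ √(p : ℝ) := by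
    rw [Real.one_le_sqrt]
    exact_mod_cast (Fact.out : p.Prime).one_le
  rw [hsum, hdiff, Int.cast_sub]
  refine (abs_sub _ _).trans ((add_le_add hT hE).trans ?_)
  have hTc' : (#T : ℝ) ≤ Fintype.card ι := by exact_mod_cast hTc
  have hn : (0 : ℝ) ≤ Fintype.card ι := Nat.cast_nonneg _
  nlinarith

theorem abs_sum_jacobiSym_le {D : ℕ} (hsq : Squarefree D) (hodd : Odd D) (b : ι → ℤ) (i : ι)
    (hi : Odd #{j | b j = b i}) :
    |((∑ x ∈ range D, jacobiSym (∏ j, ((x : ℤ) + b j)) D : ℤ) : ℝ)| ≤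
      (28 * (2 * Fintype.card ι + 1)) ^ #D.primeFactors * √D *
        ∏ j, (if b j = b i then 1 else D.gcd (b i - b j).natAbs : ℕ) := by
  classical
  induction D using induction_on_primes with
  | zero => simp at hsq
  | one => simp
  | prime_mul p a hp ih =>
    have hcop : p.Coprime a := Nat.coprime_of_squarefree_mul hsq
    have hsqa : Squarefree a := hsq.squarefree_of_dvd (dvd_mul_left _ _)
    have hodda : Odd a := (Nat.odd_mul.1 hodd).2
    have hoddp : Odd p := (Nat.odd_mul.1 hodd).1
    have ha0 : a ≠ 0 := hsqa.ne_zero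
    have := Fact.mk hp
    have hmul : ∑ x ∈ range (p * a), jacobiSym (∏ j, ((x : ℤ) + b j)) (p * a) =
        (∑ x ∈ range p, jacobiSym (∏ j, ((x : ℤ) + b j)) p) *
          ∑ x ∈ range a, jacobiSym (∏ j, ((x : ℤ) + b j)) a := by
      rw [← sum_range_mul_of_periodic hcop hp.pos (Nat.pos_of_ne_zero ha0)]
      · exact sum_congr rfl fun x _ => jacobiSym.mul_right' _ hp.ne_zero ha0
      · exact fun x => jacobiSym_prod_add_mod b p x
      · exact fun x => jacobiSym_prod_add_mod b a x
    have hprime : |((∑ x ∈ range p, jacobiSym (∏ j, ((x : ℤ) + b j)) p : ℤ) : ℝ)| ≤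
        28 * (2 * Fintype.card ι + 1) * √p *
          ∏ j, (if b j = b i then 1 else p.gcd (b i - b j).natAbs : ℕ) := by
      by_cases hne : ∀ j, b j ≠ b i → ¬ (p : ℤ) ∣ b i - b j
      · refine (abs_sum_jacobiSym_prime_le (by rintro rfl; exact absurd hoddp (by decide)) b i hi hne).trans ?_
        refine le_mul_of_one_le_right (by positivity) ?_
        exact_mod_cast Nat.one_le_iff_ne_zero.2 (prod_ne_zero_iff.2 fun j _ => by
          split_ifs
          · exact one_ne_zero
          · exact (Nat.gcd_pos_of_pos_left _ hp.pos).ne')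
      · push Not at hne
        obtain ⟨j, hj, hdvd⟩ := hne
        have h1 : |((∑ x ∈ range p, jacobiSym (∏ j, ((x : ℤ) + b j)) p : ℤ) : ℝ)| ≤ p := by
          rw [Int.cast_sum]
          refine (abs_sum_le_sum_abs _ _).trans ?_
          calc _ ≤ ∑ x ∈ range p, (1 : ℝ) := sum_le_sum fun x _ => by
                rcases jacobiSym.trichotomy (∏ j, ((x : ℤ) + b j)) p with h | h | h <;> simp [h]
            _ = p := by simp
        have h2 : p ≤ ∏ j, (if b j = b i then 1 else p.gcd (b i - b j).natAbs : ℕ) := by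
          refine Nat.le_of_dvd (Nat.pos_of_ne_zero (prod_ne_zero_iff.2 fun j _ => ?_)) ?_
          · split_ifs
            · exact one_ne_zero
            · exact (Nat.gcd_pos_of_pos_left _ hp.pos).ne'
          · refine Dvd.dvd.trans ?_ (dvd_prod_of_mem _ (mem_univ j))
            rw [if_neg hj]
            exact Nat.dvd_gcd dvd_rfl (Int.natCast_dvd.1 hdvd)
        have hp1 : 1 ≤ √(p : ℝ) := by
          rw [Real.one_le_sqrt]
          exact_mod_cast hp.one_le
        have hn : (0 : ℝ) ≤ Fintype.card ι := Nat.cast_nonneg _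
        calc _ ≤ (p : ℝ) := h1
          _ ≤ _ := by exact_mod_cast h2
          _ ≤ _ := le_mul_of_one_le_left (by positivity) (by nlinarith)
    rw [hmul, Int.cast_mul, abs_mul]
    refine (mul_le_mul hprime (ih hsqa hodda) (abs_nonneg _) (by positivity)).trans (le_of_eq ?_)
    have hpf : #(p * a).primeFactors = #a.primeFactors + 1 := by
      rw [Nat.Coprime.primeFactors_mul hcop, card_union_of_disjoint hcop.disjoint_primeFactors,
        hp.primeFactors, card_singleton, add_comm]
    have hg : (∏ j, (if b j = b i then 1 else (p * a).gcd (b i - b j).natAbs : ℕ)) =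
        (∏ j, (if b j = b i then 1 else p.gcd (b i - b j).natAbs : ℕ)) *
          ∏ j, (if b j = b i then 1 else a.gcd (b i - b j).natAbs : ℕ) := by
      rw [← prod_mul_distrib]
      refine prod_congr rfl fun j _ => ?_
      split_ifs
      · simp
      · rw [Nat.gcd_comm, hcop.gcd_mul, Nat.gcd_comm _ p, Nat.gcd_comm _ a]
    rw [hpf, hg, pow_succ]
    push_cast
    rw [Real.sqrt_mul (by positivity)]
    ring

end jacobiTuples

section jacobiMoment

open Finset

theorem sum_gcd_Icc_le (D B : ℕ) (hD : D ≠ 0) :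
    ∑ h ∈ Icc 1 B, D.gcd h ≤ B * #D.divisors := by
  calc ∑ h ∈ Icc 1 B, D.gcd h ≤ ∑ h ∈ Icc 1 B, ∑ d ∈ D.divisors, if d ∣ h then d else 0 := by
        refine sum_le_sum fun h _ => ?_
        have : D.gcd h = if D.gcd h ∣ h then D.gcd h else 0 := by
          rw [if_pos (Nat.gcd_dvd_right _ _)]
        nth_rw 1 [this]
        exact single_le_sum (f := fun d => if d ∣ h then d else 0) (fun _ _ => Nat.zero_le _)
          (Nat.mem_divisors.2 ⟨Nat.gcd_dvd_left _ _, hD⟩)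
    _ = ∑ d ∈ D.divisors, d * #{h ∈ Icc 1 B | d ∣ h} := by
        rw [sum_comm]
        refine sum_congr rfl fun d _ => ?_
        rw [← sum_filter, sum_const, smul_eq_mul, mul_comm]
    _ ≤ ∑ d ∈ D.divisors, B := by
        refine sum_le_sum fun d _ => ?_
        have : #{h ∈ Icc 1 B | d ∣ h} = B / d := by
          rw [← Nat.Ioc_filter_dvd_card_eq_div]
          rfl
        rw [this]
        exact Nat.mul_div_le _ _
    _ = _ := by rw [sum_const, smul_eq_mul, mul_comm]

theorem sum_gcd_sub_le (D B : ℕ) (hD : D ≠ 0) (c : ℕ) (hc : c ∈ Icc 1 B) :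
    ∑ b ∈ Icc 1 B, (if (b : ℤ) = c then 1 else D.gcd ((c : ℤ) - b).natAbs) ≤
      3 * (B * #D.divisors) := by
  rw [mem_Icc] at hc
  have hτ : 1 ≤ #D.divisors := card_pos.2 ⟨1, Nat.one_mem_divisors.2 hD⟩
  have h1 : ∑ b ∈ (Icc 1 B).filter (· < c),
      (if (b : ℤ) = c then 1 else D.gcd ((c : ℤ) - b).natAbs) ≤ B * #D.divisors := by
    refine le_trans ?_ (sum_gcd_Icc_le D B hD)
    have hinj : Set.InjOn (fun b => c - b) ((Icc 1 B).filter (· < c) : Finset ℕ) := by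
      intro x hx y hy hxy
      simp only [coe_filter, mem_Icc, Set.mem_ofPred_eq] at hx hy hxy
      omega
    calc _ = ∑ h ∈ ((Icc 1 B).filter (· < c)).image (fun b => c - b), D.gcd h := by
          rw [sum_image hinj]
          refine sum_congr rfl fun b hb => ?_
          simp only [mem_filter] at hb
          rw [if_neg (by omega)]
          congr 1
          omega
      _ ≤ _ := by
          refine sum_le_sum_of_subset fun h hh => ?_
          simp only [mem_image, mem_filter, mem_Icc] at hh ⊢
          omega
  have h2 : ∑ b ∈ (Icc 1 B).filter (c < ·),
      (if (b : ℤ) = c then 1 else D.gcd ((c : ℤ) - b).natAbs) ≤ B * #D.divisors := by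
    refine le_trans ?_ (sum_gcd_Icc_le D B hD)
    have hinj : Set.InjOn (fun b => b - c) ((Icc 1 B).filter (c < ·) : Finset ℕ) := by
      intro x hx y hy hxy
      simp only [coe_filter, mem_Icc, Set.mem_ofPred_eq] at hx hy hxy
      omega
    calc _ = ∑ h ∈ ((Icc 1 B).filter (c < ·)).image (fun b => b - c), D.gcd h := by
          rw [sum_image hinj]
          refine sum_congr rfl fun b hb => ?_
          simp only [mem_filter] at hb
          rw [if_neg (by omega)]
          congr 1
          omega
      _ ≤ _ := by
          refine sum_le_sum_of_subset fun h hh => ?_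
          simp only [mem_image, mem_filter, mem_Icc] at hh ⊢
          omega
  have h3 : Icc 1 B = ((Icc 1 B).filter (· < c) ∪ (Icc 1 B).filter (c < ·)) ∪ {c} := by
    ext x
    simp only [mem_union, mem_filter, mem_Icc, mem_singleton]
    omega
  have hB : 1 ≤ B * #D.divisors := Nat.mul_pos (by omega) hτ
  have hd1 : Disjoint ((Icc 1 B).filter (· < c)) ((Icc 1 B).filter (c < ·)) := by
    rw [disjoint_filter]
    intro x _ hx
    omega
  have hd2 : Disjoint ((Icc 1 B).filter (· < c) ∪ (Icc 1 B).filter (c < ·)) {c} := by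
    simp
  rw [h3, sum_union hd2, sum_union hd1, sum_singleton, if_pos rfl]
  omega

/-- Maps all of whose values are taken an even number of times are few. -/
theorem card_even_maps_le (ℓ B : ℕ) (S : Finset ℕ) (hS : #S = B) (hB : B ≠ 0) :
    #{t ∈ Fintype.piFinset (fun _ : Fin (2 * ℓ) => S) | ∀ i, Even #{j | t j = t i}} ≤
      ℓ ^ (2 * ℓ) * B ^ ℓ := by
  classical
  have hcard : #((univ : Finset (Fin (2 * ℓ) → Fin ℓ)) ×ˢ
      Fintype.piFinset (fun _ : Fin ℓ => S)) = ℓ ^ (2 * ℓ) * B ^ ℓ := by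
    simp [card_product, Fintype.card_piFinset, hS]
  rw [← hcard]
  refine card_le_card_of_surjOn (fun fg : (Fin (2 * ℓ) → Fin ℓ) × (Fin ℓ → ℕ) => fg.2 ∘ fg.1) ?_
  intro t ht
  simp only [coe_filter, Fintype.mem_piFinset, Set.mem_ofPred_eq] at ht
  obtain ⟨htS, hev⟩ := ht
  have him : #(univ.image t) ≤ ℓ := by
    have h1 : #(univ : Finset (Fin (2 * ℓ))) = ∑ c ∈ univ.image t, #{j | t j = c} :=
      card_eq_sum_card_image t univ
    have h2 : ∑ c ∈ univ.image t, 2 ≤ ∑ c ∈ univ.image t, #{j | t j = c} := by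
      refine sum_le_sum fun c hc => ?_
      obtain ⟨i, -, rfl⟩ := mem_image.1 hc
      have h3 : 0 < #{j | t j = t i} := card_pos.2 ⟨i, by simp⟩
      obtain ⟨w, hw⟩ := hev i
      omega
    rw [← h1, sum_const, smul_eq_mul, card_univ, Fintype.card_fin] at h2
    omega
  obtain ⟨s0, hs0⟩ : S.Nonempty := card_pos.1 (by omega)
  have hle : #(univ.image t) ≤ Fintype.card (Fin ℓ) := by simpa using him
  obtain ⟨φ⟩ : Nonempty (univ.image t ↪ Fin ℓ) :=
    Function.Embedding.nonempty_of_card_le (by simpa using him)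
  refine ⟨(fun j => φ ⟨t j, mem_image_of_mem _ (mem_univ j)⟩,
    fun u => if h : ∃ c, φ c = u then (h.choose : ℕ) else s0), ?_, ?_⟩
  · simp only [coe_product, Set.mem_prod, coe_univ, Set.mem_univ, true_and, mem_coe,
      Fintype.mem_piFinset]
    intro u
    split_ifs with h
    · obtain ⟨i, -, hi⟩ := mem_image.1 h.choose.2
      rw [← hi]
      exact htS i
    · exact hs0
  · funext j
    simp only [Function.comp]
    have h : ∃ c, φ c = φ ⟨t j, mem_image_of_mem _ (mem_univ j)⟩ := ⟨_, rfl⟩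
    rw [dif_pos h, φ.injective h.choose_spec]

theorem sum_prod_gcd_le (n D B : ℕ) (hD : D ≠ 0) (i : Fin n) :
    ∑ t ∈ Fintype.piFinset (fun _ : Fin n => Icc 1 B),
      ∏ j, (if (t j : ℤ) = t i then 1 else D.gcd ((t i : ℤ) - t j).natAbs) ≤
      B * (3 * (B * #D.divisors)) ^ (n - 1) := by
  classical
  calc ∑ t ∈ Fintype.piFinset (fun _ : Fin n => Icc 1 B),
      ∏ j, (if (t j : ℤ) = t i then 1 else D.gcd ((t i : ℤ) - t j).natAbs)
      ≤ ∑ t ∈ Fintype.piFinset (fun _ : Fin n => Icc 1 B), ∑ c ∈ Icc 1 B,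
        ∏ j, (if j = i then (if t j = c then 1 else 0) else
          (if (t j : ℤ) = c then 1 else D.gcd ((c : ℤ) - t j).natAbs)) := by
        refine sum_le_sum fun t ht => ?_
        rw [Fintype.mem_piFinset] at ht
        refine le_trans (le_of_eq ?_) (single_le_sum (fun _ _ => Nat.zero_le _) (ht i))
        refine prod_congr rfl fun j _ => ?_
        by_cases hj : j = i
        · subst hj
          simp
        · rw [if_neg hj]
    _ = ∑ c ∈ Icc 1 B, ∏ j, ∑ b ∈ Icc 1 B, (if j = i then (if b = c then 1 else 0) else
          (if (b : ℤ) = c then 1 else D.gcd ((c : ℤ) - b).natAbs)) := by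
        rw [sum_comm]
        refine sum_congr rfl fun c _ => ?_
        rw [prod_univ_sum]
    _ ≤ ∑ c ∈ Icc 1 B, (3 * (B * #D.divisors)) ^ (n - 1) := by
        refine sum_le_sum fun c hc => ?_
        rw [← mul_prod_erase univ _ (mem_univ i)]
        have h1 : ∑ b ∈ Icc 1 B, (if i = i then (if b = c then 1 else 0) else
          (if (b : ℤ) = c then 1 else D.gcd ((c : ℤ) - b).natAbs)) = 1 := by
          simp only [if_true]
          rw [sum_ite_eq', if_pos hc]
        rw [h1, one_mul]
        calc _ ≤ ∏ j ∈ univ.erase i, 3 * (B * #D.divisors) := by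
              refine prod_le_prod' fun j hj => ?_
              simp only [if_neg (ne_of_mem_erase hj)]
              exact sum_gcd_sub_le D B hD c hc
          _ = _ := by rw [prod_const, card_erase_of_mem (mem_univ i), card_univ, Fintype.card_fin]
    _ = _ := by simp

theorem exists_moment_le (ℓ : ℕ) (hℓ : ℓ ≠ 0) (η : ℝ) (hη : 0 < η) :
    ∃ K : ℝ, 1 ≤ K ∧ ∀ D : ℕ, Squarefree D → Odd D → ∀ B : ℕ, B ≠ 0 →
      ∑ x ∈ range D, ((∑ b ∈ Icc 1 B, jacobiSym ((x : ℤ) + (b : ℕ)) D : ℤ) : ℝ) ^ (2 * ℓ) ≤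
        K * (D * B ^ ℓ + √D * B ^ (2 * ℓ) * (D : ℝ) ^ η) := by
  classical
  set n := 2 * ℓ with hn
  obtain ⟨K₁, hK₁1, hK₁⟩ := exists_pow_card_primeFactors_le (28 * (2 * n + 1)) (η / 2)
    (by have : (0 : ℝ) ≤ n := Nat.cast_nonneg _
        linarith) (by positivity)
  obtain ⟨K₂, hK₂1, hK₂⟩ := exists_card_divisors_le (η / (2 * n)) (by positivity)
  refine ⟨(ℓ : ℝ) ^ n + n * K₁ * 3 ^ n * K₂ ^ n, ?_, fun D hD hodd B hB => ?_⟩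
  · have h1 : (1 : ℝ) ≤ (ℓ : ℝ) ^ n := one_le_pow₀ (by exact_mod_cast Nat.one_le_iff_ne_zero.2 hℓ)
    have : 0 ≤ n * K₁ * 3 ^ n * K₂ ^ n := by positivity
    linarith
  set P := Fintype.piFinset (fun _ : Fin n => Icc 1 B)
  set S : (Fin n → ℕ) → ℝ := fun t =>
    ((∑ x ∈ range D, jacobiSym (∏ j, ((x : ℤ) + (t j : ℤ))) D : ℤ) : ℝ) with hSdef
  have hexp : ∑ x ∈ range D, ((∑ b ∈ Icc 1 B, jacobiSym ((x : ℤ) + (b : ℕ)) D : ℤ) : ℝ) ^ n =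
      ∑ t ∈ P, S t := by
    simp only [hSdef]
    rw [← Int.cast_sum, sum_comm, Int.cast_sum]
    refine sum_congr rfl fun x _ => ?_
    rw [← Int.cast_pow]
    congr 1
    have : (∑ b ∈ Icc 1 B, jacobiSym ((x : ℤ) + (b : ℕ)) D) ^ n =
      ∏ _j : Fin n, ∑ b ∈ Icc 1 B, jacobiSym ((x : ℤ) + (b : ℕ)) D := by simp
    rw [this, prod_univ_sum]
    refine sum_congr rfl fun t _ => ?_
    exact (map_prod (⟨⟨fun a => jacobiSym a D, jacobiSym.one_left D⟩,
      fun a b => jacobiSym.mul_left a b D⟩ : ℤ →* ℤ) _ _).symm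
  have hD0 : D ≠ 0 := hD.ne_zero
  have hDpos : (0 : ℝ) < D := by exact_mod_cast Nat.pos_of_ne_zero hD0
  have hcard : (Fintype.card (Fin n) : ℝ) = n := by simp
  set G : Fin n → (Fin n → ℕ) → ℕ := fun i t =>
    ∏ j, (if (t j : ℤ) = t i then 1 else D.gcd ((t i : ℤ) - t j).natAbs) with hG
  set Even' : (Fin n → ℕ) → Prop := fun t => ∀ i, Even #{j | t j = t i} with hEv
  have heven : ∑ t ∈ P.filter Even', S t ≤ (ℓ : ℝ) ^ n * (D * B ^ ℓ) := by
    calc ∑ t ∈ P.filter Even', S t ≤ ∑ t ∈ P.filter Even', (D : ℝ) := by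
          refine sum_le_sum fun t _ => ?_
          simp only [hSdef]
          rw [Int.cast_sum]
          calc _ ≤ ∑ x ∈ range D, (1 : ℝ) := sum_le_sum fun x _ => by
                rcases jacobiSym.trichotomy (∏ j, ((x : ℤ) + (t j : ℤ))) D with h | h | h <;>
                  simp [h]
            _ = D := by simp
      _ = #(P.filter Even') * (D : ℝ) := by rw [sum_const, nsmul_eq_mul]
      _ ≤ ((ℓ ^ n * B ^ ℓ : ℕ) : ℝ) * D := by
          gcongr
          exact card_even_maps_le ℓ B (Icc 1 B) (by simp) hB
      _ = _ := by
          push_cast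
          ring
  have hodd' : ∑ t ∈ P.filter (¬ Even' ·), S t ≤
      n * K₁ * 3 ^ n * K₂ ^ n * (√D * B ^ n * (D : ℝ) ^ η) := by
    calc ∑ t ∈ P.filter (¬ Even' ·), S t
        ≤ ∑ t ∈ P.filter (¬ Even' ·), ∑ i, K₁ * (D : ℝ) ^ (η / 2) * √D * G i t := by
          refine sum_le_sum fun t ht => ?_
          rw [mem_filter, hEv] at ht
          obtain ⟨i, hi⟩ := not_forall.1 ht.2
          rw [Nat.not_even_iff_odd] at hi
          have h1 := abs_sum_jacobiSym_le hD hodd (fun j => (t j : ℤ)) i (by simpa using hi)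
          refine le_trans ?_ (single_le_sum (f := fun i => K₁ * (D : ℝ) ^ (η / 2) * √D * G i t)
            (fun _ _ => by positivity) (mem_univ i))
          refine (le_abs_self _).trans (h1.trans ?_)
          rw [hcard]
          gcongr
          exact hK₁ D hD0
      _ ≤ ∑ t ∈ P, ∑ i, K₁ * (D : ℝ) ^ (η / 2) * √D * G i t :=
          sum_le_sum_of_subset_of_nonneg (filter_subset _ _) fun _ _ _ =>
            sum_nonneg fun _ _ => by positivity
      _ = K₁ * (D : ℝ) ^ (η / 2) * √D * ∑ i, ((∑ t ∈ P, G i t : ℕ) : ℝ) := by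
          rw [sum_comm, mul_sum]
          refine sum_congr rfl fun i _ => ?_
          rw [Nat.cast_sum, mul_sum]
      _ ≤ K₁ * (D : ℝ) ^ (η / 2) * √D * ∑ i : Fin n,
            (B : ℝ) ^ n * 3 ^ n * (K₂ ^ n * (D : ℝ) ^ (η / 2)) := by
          gcongr with i
          calc ((∑ t ∈ P, G i t : ℕ) : ℝ)
              ≤ ((B * (3 * (B * #D.divisors)) ^ (n - 1) : ℕ) : ℝ) := by
                exact Nat.cast_le.2 (sum_prod_gcd_le n D B hD0 i)
            _ ≤ ((B * (#D.divisors * 3) * (3 * (B * #D.divisors)) ^ (n - 1) : ℕ) : ℝ) := by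
                have hτ : 1 ≤ #D.divisors := card_pos.2 ⟨1, Nat.one_mem_divisors.2 hD0⟩
                gcongr
                exact Nat.le_mul_of_pos_right _ (by omega)
            _ = (B : ℝ) ^ n * 3 ^ n * (#D.divisors : ℝ) ^ n := by
                obtain ⟨w, hw⟩ : ∃ w, n = w + 1 := ⟨n - 1, by omega⟩
                rw [hw]
                push_cast [Nat.add_sub_cancel]
                ring
            _ ≤ (B : ℝ) ^ n * 3 ^ n * (K₂ * (D : ℝ) ^ (η / (2 * n))) ^ n := by
                gcongr
                exact hK₂ D hD0
            _ = _ := by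
                rw [mul_pow, ← Real.rpow_mul_natCast hDpos.le]
                congr 3
                have : (n : ℝ) ≠ 0 := by
                  rw [hn]
                  positivity
                field_simp
      _ = n * K₁ * 3 ^ n * K₂ ^ n * (√D * B ^ n * ((D : ℝ) ^ (η / 2) * (D : ℝ) ^ (η / 2))) := by
          rw [sum_const, card_univ, Fintype.card_fin, nsmul_eq_mul]
          ring
      _ = _ := by rw [← Real.rpow_add hDpos, add_halves]
  rw [hexp, ← sum_filter_add_sum_filter_not P Even']
  have hp1 : 0 ≤ (D : ℝ) * B ^ ℓ := by positivity
  have hp2 : 0 ≤ √D * (B : ℝ) ^ n * (D : ℝ) ^ η := by positivity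
  have hp3 : 0 ≤ (ℓ : ℝ) ^ n := by positivity
  have hp4 : 0 ≤ n * K₁ * 3 ^ n * K₂ ^ n := by positivity
  nlinarith [mul_nonneg hp3 hp2, mul_nonneg hp4 hp1]

end jacobiMoment

section amplification

open Finset

/-- The Jacobi symbol `J(· | D)` as a multiplicative function on `ZMod D`. -/
def jacobiHom (D : ℕ) : ZMod D →* ℤ where
  toFun x := jacobiSym (x.cast : ℤ) D
  map_one' := by
    rw [jacobiSym.mod_left, ← ZMod.coe_intCast]
    simp only [ZMod.intCast_cast, ZMod.cast_id', id_eq]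
    rw [show (1 : ZMod D) = ((1 : ℤ) : ZMod D) by simp, ZMod.coe_intCast, ← jacobiSym.mod_left,
      jacobiSym.one_left]
  map_mul' x y := by
    rw [← jacobiSym.mul_left, jacobiSym.mod_left, jacobiSym.mod_left ((x.cast : ℤ) * _),
      ← ZMod.coe_intCast, ← ZMod.coe_intCast]
    congr 2
    simp

theorem jacobiHom_intCast (D : ℕ) (a : ℤ) : jacobiHom D (a : ZMod D) = jacobiSym a D := by
  change jacobiSym ((a : ZMod D).cast : ℤ) D = _
  rw [ZMod.coe_intCast, ← jacobiSym.mod_left]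

theorem abs_jacobiHom_le_one (D : ℕ) (x : ZMod D) : |(jacobiHom D x : ℝ)| ≤ 1 := by
  change |(jacobiSym (x.cast : ℤ) D : ℝ)| ≤ 1
  rcases jacobiSym.trichotomy (x.cast : ℤ) D with h | h | h <;> simp [h]

/-- The quotients `(N₀ + n) / a` modulo `D`. -/
def quotientMod (D : ℕ) (N₀ : ℤ) (u : ℕ × ℕ) : ZMod D :=
  ((N₀ + u.2 : ℤ) : ZMod D) * ((u.1 : ZMod D))⁻¹

theorem quotientMod_eq_iff {D : ℕ} {N₀ : ℤ} {u v : ℕ × ℕ} (hu : u.1.Coprime D)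
    (hv : v.1.Coprime D) : quotientMod D N₀ u = quotientMod D N₀ v ↔
      (D : ℤ) ∣ v.1 * (N₀ + u.2) - u.1 * (N₀ + v.2) := by
  have hu' := (ZMod.isUnit_iff_coprime u.1 D).2 hu
  have hv' := (ZMod.isUnit_iff_coprime v.1 D).2 hv
  rw [← ZMod.intCast_zmod_eq_zero_iff_dvd]
  push_cast
  rw [sub_eq_zero, quotientMod, quotientMod]
  push_cast
  have h1 := ZMod.mul_inv_of_unit _ hu'
  have h2 := ZMod.mul_inv_of_unit _ hv'
  constructor
  · intro h
    calc (v.1 : ZMod D) * (N₀ + u.2)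
        = v.1 * u.1 * ((N₀ + u.2) * (u.1 : ZMod D)⁻¹) := by
          linear_combination (-(v.1 : ZMod D) * (N₀ + u.2)) * h1
      _ = _ := by
          rw [h]
          linear_combination ((u.1 : ZMod D) * (N₀ + v.2)) * h2
  · intro h
    linear_combination (u.1 : ZMod D)⁻¹ * (v.1 : ZMod D)⁻¹ * h
      - (N₀ + u.2) * (u.1 : ZMod D)⁻¹ * h2 + (N₀ + v.2) * (v.1 : ZMod D)⁻¹ * h1

theorem card_quotientMod_pairs_le {D A H : ℕ} (N₀ : ℤ) (hAH : 2 * (A * H) < D)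
    {a₁ a₂ : ℕ}
    (h₁ : a₁ ≤ A) (h₂ : a₂ ≤ A) (hc : a₁.Coprime a₂) (h₁D : a₁.Coprime D) (h₂D : a₂.Coprime D)
    (ha₁ : 0 < a₁) :
    #{w ∈ range H ×ˢ range H | quotientMod D N₀ (a₁, w.1) = quotientMod D N₀ (a₂, w.2)} ≤
      H / a₁ + 1 := by
  rw [← card_range (H / a₁ + 1)]
  refine card_le_card_of_injOn (fun w => w.1 / a₁) ?_ ?_
  · rintro ⟨n, n'⟩ hw
    simp only [coe_filter, mem_product, mem_range, Set.mem_ofPred_eq] at hw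
    simp only [coe_range, Set.mem_Iio]
    exact Nat.lt_succ_of_le (Nat.div_le_div_right hw.1.1.le)
  · rintro ⟨x, x'⟩ hx ⟨y, y'⟩ hy hxy
    simp only [coe_filter, mem_product, mem_range, Set.mem_ofPred_eq] at hx hy hxy
    have e1 := (quotientMod_eq_iff (u := (a₁, x)) (v := (a₂, x')) h₁D h₂D).1 hx.2
    have e2 := (quotientMod_eq_iff (u := (a₁, y)) (v := (a₂, y')) h₁D h₂D).1 hy.2
    have e3 := dvd_sub e1 e2
    simp only at e3
    have e4 : (a₂ * (N₀ + x) - a₁ * (N₀ + x') - (a₂ * (N₀ + y) - a₁ * (N₀ + y')) : ℤ) =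
        a₂ * (x - y) - a₁ * (x' - y') := by ring
    rw [e4] at e3
    have b1 : |(a₂ * (x - y) : ℤ)| ≤ A * H := by
      rw [abs_mul]
      refine mul_le_mul ?_ ?_ (abs_nonneg _) (by positivity)
      · rw [Nat.abs_cast]
        exact_mod_cast h₂
      · rw [abs_le]
        constructor <;> omega
    have b2 : |(a₁ * (x' - y') : ℤ)| ≤ A * H := by
      rw [abs_mul]
      refine mul_le_mul ?_ ?_ (abs_nonneg _) (by positivity)
      · rw [Nat.abs_cast]
        exact_mod_cast h₁
      · rw [abs_le]
        constructor <;> omega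
    have e5 : (a₂ * (x - y) - a₁ * (x' - y') : ℤ) = 0 := by
      refine Int.eq_zero_of_abs_lt_dvd e3 ((abs_sub _ _).trans_lt ?_)
      have : (2 * (A * H) : ℤ) < D := by exact_mod_cast hAH
      linarith
    have e6 : (a₁ : ℤ) ∣ x - y := by
      refine (Nat.isCoprime_iff_coprime.2 hc).dvd_of_dvd_mul_left (Dvd.intro (x' - y') ?_)
      linarith
    have e7 : x = y := by
      have hm : x % a₁ = y % a₁ := ((Nat.modEq_iff_dvd).2 e6).symm
      rw [← Nat.div_add_mod x a₁, ← Nat.div_add_mod y a₁, hxy, hm]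
    subst e7
    simp only [sub_self, mul_zero, zero_sub, neg_eq_zero, mul_eq_zero] at e5
    simp only [Prod.mk.injEq, true_and]
    rcases e5 with h | h <;> omega

theorem sum_sq_card_quotientMod_le {D A H : ℕ} [NeZero D] (N₀ : ℤ) (hAH : 2 * (A * H) < D)
    (hA : 0 < A)
    (hH : A ≤ H) (P : Finset ℕ) (hP : ∀ p ∈ P, p.Prime ∧ p ≤ A ∧ p.Coprime D) :
    ∑ x : ZMod D, (#{u ∈ P ×ˢ range H | quotientMod D N₀ u = x} : ℝ) ^ 2 ≤
      #P * H * (3 + Real.log A) := by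
  classical
  have hH0 : 0 < H := hA.trans_le hH
  have h1 : ∑ x : ZMod D, (#{u ∈ P ×ˢ range H | quotientMod D N₀ u = x} : ℝ) ^ 2 =
      ((∑ a₁ ∈ P, ∑ a₂ ∈ P, #{w ∈ range H ×ˢ range H |
        quotientMod D N₀ (a₁, w.1) = quotientMod D N₀ (a₂, w.2)} : ℕ) : ℝ) := by
    have e1 : ∀ x : ZMod D, (#{u ∈ P ×ˢ range H | quotientMod D N₀ u = x}) ^ 2 =
        ∑ u ∈ P ×ˢ range H, ∑ v ∈ P ×ˢ range H, (if quotientMod D N₀ u = x then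
          (if quotientMod D N₀ v = quotientMod D N₀ u then 1 else 0) else 0) := fun x => by
      rw [card_filter, sq, sum_mul_sum]
      refine sum_congr rfl fun u _ => sum_congr rfl fun v _ => ?_
      by_cases h : quotientMod D N₀ u = x
      · simp [h]
      · simp [h]
    have e2 : ∑ x : ZMod D, (#{u ∈ P ×ˢ range H | quotientMod D N₀ u = x}) ^ 2 =
        ∑ a₁ ∈ P, ∑ a₂ ∈ P, #{w ∈ range H ×ˢ range H |
          quotientMod D N₀ (a₁, w.1) = quotientMod D N₀ (a₂, w.2)} := by
      simp only [e1]
      rw [sum_comm]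
      simp only [sum_comm (s := (univ : Finset (ZMod D)))]
      simp only [sum_ite_eq, mem_univ, if_true, sum_product, card_filter]
      refine sum_congr rfl fun a₁ _ => ?_
      rw [sum_comm]
      refine sum_congr rfl fun a₂ _ => ?_
      refine sum_congr rfl fun n _ => sum_congr rfl fun n' _ => ?_
      simp only [eq_comm]
    rw [← e2]
    push_cast
    rfl
  have h2 : ∀ a₁ ∈ P, ∀ a₂ ∈ P, a₁ ≠ a₂ → #{w ∈ range H ×ˢ range H |
        quotientMod D N₀ (a₁, w.1) = quotientMod D N₀ (a₂, w.2)} ≤ H / a₁ + 1 :=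
    fun a₁ h₁ a₂ h₂ hne =>
      card_quotientMod_pairs_le N₀ hAH (hP _ h₁).2.1 (hP _ h₂).2.1
        ((Nat.coprime_primes (hP _ h₁).1 (hP _ h₂).1).2 hne) (hP _ h₁).2.2 (hP _ h₂).2.2
        (hP _ h₁).1.pos
  have h3 : ∀ a ∈ P, #{w ∈ range H ×ˢ range H |
        quotientMod D N₀ (a, w.1) = quotientMod D N₀ (a, w.2)} ≤ H := fun a ha => by
    refine le_of_le_of_eq (card_le_card_of_injOn (t := range H) Prod.fst (fun w hw => ?_) ?_)
      (card_range H)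
    · simp only [coe_filter, mem_product, Set.mem_ofPred_eq] at hw
      exact mem_coe.2 hw.1.1
    · rintro ⟨x, x'⟩ hx ⟨y, y'⟩ hy hxy
      simp only [coe_filter, mem_product, mem_range, Set.mem_ofPred_eq] at hx hy hxy
      subst hxy
      have e0 : quotientMod D N₀ (a, x') = quotientMod D N₀ (a, y') := hx.2.symm.trans hy.2
      have e1 := (quotientMod_eq_iff (hP a ha).2.2 (hP a ha).2.2).1 e0
      simp only at e1
      have e2 : (a * (N₀ + x') - a * (N₀ + y') : ℤ) = a * (x' - y') := by ring
      rw [e2] at e1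
      have e3 : (D : ℤ) ∣ x' - y' :=
        (Nat.isCoprime_iff_coprime.2 (hP a ha).2.2.symm).dvd_of_dvd_mul_left e1
      have hHD : H < D := by nlinarith
      have e4 := Int.eq_zero_of_abs_lt_dvd e3 (by
        rw [abs_lt]
        constructor <;> omega)
      simp only [Prod.mk.injEq, true_and]
      omega
  have hharm : ∑ a ∈ P, (1 / a : ℝ) ≤ 1 + Real.log A := by
    have e1 := harmonic_le_one_add_log A
    rw [harmonic_eq_sum_Icc] at e1
    push_cast at e1
    refine le_trans ?_ e1
    simp only [one_div]
    refine sum_le_sum_of_subset_of_nonneg (fun p hp => ?_) fun _ _ _ => by positivity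
    exact mem_Icc.2 ⟨(hP p hp).1.one_le, (hP p hp).2.1⟩
  have hPA : #P ≤ A := by
    calc #P ≤ #(Icc 1 A) := card_le_card fun p hp =>
          mem_Icc.2 ⟨(hP p hp).1.one_le, (hP p hp).2.1⟩
      _ = A := by simp
  rw [h1]
  calc ((∑ a₁ ∈ P, ∑ a₂ ∈ P, #{w ∈ range H ×ˢ range H |
        quotientMod D N₀ (a₁, w.1) = quotientMod D N₀ (a₂, w.2)} : ℕ) : ℝ)
      ≤ ∑ a₁ ∈ P, ∑ a₂ ∈ P, ((H * (1 / a₁) + 1) + if a₁ = a₂ then (H : ℝ) else 0) := by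
        push_cast
        refine sum_le_sum fun a₁ h₁ => sum_le_sum fun a₂ h₂ => ?_
        by_cases h : a₁ = a₂
        · subst h
          rw [if_pos rfl]
          have e1 : (#{w ∈ range H ×ˢ range H |
            quotientMod D N₀ (a₁, w.1) = quotientMod D N₀ (a₁, w.2)} : ℝ) ≤ H := by
            exact_mod_cast h3 a₁ h₁
          have : (0 : ℝ) ≤ H * (1 / a₁) + 1 := by positivity
          linarith
        · rw [if_neg h, add_zero]
          have e1 : (#{w ∈ range H ×ˢ range H |
            quotientMod D N₀ (a₁, w.1) = quotientMod D N₀ (a₂, w.2)} : ℝ) ≤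
              ((H / a₁ + 1 : ℕ) : ℝ) := by
            exact_mod_cast h2 a₁ h₁ a₂ h₂ h
          refine e1.trans ?_
          push_cast
          rw [mul_one_div]
          gcongr
          exact Nat.cast_div_le
    _ = #P * (H * ∑ a ∈ P, (1 / a : ℝ)) + #P * #P + #P * H := by
        simp only [sum_add_distrib, sum_const, sum_ite_eq, nsmul_eq_mul, mul_one]
        rw [← mul_sum, ← mul_sum]
        congr 1
        rw [sum_ite_mem, inter_self, sum_const, nsmul_eq_mul]
    _ ≤ #P * (H * (1 + Real.log A)) + #P * H + #P * H := by
        gcongr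
        exact_mod_cast hPA.trans hH
    _ = _ := by ring

/-- The amplification inequality of Burgess. -/
theorem amplification {D A H B ℓ : ℕ} [NeZero D] (N₀ : ℤ) (hAH : 2 * (A * H) < D)
    (hA : 0 < A) (hH : A ≤ H) (P : Finset ℕ) (hP : ∀ p ∈ P, p.Prime ∧ p ≤ A ∧ p.Coprime D)
    (hℓ : ℓ ≠ 0) (hPne : P.Nonempty) (hB : B ≠ 0) :
    ∃ T : ℝ, 0 ≤ T ∧
      |∑ n ∈ range H, (jacobiSym (N₀ + n) D : ℝ)| ≤ H / B * T + 2 * (A * B) ∧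
      T ^ (2 * ℓ) ≤ (3 + Real.log A) / (#P * H) *
        ∑ x ∈ range D, ((∑ b ∈ Icc 1 B, jacobiSym ((x : ℤ) + (b : ℕ)) D : ℤ) : ℝ) ^ (2 * ℓ) := by
  classical
  have hH0 : 0 < H := hA.trans_le hH
  set f : ZMod D → ℝ := fun x => |∑ b ∈ Icc 1 B, (jacobiHom D (x + (b : ℕ)) : ℝ)| with hf
  set U := P ×ˢ range H with hU
  have hUc : (#U : ℝ) = #P * H := by simp [hU, card_product]
  have hUpos : (0 : ℝ) < #P * H := by
    have := card_pos.2 hPne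
    positivity
  have hshift : ∀ t : ℕ, |∑ n ∈ range H, (jacobiSym (N₀ + n) D : ℝ) -
      ∑ n ∈ range H, (jacobiSym (N₀ + n + t) D : ℝ)| ≤ 2 * t := fun t => by
    have hle : ∀ a : ℤ, |(jacobiSym a D : ℝ)| ≤ 1 := fun a => by
      rcases jacobiSym.trichotomy a D with h | h | h <;> simp [h]
    induction t with
    | zero => simp
    | succ t ih =>
      have e1 := sum_range_succ' (fun n : ℕ => (jacobiSym (N₀ + n + t) D : ℝ)) H
      have e2 := sum_range_succ (fun n : ℕ => (jacobiSym (N₀ + n + t) D : ℝ)) H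
      have e3 : ∑ n ∈ range H, (jacobiSym (N₀ + n + (t + 1 : ℕ)) D : ℝ) =
          ∑ n ∈ range H, (jacobiSym (N₀ + (n + 1 : ℕ) + t) D : ℝ) := by
        refine sum_congr rfl fun n _ => ?_
        congr 2
        push_cast
        ring
      rw [e3, Nat.cast_succ]
      have e4 := abs_le.1 (hle (N₀ + (0 : ℕ) + t))
      have e5 := abs_le.1 (hle (N₀ + H + t))
      rw [abs_le] at ih ⊢
      constructor <;> linarith
  refine ⟨(∑ u ∈ U, f (quotientMod D N₀ u)) / (#P * H), ?_, ?_, ?_⟩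
  · exact div_nonneg (sum_nonneg fun _ _ => abs_nonneg _) hUpos.le
  · have hP0 : (0 : ℝ) < #P := by exact_mod_cast card_pos.2 hPne
    have hB0 : (0 : ℝ) < B := by exact_mod_cast Nat.pos_of_ne_zero hB
    have hHr : (0 : ℝ) < H := by exact_mod_cast hH0
    set S := ∑ n ∈ range H, (jacobiSym (N₀ + n) D : ℝ) with hS
    have e1 : #P * (B * S) = ∑ a ∈ P, ∑ b ∈ Icc 1 B,
          (S - ∑ n ∈ range H, (jacobiSym (N₀ + n + (a * b : ℕ)) D : ℝ)) +
        ∑ a ∈ P, ∑ b ∈ Icc 1 B, ∑ n ∈ range H, (jacobiSym (N₀ + n + (a * b : ℕ)) D : ℝ) := by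
      simp only [sum_sub_distrib, sub_add_cancel, sum_const, nsmul_eq_mul, Nat.card_Icc,
        Nat.add_sub_cancel]
    have e2 : |∑ a ∈ P, ∑ b ∈ Icc 1 B,
          (S - ∑ n ∈ range H, (jacobiSym (N₀ + n + (a * b : ℕ)) D : ℝ))| ≤
        #P * (B * (2 * (A * B))) := by
      refine (abs_sum_le_sum_abs _ _).trans ?_
      calc _ ≤ ∑ a ∈ P, ∑ b ∈ Icc 1 B, (2 * (A * B) : ℝ) := by
            refine sum_le_sum fun a ha => (abs_sum_le_sum_abs _ _).trans
              (sum_le_sum fun b hb => (hshift _).trans ?_)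
            push_cast
            have h1 : (a : ℝ) ≤ A := by exact_mod_cast (hP a ha).2.1
            have h2 : (b : ℝ) ≤ B := by exact_mod_cast (mem_Icc.1 hb).2
            gcongr
        _ = _ := by simp
    have e3 : |∑ a ∈ P, ∑ b ∈ Icc 1 B, ∑ n ∈ range H,
        (jacobiSym (N₀ + n + (a * b : ℕ)) D : ℝ)| ≤ ∑ u ∈ U, f (quotientMod D N₀ u) := by
      rw [hU, sum_product]
      refine (abs_sum_le_sum_abs _ _).trans (sum_le_sum fun a ha => ?_)
      rw [sum_comm]
      refine (abs_sum_le_sum_abs _ _).trans (sum_le_sum fun n _ => ?_)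
      have hu := (ZMod.isUnit_iff_coprime a D).2 (hP a ha).2.2
      have h1 : ∀ b : ℕ, (jacobiSym (N₀ + n + (a * b : ℕ)) D : ℝ) =
          jacobiHom D (a : ZMod D) * jacobiHom D (quotientMod D N₀ (a, n) + (b : ℕ)) := fun b => by
        rw [← jacobiHom_intCast, ← Int.cast_mul, ← map_mul]
        congr 2
        rw [quotientMod]
        push_cast
        linear_combination (-((N₀ : ZMod D) + n)) * ZMod.mul_inv_of_unit _ hu
      simp only [h1]
      rw [← mul_sum, abs_mul]
      exact mul_le_of_le_one_left (abs_nonneg _) (abs_jacobiHom_le_one _ _)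
    have e4 : #P * (B * |S|) ≤ #P * (B * (2 * (A * B))) + ∑ u ∈ U, f (quotientMod D N₀ u) := by
      have : #P * (B * |S|) = |#P * (B * S)| := by
        rw [abs_mul, abs_mul, Nat.abs_cast, Nat.abs_cast]
      rw [this, e1]
      exact (abs_add_le _ _).trans (add_le_add e2 e3)
    have e5 : (H / B * ((∑ u ∈ U, f (quotientMod D N₀ u)) / (#P * H)) + 2 * (A * B) : ℝ) =
        (#P * (B * (2 * (A * B))) + ∑ u ∈ U, f (quotientMod D N₀ u)) / (#P * B) := by
      field_simp
      ring
    rw [e5, le_div_iff₀ (by positivity)]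
    linarith
  · set T := ∑ u ∈ U, f (quotientMod D N₀ u) with hT
    have hT0 : 0 ≤ T := sum_nonneg fun _ _ => abs_nonneg _
    obtain ⟨w, hw⟩ := Nat.exists_eq_succ_of_ne_zero hℓ
    have e1 : T ^ ℓ ≤ (#P * H) ^ w * ∑ u ∈ U, f (quotientMod D N₀ u) ^ ℓ := by
      have := pow_sum_div_card_le_sum_pow (s := U) (f := fun u => f (quotientMod D N₀ u))
        (fun _ _ => abs_nonneg _) w
      rw [hUc, div_le_iff₀ (by positivity), ← Nat.succ_eq_add_one, ← hw] at this
      linarith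
    have e2 : ∑ u ∈ U, f (quotientMod D N₀ u) ^ ℓ =
        ∑ x : ZMod D, (#{u ∈ U | quotientMod D N₀ u = x} : ℝ) * f x ^ ℓ := by
      rw [← sum_fiberwise U (quotientMod D N₀)]
      refine sum_congr rfl fun x _ => ?_
      rw [← nsmul_eq_mul, ← sum_const]
      refine sum_congr rfl fun u hu => ?_
      rw [(mem_filter.1 hu).2]
    have e3 := sum_mul_sq_le_sq_mul_sq univ
      (fun x : ZMod D => (#{u ∈ U | quotientMod D N₀ u = x} : ℝ)) (fun x => f x ^ ℓ)
    have e4 := sum_sq_card_quotientMod_le N₀ hAH hA hH P hP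
    have e5 : ∑ x : ZMod D, (f x ^ ℓ) ^ 2 =
        ∑ x ∈ range D, ((∑ b ∈ Icc 1 B, jacobiSym ((x : ℤ) + (b : ℕ)) D : ℤ) : ℝ) ^ (2 * ℓ) := by
      symm
      refine sum_bij' (fun x _ => (x : ZMod D)) (fun x _ => x.val) ?_ ?_ ?_ ?_ ?_
      · simp
      · intro x _
        simpa using ZMod.val_lt x
      · intro x hx
        exact ZMod.val_cast_of_lt (mem_range.1 hx)
      · intro x _
        exact ZMod.natCast_zmod_val x
      · intro x _
        simp only [hf]
        rw [← pow_mul, mul_comm ℓ 2, pow_mul, pow_mul, sq_abs]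
        congr 2
        push_cast
        refine sum_congr rfl fun b _ => ?_
        rw [← jacobiHom_intCast]
        push_cast
        rfl
    set M := ∑ x ∈ range D,
      ((∑ b ∈ Icc 1 B, jacobiSym ((x : ℤ) + (b : ℕ)) D : ℤ) : ℝ) ^ (2 * ℓ) with hM
    have hM0 : 0 ≤ M := by
      rw [← e5]
      exact sum_nonneg fun _ _ => sq_nonneg _
    rw [e5] at e3
    rw [div_pow, div_le_iff₀ (by positivity)]
    calc T ^ (2 * ℓ) = (T ^ ℓ) ^ 2 := by rw [← pow_mul, mul_comm]
      _ ≤ ((#P * H) ^ w * ∑ u ∈ U, f (quotientMod D N₀ u) ^ ℓ) ^ 2 := by gcongr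
      _ = (#P * H) ^ (2 * w) * (∑ u ∈ U, f (quotientMod D N₀ u) ^ ℓ) ^ 2 := by
          rw [mul_pow, ← pow_mul, mul_comm w]
      _ ≤ (#P * H) ^ (2 * w) * ((#P * H * (3 + Real.log A)) * M) := by
          rw [e2]
          gcongr
          exact e3.trans (mul_le_mul_of_nonneg_right e4 hM0)
      _ = _ := by
          rw [hw]
          have : (#P * H : ℝ) ≠ 0 := hUpos.ne'
          generalize (#P * H : ℝ) = z at this
          rw [Nat.succ_eq_add_one]
          field_simp
          ring

end amplification

section burgess

open Finset

theorem exists_rpow_le_primeCounting (η : ℝ) (hη : 0 < η) :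
    ∃ K : ℝ, 1 ≤ K ∧ ∀ A : ℕ, 2 ≤ A → (A : ℝ) ^ (1 - η) ≤ K * A.primeCounting := by
  refine ⟨4 + 8 / η, by have : 0 < 8 / η := by positivity
                        linarith, fun A hA => ?_⟩
  have hA0 : (0 : ℝ) < A := by positivity
  have hA2 : (2 : ℝ) ≤ A := by exact_mod_cast hA
  have hη8 : 0 < 8 / η := by positivity
  by_cases h5 : A < 5
  · have h1 : 1 ≤ A.primeCounting := by
      have : Nat.primeCounting 2 ≤ A.primeCounting := Nat.monotone_primeCounting hA
      exact (by decide : 1 ≤ Nat.primeCounting 2).trans this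
    have h2 : (1 : ℝ) ≤ A.primeCounting := by exact_mod_cast h1
    have h3 : (A : ℝ) ≤ 4 := by exact_mod_cast Nat.lt_succ_iff.1 h5
    calc (A : ℝ) ^ (1 - η) ≤ (A : ℝ) ^ (1 : ℝ) :=
          Real.rpow_le_rpow_of_exponent_le (by linarith) (by linarith)
      _ ≤ 4 := by rwa [Real.rpow_one]
      _ ≤ _ := by nlinarith
  · have hA5 : (5 : ℝ) ≤ A := by exact_mod_cast not_lt.1 h5
    have h1 := Chebyshev.pi_ge' (x := A) (by linarith)
    rw [Nat.floor_natCast] at h1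
    have hl2 := Real.log_two_gt_d9
    have hl2' := Real.log_two_lt_d9
    have h2 : Real.log (A + 2) ≤ (A + 2) / 8 - 1 + 3 * Real.log 2 := by
      have e1 : Real.log (A + 2) = Real.log ((A + 2) / 8) + 3 * Real.log 2 := by
        have e2 : (3 : ℝ) * Real.log 2 = Real.log 8 := by
          rw [show (8 : ℝ) = 2 ^ 3 by norm_num, Real.log_pow]
          norm_num
        rw [e2, ← Real.log_mul (by positivity) (by norm_num)]
        congr 1
        ring
      rw [e1]
      linarith [Real.log_le_sub_one_of_pos (show 0 < ((A : ℝ) + 2) / 8 by positivity)]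
    have hlA : 0 < Real.log A := Real.log_pos (by linarith)
    have h3 : (A : ℝ) / 8 ≤ (A - 1) * Real.log 2 - Real.log (A + 2) := by nlinarith
    have h4 := Real.log_le_rpow_div hA0.le hη
    have hAη : 0 < (A : ℝ) ^ η := by positivity
    have h5 : (A : ℝ) / 8 / ((A : ℝ) ^ η / η) ≤ A.primeCounting :=
      (div_le_div₀ (by linarith) h3 hlA h4).trans h1
    have h6 : (A : ℝ) ^ (1 - η) = 8 / η * ((A : ℝ) / 8 / ((A : ℝ) ^ η / η)) := by
      rw [Real.rpow_sub hA0, Real.rpow_one]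
      field_simp
    rw [h6]
    gcongr
    linarith

theorem natCeil_le_two_mul {x : ℝ} (hx : 1 ≤ x) : (⌈x⌉₊ : ℝ) ≤ 2 * x := by
  have := (Nat.ceil_lt_add_one (by linarith : 0 ≤ x)).le
  linarith

set_option maxHeartbeats 1000000 in
theorem exists_burgess_core (ε : ℝ) (hε : 0 < ε) (hε8 : ε ≤ 1 / 8) :
    ∃ δ K : ℝ, ∃ D₀ : ℕ, 0 < δ ∧ δ ≤ 1 ∧ 0 < K ∧ ∀ D : ℕ, D₀ ≤ D → Squarefree D → Odd D →
      ∀ N₀ : ℤ, |∑ n ∈ range ⌈(D : ℝ) ^ (1 / 4 + ε)⌉₊, (jacobiSym (N₀ + n) D : ℝ)| ≤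
        K * ⌈(D : ℝ) ^ (1 / 4 + ε)⌉₊ * (D : ℝ) ^ (-δ) := by
  set ℓ : ℕ := ⌈1 / ε⌉₊ with hℓdef
  have hℓε : 1 / ε ≤ ℓ := Nat.le_ceil _
  have hℓ8 : (8 : ℝ) ≤ ℓ := by
    refine le_trans ?_ hℓε
    rw [le_div_iff₀ hε]
    linarith
  have hℓ0 : ℓ ≠ 0 := by
    rintro h
    rw [h] at hℓ8
    norm_num at hℓ8
  have hℓpos : (0 : ℝ) < ℓ := by linarith
  set η := ε / 12 with hη
  have hη0 : 0 < η := by positivity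
  obtain ⟨K₁, hK₁1, hK₁⟩ := exists_rpow_le_primeCounting η hη0
  obtain ⟨K₂, hK₂1, hK₂⟩ := exists_pow_card_primeFactors_le 2 (1 / 32) one_le_two (by norm_num)
  obtain ⟨Km, hKm1, hKm⟩ := exists_moment_le ℓ hℓ0 η hη0
  set K₄ : ℝ := 3 + 1 / η with hK₄
  have hK₄1 : 1 ≤ K₄ := by
    have : 0 < 1 / η := by positivity
    linarith
  set K₅ : ℝ := K₄ * (8 * K₁) * (Km * 2 ^ (2 * ℓ + 1)) with hK₅
  have hK₅1 : 1 ≤ K₅ := by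
    refine one_le_mul_of_one_le_of_one_le (one_le_mul_of_one_le_of_one_le hK₄1 (by linarith))
      (one_le_mul_of_one_le_of_one_le hKm1 (one_le_pow₀ one_le_two))
  refine ⟨ε / (2 * ℓ), K₅ + 2, max (4 ^ 8) ⌈(2 * K₁ * K₂) ^ 32⌉₊, by positivity, ?_, by linarith,
    fun D hD hsq hodd N₀ => ?_⟩
  · rw [div_le_one (by positivity)]
    linarith
  set L : ℝ := (D : ℝ) with hL
  have hL48 : (4 : ℝ) ^ 8 ≤ L := by
    rw [hL]
    exact_mod_cast (le_max_left _ _).trans hD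
  have hLK : (2 * K₁ * K₂) ^ 32 ≤ L := (Nat.le_ceil _).trans
    (by
      rw [hL]
      exact_mod_cast (le_max_right _ _).trans hD)
  have hL1 : 1 ≤ L := le_trans (by norm_num) hL48
  have hL0 : 0 < L := by linarith
  have hD0 : D ≠ 0 := hsq.ne_zero
  have : NeZero D := ⟨hD0⟩
  have mono : ∀ {s t : ℝ}, s ≤ t → L ^ s ≤ L ^ t := fun h =>
    Real.rpow_le_rpow_of_exponent_le hL1 h
  have one_le : ∀ {s : ℝ}, 0 ≤ s → 1 ≤ L ^ s := fun h => Real.one_le_rpow hL1 h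
  have hL8 : 4 ≤ L ^ (1 / 8 : ℝ) := by
    calc (4 : ℝ) = ((4 : ℝ) ^ 8) ^ (1 / 8 : ℝ) := by
          rw [← Real.rpow_natCast, ← Real.rpow_mul (by norm_num)]
          norm_num
      _ ≤ _ := by gcongr
  have hL32 : 2 * K₁ * K₂ ≤ L ^ (1 / 32 : ℝ) := by
    have h0 : 0 ≤ 2 * K₁ * K₂ := by positivity
    calc 2 * K₁ * K₂ = ((2 * K₁ * K₂) ^ 32) ^ (1 / 32 : ℝ) := by
          rw [← Real.rpow_natCast, ← Real.rpow_mul h0]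
          norm_num
      _ ≤ _ := by gcongr
  set H : ℕ := ⌈L ^ (1 / 4 + ε)⌉₊ with hH
  have hH1 : L ^ (1 / 4 + ε) ≤ H := Nat.le_ceil _
  have hH2 : (H : ℝ) ≤ 2 * L ^ (1 / 4 + ε) := natCeil_le_two_mul (one_le (by linarith))
  set s : ℝ := 1 / (2 * ℓ) with hs
  have hs0 : 0 < s := by positivity
  have hsε : s ≤ ε / 2 := by
    rw [hs, div_le_iff₀ (by positivity)]
    rw [div_le_iff₀ hε] at hℓε
    linarith
  set B : ℕ := ⌈L ^ s⌉₊ with hB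
  have hB1 : L ^ s ≤ B := Nat.le_ceil _
  have hB2 : (B : ℝ) ≤ 2 * L ^ s := natCeil_le_two_mul (one_le hs0.le)
  have hBpos : (0 : ℝ) < B := lt_of_lt_of_le (by positivity) hB1
  have hBge1 : (1 : ℝ) ≤ B := (one_le hs0.le).trans hB1
  have hB0 : B ≠ 0 := by
    rintro h
    rw [h] at hBpos
    norm_num at hBpos
  have hHpos : (0 : ℝ) < H := lt_of_lt_of_le (by positivity) hH1
  set z : ℝ := H * L ^ (-(ε / 4)) / B with hz
  have hz1 : 2 * L ^ (1 / 8 : ℝ) ≤ z := by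
    rw [hz, le_div_iff₀ hBpos]
    calc 2 * L ^ (1 / 8 : ℝ) * B ≤ L ^ (1 / 8 : ℝ) * L ^ (1 / 8 : ℝ) * L ^ s := by
          nlinarith [mul_le_mul_of_nonneg_left hB2 (show 0 ≤ 2 * L ^ (1 / 8 : ℝ) by positivity),
            mul_le_mul_of_nonneg_right hL8 (show 0 ≤ L ^ (1 / 8 : ℝ) * L ^ s by positivity)]
      _ = L ^ (1 / 4 + s) := by
          rw [← Real.rpow_add hL0, ← Real.rpow_add hL0]
          norm_num
      _ ≤ L ^ (1 / 4 + ε + -(ε / 4)) := mono (by linarith)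
      _ = L ^ (1 / 4 + ε) * L ^ (-(ε / 4)) := Real.rpow_add hL0 _ _
      _ ≤ _ := by gcongr
  set A : ℕ := ⌊z⌋₊ with hA
  have hz0 : 0 ≤ z := by positivity
  have hAz : (A : ℝ) ≤ z := Nat.floor_le hz0
  have hAz' : z / 2 ≤ A := by
    have := Nat.lt_floor_add_one z
    rw [← hA] at this
    linarith
  have hA8 : L ^ (1 / 8 : ℝ) ≤ A := by linarith
  have hA2 : 2 ≤ A := by
    have : (2 : ℝ) ≤ A := by linarith
    exact_mod_cast this
  have hApos : (0 : ℝ) < A := by positivity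
  have hAB : (A : ℝ) * B ≤ H * L ^ (-(ε / 4)) := by
    rw [hz, le_div_iff₀ hBpos] at hAz
    exact hAz
  have hAH : (A : ℝ) ≤ H := by
    refine hAz.trans ?_
    rw [hz, div_le_iff₀ hBpos]
    gcongr
    exact (Real.rpow_le_one_of_one_le_of_nonpos hL1 (by linarith)).trans hBge1
  have hHL : (2 : ℝ) * (H * H) < L := by
    calc (2 : ℝ) * (H * H) ≤ 2 * ((2 * L ^ (1 / 4 + ε)) * (2 * L ^ (1 / 4 + ε))) := by gcongr
      _ = 8 * L ^ (1 / 2 + 2 * ε) := by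
          rw [show (1 : ℝ) / 2 + 2 * ε = (1 / 4 + ε) + (1 / 4 + ε) by ring,
            Real.rpow_add hL0 (1 / 4 + ε)]
          ring
      _ ≤ 8 * L ^ (3 / 4 : ℝ) := by
          gcongr ?_ * ?_
          exact mono (by linarith)
      _ < (L ^ (1 / 8 : ℝ) * L ^ (1 / 8 : ℝ)) * L ^ (3 / 4 : ℝ) := by
          gcongr
          nlinarith
      _ = L := by
          rw [← Real.rpow_add hL0, ← Real.rpow_add hL0]
          norm_num
  have hAL : (A : ℝ) ≤ L := by
    have h1 : (1 : ℝ) ≤ H := (one_le (by linarith)).trans hH1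
    have h2 : (H : ℝ) ≤ H * H := le_mul_of_one_le_left hHpos.le h1
    linarith
  have hAHD : 2 * (A * H) < D := by
    have : (2 * (A * H) : ℝ) < D := lt_of_le_of_lt (by gcongr) hHL
    exact_mod_cast this
  set P : Finset ℕ := (Nat.primesBelow (A + 1)) \ D.primeFactors with hPdef
  have hP : ∀ p ∈ P, p.Prime ∧ p ≤ A ∧ p.Coprime D := fun p hp => by
    rw [hPdef, mem_sdiff, Nat.mem_primesBelow, Nat.mem_primeFactors] at hp
    refine ⟨hp.1.2, Nat.lt_succ_iff.1 hp.1.1, ?_⟩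
    rw [hp.1.2.coprime_iff_not_dvd]
    exact fun h => hp.2 ⟨hp.1.2, h, hD0⟩
  have hPcard : A.primeCounting ≤ #P + #D.primeFactors := by
    have h1 : A.primeCounting = #(Nat.primesBelow (A + 1)) := by
      rw [Nat.primesBelow_card_eq_primeCounting']
      rfl
    rw [h1]
    exact Nat.sub_le_iff_le_add.1 (le_card_sdiff D.primeFactors (Nat.primesBelow (A + 1)))
  have hω : (#D.primeFactors : ℝ) ≤ K₂ * L ^ (1 / 32 : ℝ) := by
    refine le_trans ?_ (hK₂ D hD0)
    exact_mod_cast Nat.lt_two_pow_self.le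
  have hπ : (A : ℝ) ^ (1 - η) ≤ K₁ * A.primeCounting := hK₁ A hA2
  have hAη : L ^ (1 / 16 : ℝ) ≤ (A : ℝ) ^ (1 - η) := by
    calc L ^ (1 / 16 : ℝ) ≤ L ^ ((1 / 8 : ℝ) * (1 - η)) := mono (by linarith)
      _ = (L ^ (1 / 8 : ℝ)) ^ (1 - η) := Real.rpow_mul hL0.le _ _
      _ ≤ _ := by
          gcongr
          linarith
  have hV : (A : ℝ) ^ (1 - η) ≤ 2 * K₁ * #P := by
    have h1 : (A.primeCounting : ℝ) ≤ #P + #D.primeFactors := by exact_mod_cast hPcard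
    have h2 : 2 * K₁ * (K₂ * L ^ (1 / 32 : ℝ)) ≤ (A : ℝ) ^ (1 - η) := by
      refine le_trans ?_ hAη
      calc 2 * K₁ * (K₂ * L ^ (1 / 32 : ℝ)) = 2 * K₁ * K₂ * L ^ (1 / 32 : ℝ) := by ring
        _ ≤ L ^ (1 / 32 : ℝ) * L ^ (1 / 32 : ℝ) := by gcongr
        _ = _ := by
            rw [← Real.rpow_add hL0]
            norm_num
    have h3 := mul_le_mul_of_nonneg_left (h1.trans (add_le_add_right hω _))
      (show 0 ≤ K₁ by linarith)
    linarith
  have hVpos : (0 : ℝ) < #P := by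
    have : 0 < (A : ℝ) ^ (1 - η) := by positivity
    by_contra h
    have h0 : (#P : ℝ) = 0 := le_antisymm (not_lt.1 h) (Nat.cast_nonneg _)
    rw [h0] at hV
    linarith
  have hPne : P.Nonempty := card_pos.1 (by exact_mod_cast hVpos)
  obtain ⟨T, hT0, hT1, hT2⟩ := amplification N₀ hAHD (by omega)
    (by exact_mod_cast hAH) P hP hℓ0 hPne hB0
  have hVH : L ^ (1 / 2 + 2 * ε - ε / 4 - η - s) ≤ 8 * K₁ * (#P * H) := by
    have h1 : (A : ℝ) * L ^ (-η) ≤ 2 * K₁ * #P := by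
      refine le_trans ?_ hV
      rw [sub_eq_add_neg, Real.rpow_add hApos, Real.rpow_one]
      gcongr ?_ * ?_
      exact Real.rpow_le_rpow_of_nonpos hApos hAL (by linarith)
    have h2 : L ^ (1 / 4 + ε) * L ^ (-(ε / 4)) ≤ 4 * (L ^ s * A) := by
      have h3 : H * L ^ (-(ε / 4)) ≤ 2 * A * B := by
        rw [← div_le_iff₀ hBpos]
        linarith
      calc _ ≤ H * L ^ (-(ε / 4)) := by gcongr
        _ ≤ 2 * A * B := h3
        _ ≤ 2 * A * (2 * L ^ s) := by gcongr
        _ = _ := by ring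
    calc L ^ (1 / 2 + 2 * ε - ε / 4 - η - s)
        = L ^ (1 / 4 + ε) * L ^ (-(ε / 4)) * (L ^ (-η) * L ^ (-s) * L ^ (1 / 4 + ε)) := by
          rw [← Real.rpow_add hL0, ← Real.rpow_add hL0, ← Real.rpow_add hL0, ← Real.rpow_add hL0]
          congr 1
          ring
      _ ≤ 4 * (L ^ s * A) * (L ^ (-η) * L ^ (-s) * H) := by gcongr
      _ = 4 * (L ^ s * L ^ (-s)) * (A * L ^ (-η)) * H := by ring
      _ = 4 * (A * L ^ (-η)) * H := by
          rw [← Real.rpow_add hL0, add_neg_cancel, Real.rpow_zero]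
          ring
      _ ≤ 4 * (2 * K₁ * #P) * H := by gcongr
      _ = _ := by ring
  have hMom := hKm D hsq hodd B hB0
  have hMom2 : K₄ * L ^ η * (Km * (L * B ^ ℓ + √L * B ^ (2 * ℓ) * L ^ η)) ≤
      K₄ * L ^ η * (Km * 2 ^ (2 * ℓ + 1) * L ^ (3 / 2 + η)) := by
    have e0 : (L ^ s) ^ ℓ = L ^ (1 / 2 : ℝ) := by
      rw [← Real.rpow_natCast, ← Real.rpow_mul hL0.le, hs]
      congr 1
      field_simp
    have e1 : (B : ℝ) ^ ℓ ≤ 2 ^ ℓ * L ^ (1 / 2 : ℝ) := by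
      calc (B : ℝ) ^ ℓ ≤ (2 * L ^ s) ^ ℓ := by gcongr
        _ = _ := by rw [mul_pow, e0]
    have e2 : L * (B : ℝ) ^ ℓ ≤ 2 ^ (2 * ℓ) * L ^ (3 / 2 + η) := by
      calc L * (B : ℝ) ^ ℓ ≤ L * (2 ^ ℓ * L ^ (1 / 2 : ℝ)) := by gcongr
        _ = 2 ^ ℓ * L ^ (1 + 1 / 2 : ℝ) := by
            rw [Real.rpow_add hL0, Real.rpow_one]
            ring
        _ ≤ 2 ^ (2 * ℓ) * L ^ (3 / 2 + η) := by
            gcongr ?_ * ?_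
            · exact pow_le_pow_right₀ one_le_two (by omega)
            · exact mono (by linarith)
    have e3 : √L * (B : ℝ) ^ (2 * ℓ) * L ^ η ≤ 2 ^ (2 * ℓ) * L ^ (3 / 2 + η) := by
      calc √L * (B : ℝ) ^ (2 * ℓ) * L ^ η ≤ √L * (2 ^ ℓ * L ^ (1 / 2 : ℝ)) ^ 2 * L ^ η := by
            rw [mul_comm 2 ℓ, pow_mul]
            gcongr
        _ = 2 ^ (2 * ℓ) * (L ^ (1 / 2 : ℝ) * L ^ (1 / 2 : ℝ) * L ^ (1 / 2 : ℝ) * L ^ η) := by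
            rw [Real.sqrt_eq_rpow, mul_pow, ← pow_mul, mul_comm ℓ 2]
            ring
        _ = _ := by
            rw [← Real.rpow_add hL0, ← Real.rpow_add hL0, ← Real.rpow_add hL0]
            norm_num
    rw [mul_assoc Km]
    gcongr
    rw [pow_succ]
    linarith
  have hlog : 3 + Real.log A ≤ K₄ * L ^ η := by
    have h1 : Real.log A ≤ Real.log L := Real.log_le_log hApos hAL
    have h2 := Real.log_le_rpow_div hL0.le hη0
    have h3 : 1 ≤ L ^ η := one_le hη0.le
    rw [hK₄, add_mul, one_div_mul_eq_div]
    linarith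
  have hT3 : T ^ (2 * ℓ) ≤ (K₅ * L ^ ((1 - ε) * s)) ^ (2 * ℓ) := by
    have hVHpos : (0 : ℝ) < #P * H := by positivity
    have hlog0 : 0 ≤ 3 + Real.log A := by
      have : 0 ≤ Real.log A := Real.log_natCast_nonneg _
      linarith
    have hM0 : 0 ≤ ∑ x ∈ range D,
        ((∑ b ∈ Icc 1 B, jacobiSym ((x : ℤ) + (b : ℕ)) D : ℤ) : ℝ) ^ (2 * ℓ) :=
      sum_nonneg fun _ _ => (even_two_mul ℓ).pow_nonneg _
    calc T ^ (2 * ℓ) ≤ _ := hT2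
      _ ≤ (K₄ * L ^ η) / (#P * H) * (Km * (L * B ^ ℓ + √L * B ^ (2 * ℓ) * L ^ η)) := by gcongr
      _ = (K₄ * L ^ η * (Km * (L * B ^ ℓ + √L * B ^ (2 * ℓ) * L ^ η))) / (#P * H) := by ring
      _ ≤ (K₄ * L ^ η * (Km * 2 ^ (2 * ℓ + 1) * L ^ (3 / 2 + η))) / (#P * H) := by gcongr
      _ ≤ K₅ * L ^ (1 - ε) := by
          rw [div_le_iff₀ hVHpos]
          calc K₄ * L ^ η * (Km * 2 ^ (2 * ℓ + 1) * L ^ (3 / 2 + η))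
              = K₄ * (Km * 2 ^ (2 * ℓ + 1)) * L ^ (η + (3 / 2 + η)) := by
                rw [Real.rpow_add hL0 η (3 / 2 + η)]
                ring
            _ ≤ K₄ * (Km * 2 ^ (2 * ℓ + 1)) *
                  L ^ ((1 - ε) + (1 / 2 + 2 * ε - ε / 4 - η - s)) := by
                gcongr ?_ * ?_
                exact mono (by linarith)
            _ ≤ K₄ * (Km * 2 ^ (2 * ℓ + 1)) * (L ^ (1 - ε) * (8 * K₁ * (#P * H))) := by
                rw [Real.rpow_add hL0 (1 - ε)]
                gcongr
            _ = _ := by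
                rw [hK₅]
                ring
      _ ≤ K₅ ^ (2 * ℓ) * L ^ (1 - ε) := by
          gcongr
          exact le_self_pow₀ hK₅1 (by omega)
      _ = _ := by
          rw [mul_pow K₅ (L ^ ((1 - ε) * s)), ← Real.rpow_mul_natCast hL0.le]
          congr 2
          rw [hs]
          push_cast
          field_simp
  have hT4 : T ≤ K₅ * L ^ ((1 - ε) * s) :=
    (pow_le_pow_iff_left₀ hT0 (by positivity) (by omega)).1 hT3
  refine hT1.trans ?_
  have hδ : ε / (2 * ℓ) = ε * s := by
    rw [hs]
    ring
  rw [hδ]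
  have f1 : H / B * T ≤ H * (K₅ * L ^ (-(ε * s))) := by
    rw [div_mul_eq_mul_div, div_le_iff₀ hBpos]
    calc H * T ≤ H * (K₅ * L ^ (-(ε * s) + s)) := by
          gcongr
          refine hT4.trans (le_of_eq ?_)
          congr 2
          ring
      _ = H * (K₅ * L ^ (-(ε * s))) * L ^ s := by
          rw [Real.rpow_add hL0]
          ring
      _ ≤ _ := by gcongr
  have f2 : 2 * ((A : ℝ) * B) ≤ H * (2 * L ^ (-(ε * s))) := by
    have h1 : L ^ (-(ε / 4)) ≤ L ^ (-(ε * s)) := mono (by nlinarith)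
    nlinarith [mul_le_mul_of_nonneg_left h1 hHpos.le]
  calc H / B * T + 2 * (A * B) ≤ H * (K₅ * L ^ (-(ε * s))) + H * (2 * L ^ (-(ε * s))) :=
        add_le_add f1 f2
    _ = _ := by ring

end burgess

section incomplete

open Finset

theorem sum_range_natCast_zmod {E : Type*} [AddCommMonoid E] {D : ℕ} [NeZero D] (f : ZMod D → E)
    (a : ZMod D) : ∑ n ∈ range D, f (a + n) = ∑ x, f x := by
  rw [← Equiv.sum_comp (Equiv.addLeft a) f]
  refine sum_nbij' (fun n => (n : ZMod D)) (fun x => x.val) ?_ ?_ ?_ ?_ ?_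
  · simp
  · intro x _
    simpa using ZMod.val_lt x
  · intro n hn
    exact ZMod.val_cast_of_lt (mem_range.1 hn)
  · intro x _
    simp
  · simp

/-- Incomplete sums of a bounded function on `ZMod D` of mean zero are bounded by `D`. -/
theorem norm_sum_range_le_of_sum_eq_zero {E : Type*} [NormedAddCommGroup E] {D : ℕ} [NeZero D]
    (f : ZMod D → E) (hf : ∀ x, ‖f x‖ ≤ 1) (h0 : ∑ x, f x = 0) (H : ℕ) (a : ZMod D) :
    ‖∑ n ∈ range H, f (a + n)‖ ≤ D := by
  induction H using Nat.strong_induction_on generalizing a with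
  | _ H ih =>
    rcases lt_or_ge H D with h | h
    · calc ‖∑ n ∈ range H, f (a + n)‖ ≤ ∑ n ∈ range H, (1 : ℝ) :=
          norm_sum_le_of_le _ fun _ _ => hf _
        _ ≤ D := by
          simpa using h.le
    · obtain ⟨c, rfl⟩ := Nat.exists_eq_add_of_le h
      rw [sum_range_add, sum_range_natCast_zmod, h0, zero_add]
      have := ih c (by have := Nat.pos_of_neZero D; omega) (a + (D : ℕ))
      simpa [add_assoc] using this

theorem exists_jacobiSym_eq_neg_one {D : ℕ} (hsq : Squarefree D) (hodd : Odd D) (hD : D ≠ 1) :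
    ∃ a : ℕ, jacobiSym a D = -1 := by
  obtain ⟨p, hp, d, rfl⟩ := Nat.exists_prime_and_dvd hD
  have : Fact p.Prime := ⟨hp⟩
  have hc : p.Coprime d := Nat.coprime_of_squarefree_mul hsq
  have hp2 : ringChar (ZMod p) ≠ 2 := by
    rw [ZMod.ringChar_zmod_n]
    rintro rfl
    exact Nat.not_even_iff_odd.2 hodd (even_two.mul_right d)
  obtain ⟨b, hb⟩ := FiniteField.exists_nonsquare hp2
  obtain ⟨x, hx1, hx2⟩ := Nat.chineseRemainder hc b.val 1
  have : NeZero p := ⟨hp.ne_zero⟩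
  have : NeZero d := ⟨fun h => hsq.ne_zero (by simp [h])⟩
  refine ⟨x, ?_⟩
  have e1 : jacobiSym x p = -1 := by
    rw [← jacobiSym.legendreSym.to_jacobiSym, legendreSym.eq_neg_one_iff']
    have : (x : ZMod p) = b := by
      rw [(ZMod.natCast_eq_natCast_iff x b.val p).2 hx1, ZMod.natCast_zmod_val]
    rwa [this]
  have e2 : jacobiSym x d = 1 := by
    rw [jacobiSym.mod_left' (b := d) (a₂ := 1), jacobiSym.one_left]
    exact_mod_cast hx2
  rw [jacobiSym.mul_right, e1, e2]
  norm_num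

theorem sum_jacobiHom_eq_zero {D : ℕ} [NeZero D] (hsq : Squarefree D) (hodd : Odd D)
    (hD : D ≠ 1) : ∑ x, (jacobiHom D x : ℝ) = 0 := by
  obtain ⟨a, ha⟩ := exists_jacobiSym_eq_neg_one hsq hodd hD
  have hu : IsUnit (a : ZMod D) := by
    rw [ZMod.isUnit_iff_coprime]
    by_contra h
    have := jacobiSym.eq_zero_iff_not_coprime (a := a) (b := D).2 (by simpa using h)
    omega
  have ha' : jacobiHom D (a : ZMod D) = -1 := by
    rw [← ha, ← jacobiHom_intCast]
    simp
  have h := Equiv.sum_comp hu.unit.mulLeft fun x => (jacobiHom D x : ℝ)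
  have h2 : ∑ x, (jacobiHom D (hu.unit.mulLeft x) : ℝ) = - ∑ x, (jacobiHom D x : ℝ) := by
    rw [← sum_neg_distrib]
    refine sum_congr rfl fun x _ => ?_
    rw [Units.mulLeft_apply, map_mul, IsUnit.unit_spec, ha']
    push_cast
    ring
  rw [h2] at h
  linarith

theorem abs_sum_jacobiSym_range_le_card {D : ℕ} (hsq : Squarefree D) (hodd : Odd D)
    (hD : D ≠ 1) (N₀ : ℤ) (H : ℕ) :
    |∑ n ∈ range H, (jacobiSym (N₀ + (n : ℕ)) D : ℝ)| ≤ D := by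
  have : NeZero D := ⟨hsq.ne_zero⟩
  have := norm_sum_range_le_of_sum_eq_zero (fun x => (jacobiHom D x : ℝ))
    (fun x => abs_jacobiHom_le_one D x) (sum_jacobiHom_eq_zero hsq hodd hD) H (N₀ : ZMod D)
  rw [Real.norm_eq_abs] at this
  convert this using 4 with n
  rw [← jacobiHom_intCast]
  push_cast
  rfl

theorem abs_sum_range_le_card (D H : ℕ) (N₀ : ℤ) :
    |∑ n ∈ range H, (jacobiSym (N₀ + (n : ℕ)) D : ℝ)| ≤ H := by
  refine (abs_sum_le_sum_abs _ _).trans ?_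
  calc _ ≤ ∑ n ∈ range H, (1 : ℝ) := sum_le_sum fun n _ => by
        rw [← jacobiHom_intCast]
        exact abs_jacobiHom_le_one _ _
    _ = H := by simp

theorem abs_sum_blocks_le {D h q : ℕ} {B : ℝ}
    (hB : ∀ N₀ : ℤ, |∑ n ∈ range h, (jacobiSym (N₀ + (n : ℕ)) D : ℝ)| ≤ B) (N₀ : ℤ) :
    |∑ n ∈ range (h * q), (jacobiSym (N₀ + (n : ℕ)) D : ℝ)| ≤ q * B := by
  induction q with
  | zero => simp
  | succ q ih =>
    rw [mul_add, mul_one, sum_range_add]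
    refine (abs_add_le _ _).trans ?_
    have := hB (N₀ + (h * q : ℕ))
    push_cast at this ⊢
    simp only [add_assoc] at this ⊢
    linarith

/-- Burgess's bound for sums of the Jacobi symbol over intervals of arbitrary length. -/
theorem exists_jacobi_sum_le (ε : ℝ) (hε : 0 < ε) (hε8 : ε ≤ 1 / 8) :
    ∃ δ K : ℝ, 0 < δ ∧ δ ≤ 1 / 4 ∧ 1 ≤ K ∧ ∀ D : ℕ, Squarefree D → Odd D → D ≠ 1 →
      ∀ Y : ℝ, (D : ℝ) ^ (1 / 4 + ε) ≤ Y → ∀ (N₀ : ℤ) (H : ℕ),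
        |∑ n ∈ range H, (jacobiSym (N₀ + (n : ℕ)) D : ℝ)| ≤
          K * ((H : ℝ) ^ (1 - δ) * Y ^ δ) := by
  obtain ⟨δ₀, K, D₀, hδ0, hδ1, hK, hcore⟩ := exists_burgess_core ε hε hε8
  refine ⟨δ₀ / 4, K + 2 + D₀, by positivity, by linarith, by
    have : (0 : ℝ) ≤ D₀ := Nat.cast_nonneg _
    linarith, fun D hsq hodd hD Y hY N₀ H => ?_⟩
  set δ := δ₀ / 4
  have hδpos : 0 < δ := by positivity
  have hδ2 : δ ≤ 1 / 4 := by
    simp only [δ]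
    linarith
  have hDpos : (1 : ℝ) ≤ D := by exact_mod_cast Nat.one_le_iff_ne_zero.2 hsq.ne_zero
  set y := (D : ℝ) ^ (1 / 4 + ε) with hy
  have hy1 : 1 ≤ y := Real.one_le_rpow hDpos (by linarith)
  have hY1 : 1 ≤ Y := hy1.trans hY
  rcases Nat.eq_zero_or_pos H with rfl | hH
  · simp only [range_zero, sum_empty, abs_zero]
    positivity
  have hH1 : (1 : ℝ) ≤ H := by exact_mod_cast hH
  have hHpos : (0 : ℝ) < H := by linarith
  have hYδ : 1 ≤ Y ^ δ := Real.one_le_rpow hY1 hδpos.le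
  have hHδ : 1 ≤ (H : ℝ) ^ (1 - δ) := Real.one_le_rpow hH1 (by linarith)
  have hX1 : 1 ≤ (H : ℝ) ^ (1 - δ) * Y ^ δ := one_le_mul_of_one_le_of_one_le hHδ hYδ
  set X := (H : ℝ) ^ (1 - δ) * Y ^ δ with hX
  have hD₀ : (0 : ℝ) ≤ D₀ := Nat.cast_nonneg _
  have key : ∀ c, c ≤ K + 2 + D₀ → ∀ S : ℝ, S ≤ c * X → S ≤ (K + 2 + D₀) * X := fun c hc S hS =>
    hS.trans (by gcongr)
  have split : ∀ t : ℝ, 0 < t → t = t ^ (1 - δ) * t ^ δ := fun t ht => by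
    rw [← Real.rpow_add ht]
    simp
  by_cases hsmall : D < D₀
  · refine key D₀ (by linarith) _ ((abs_sum_jacobiSym_range_le_card hsq hodd hD N₀ H).trans ?_)
    calc (D : ℝ) ≤ D₀ := by exact_mod_cast hsmall.le
      _ ≤ D₀ * X := le_mul_of_one_le_right hD₀ hX1
  by_cases hlong : (D : ℝ) ^ 2 < H
  · refine key 1 (by linarith) _ ((abs_sum_jacobiSym_range_le_card hsq hodd hD N₀ H).trans ?_)
    calc (D : ℝ) = ((D : ℝ) ^ 2) ^ (1 / 2 : ℝ) := by
          rw [← Real.sqrt_eq_rpow, Real.sqrt_sq (by linarith)]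
      _ ≤ (H : ℝ) ^ (1 / 2 : ℝ) := by gcongr
      _ ≤ (H : ℝ) ^ (1 - δ) := Real.rpow_le_rpow_of_exponent_le hH1 (by linarith)
      _ ≤ 1 * X := by
        rw [one_mul]
        exact le_mul_of_one_le_right (by positivity) hYδ
  set h := ⌈y⌉₊ with hh
  have hh1 : y ≤ h := Nat.le_ceil _
  have hh2 : (h : ℝ) ≤ 2 * y := natCeil_le_two_mul hy1
  have hh0 : 0 < h := Nat.ceil_pos.2 (by linarith)
  have hr : ∀ t : ℝ, 0 < t → t ≤ H → t ≤ Y → t ≤ X := fun t ht h1 h2 => by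
    rw [split t ht, hX]
    gcongr
    linarith
  by_cases hshort : H < h
  · refine key 1 (by linarith) _ ((abs_sum_range_le_card D H N₀).trans ?_)
    rw [one_mul]
    exact hr H hHpos le_rfl ((Nat.lt_ceil.1 hshort).le.trans hY)
  have hyX : y ≤ X := hr y (by linarith) (hh1.trans (by exact_mod_cast not_lt.1 hshort)) hY
  refine key (K + 2) (by linarith) _ ?_
  have hdiv : H = h * (H / h) + H % h := (Nat.div_add_mod H h).symm
  have hsplit : range H = range (h * (H / h) + H % h) := by rw [← hdiv]
  rw [hsplit, sum_range_add]
  refine (abs_add_le _ _).trans ?_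
  rw [add_mul]
  refine add_le_add ?_ ?_
  · refine (abs_sum_blocks_le (hcore D (not_lt.1 hsmall) hsq hodd) N₀).trans ?_
    have h1 : ((H / h : ℕ) : ℝ) * h ≤ H := by exact_mod_cast Nat.div_mul_le_self H h
    have h2 : (D : ℝ) ^ (-δ₀) ≤ (H : ℝ) ^ (-δ) := by
      have : (D : ℝ) ^ (-δ₀) ≤ ((D : ℝ) ^ 2) ^ (-δ) := by
        rw [← Real.rpow_natCast, ← Real.rpow_mul (by linarith)]
        refine Real.rpow_le_rpow_of_exponent_le hDpos ?_
        simp only [δ]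
        push_cast
        linarith
      refine this.trans ?_
      exact Real.rpow_le_rpow_of_nonpos hHpos (not_lt.1 hlong) (by linarith)
    calc ((H / h : ℕ) : ℝ) * (K * h * (D : ℝ) ^ (-δ₀))
        = K * (((H / h : ℕ) : ℝ) * h) * (D : ℝ) ^ (-δ₀) := by ring
      _ ≤ K * H * (H : ℝ) ^ (-δ) := by gcongr
      _ = K * (H : ℝ) ^ (1 - δ) := by
        rw [sub_eq_add_neg, Real.rpow_add hHpos, Real.rpow_one]
        ring
      _ ≤ K * X := by
        gcongr
        exact le_mul_of_one_le_right (by positivity) hYδ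
  · have := abs_sum_range_le_card D (H % h) (N₀ + (h * (H / h) : ℕ))
    calc _ ≤ ((H % h : ℕ) : ℝ) := by
          refine le_of_eq_of_le ?_ this
          congr 1
          refine sum_congr rfl fun n _ => ?_
          rw [Nat.cast_add (h * (H / h)) n, add_assoc]
      _ ≤ h := by exact_mod_cast (Nat.mod_lt H hh0).le
      _ ≤ 2 * X := by linarith

theorem sum_range_mul_eq {E : Type*} [AddCommMonoid E] (f : ℕ → E) (M q : ℕ) :
    ∑ n ∈ range (M * q), f n = ∑ b ∈ range M, ∑ l ∈ range q, f (b + M * l) := by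
  rw [sum_comm]
  induction q with
  | zero => simp
  | succ q ih =>
    rw [mul_add, mul_one, sum_range_add, ih, sum_range_succ]
    simp only [add_comm]

theorem norm_jacobiSym_le_one (a : ℤ) (D : ℕ) : ‖(jacobiSym a D : ℂ)‖ ≤ 1 := by
  rcases jacobiSym.trichotomy a D with h | h | h <;> simp [h]

/-- Burgess's bound for the Jacobi symbol twisted by a character of fixed modulus. -/
theorem exists_twisted_jacobi_sum_le (M : ℕ) (hM : 0 < M) (ε : ℝ) (hε : 0 < ε) (hε8 : ε ≤ 1 / 8) :
    ∃ δ K : ℝ, 0 < δ ∧ δ ≤ 1 / 4 ∧ 1 ≤ K ∧ ∀ D : ℕ, Squarefree D → Odd D → D.Coprime M →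
      ∀ χ : DirichletCharacter ℂ M, (D = 1 → χ ≠ 1) →
      ∀ Y : ℝ, (D : ℝ) ^ (1 / 4 + ε) ≤ Y → ∀ N : ℕ,
        ‖∑ n ∈ Ioc 0 N, χ n * (jacobiSym n D : ℂ)‖ ≤ K * ((N : ℝ) ^ (1 - δ) * Y ^ δ) := by
  obtain ⟨δ, K, hδ0, hδ1, hK, hmain⟩ := exists_jacobi_sum_le ε hε hε8
  have : NeZero M := ⟨hM.ne'⟩
  have hM1 : (1 : ℝ) ≤ M := by exact_mod_cast hM
  refine ⟨δ, M * K * 2 + M + 1, hδ0, hδ1, by nlinarith, fun D hsq hodd hc χ hχ Y hY N => ?_⟩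
  have hD1 : (1 : ℝ) ≤ D := by exact_mod_cast Nat.one_le_iff_ne_zero.2 hsq.ne_zero
  have hY1 : 1 ≤ Y := (Real.one_le_rpow hD1 (by linarith)).trans hY
  rcases Nat.eq_zero_or_pos N with rfl | hN
  · simp only [Ioc_self, sum_empty, norm_zero]
    positivity
  have hN1 : (1 : ℝ) ≤ N := by exact_mod_cast hN
  have hYδ : 1 ≤ Y ^ δ := Real.one_le_rpow hY1 hδ0.le
  have hX1 : 1 ≤ (N : ℝ) ^ (1 - δ) * Y ^ δ := one_le_mul_of_one_le_of_one_le
    (Real.one_le_rpow hN1 (by linarith)) hYδ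
  have hsum : ∑ n ∈ Ioc 0 N, χ n * (jacobiSym n D : ℂ) =
      ∑ n ∈ range (N + 1), χ n * (jacobiSym n D : ℂ) - χ (0 : ℕ) * (jacobiSym (0 : ℕ) D : ℂ) := by
    rw [range_eq_Ico, sum_eq_sum_Ico_succ_bot (by omega), add_sub_cancel_left]
    refine sum_congr ?_ fun _ _ => rfl
    ext
    simp only [mem_Ioc, mem_Ico]
    omega
  have h0 : ‖χ (0 : ℕ) * (jacobiSym (0 : ℕ) D : ℂ)‖ ≤ 1 := by
    rw [norm_mul]
    exact mul_le_one₀ (χ.norm_le_one _) (norm_nonneg _) (norm_jacobiSym_le_one _ _)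
  set X := (N : ℝ) ^ (1 - δ) * Y ^ δ with hX
  suffices hr : ‖∑ n ∈ range (N + 1), χ n * (jacobiSym n D : ℂ)‖ ≤ (M * K * 2 + M) * X by
    rw [hsum]
    refine (norm_sub_le _ _).trans ?_
    linarith
  by_cases hD : D = 1
  · subst hD
    have := norm_sum_range_le_of_sum_eq_zero (fun x => χ x) (fun x => χ.norm_le_one x)
      (MulChar.sum_eq_zero_of_ne_one (hχ rfl)) (N + 1) 0
    simp only [zero_add] at this
    simp only [jacobiSym.one_right, Int.cast_one, mul_one]
    refine this.trans ?_
    have : 0 ≤ (M * K * 2 : ℝ) := by positivity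
    nlinarith
  have hdiv : N + 1 = M * ((N + 1) / M) + (N + 1) % M := (Nat.div_add_mod _ _).symm
  set q := (N + 1) / M with hq
  rw [hdiv, sum_range_add]
  refine (norm_add_le _ _).trans ?_
  rw [add_mul]
  refine add_le_add ?_ ?_
  · rw [sum_range_mul_eq]
    have hqN : (q : ℝ) ≤ 2 * N := by
      have : q ≤ 2 * N := (Nat.div_le_self _ _).trans (by omega)
      exact_mod_cast this
    have hb : ∀ b ∈ range M, ‖∑ l ∈ range q, χ (b + M * l : ℕ) * (jacobiSym (b + M * l : ℕ) D : ℂ)‖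
        ≤ K * 2 * X := fun b _ => by
      have e1 : ∑ l ∈ range q, χ (b + M * l : ℕ) * (jacobiSym (b + M * l : ℕ) D : ℂ) =
          χ b * (jacobiSym M D : ℂ) * ((∑ l ∈ range q,
            (jacobiSym ((((b : ZMod D) * (M : ZMod D)⁻¹).cast : ℤ) + (l : ℕ)) D : ℝ) : ℝ) : ℂ) := by
        push_cast
        rw [mul_sum]
        refine sum_congr rfl fun l _ => ?_
        have h1 : ((b + M * l : ℕ) : ZMod M) = b := by simp
        have hM' : (M : ZMod D) * (M : ZMod D)⁻¹ = 1 := ZMod.mul_inv_of_unit _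
          ((ZMod.isUnit_iff_coprime M D).2 hc.symm)
        rw [← Nat.cast_mul, ← Nat.cast_add, h1, mul_assoc]
        congr 1
        rw [← jacobiHom_intCast, ← jacobiHom_intCast, ← jacobiHom_intCast, ← Int.cast_mul,
          ← map_mul]
        congr 2
        push_cast
        linear_combination (-(b : ZMod D)) * hM'
      rw [e1, norm_mul, norm_mul, Complex.norm_real, Real.norm_eq_abs]
      have h2 := hmain D hsq hodd hD Y hY (((b : ZMod D) * (M : ZMod D)⁻¹).cast : ℤ) q
      calc _ ≤ 1 * 1 * (K * ((q : ℝ) ^ (1 - δ) * Y ^ δ)) := by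
            gcongr
            · exact χ.norm_le_one _
            · exact norm_jacobiSym_le_one _ _
        _ ≤ K * ((2 * N : ℝ) ^ (1 - δ) * Y ^ δ) := by
            rw [one_mul, one_mul]
            gcongr
            linarith
        _ ≤ K * ((2 * (N : ℝ) ^ (1 - δ)) * Y ^ δ) := by
            rw [Real.mul_rpow (by norm_num) (by linarith)]
            gcongr
            calc (2 : ℝ) ^ (1 - δ) ≤ 2 ^ (1 : ℝ) :=
                  Real.rpow_le_rpow_of_exponent_le one_le_two (by linarith)
              _ = 2 := Real.rpow_one _
        _ = _ := by
            rw [hX]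
            ring
    calc _ ≤ ∑ b ∈ range M, K * 2 * X := norm_sum_le_of_le _ hb
      _ = _ := by
        simp
        ring
  · calc _ ≤ ∑ n ∈ range ((N + 1) % M), (1 : ℝ) := norm_sum_le_of_le _ fun n _ => by
          rw [norm_mul]
          exact mul_le_one₀ (χ.norm_le_one _) (norm_nonneg _) (norm_jacobiSym_le_one _ _)
      _ ≤ M := by simpa using (Nat.mod_lt _ hM).le
      _ ≤ M * X := le_mul_of_one_le_right (by positivity) hX1

end incomplete

section hyperbola

open Finset ArithmeticFunction

theorem sum_Ioc_mul_eq_hyperbola {R : Type*} [CommRing R] (f g : ArithmeticFunction R) {N A : ℕ}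
    (hA : 0 < A) (hAN : A ≤ N) :
    ∑ n ∈ Ioc 0 N, (f * g) n = ∑ a ∈ Ioc 0 A, f a * ∑ b ∈ Ioc 0 (N / a), g b +
      ∑ b ∈ Ioc 0 (N / A), g b * ∑ a ∈ Ioc A (N / b), f a := by
  rw [sum_Ioc_mul_eq_sum_sum, ← sum_Ioc_consecutive _ (Nat.zero_le A) hAN]
  congr 1
  simp only [mul_sum]
  rw [sum_comm' (t' := Ioc 0 (N / A)) (s' := fun b => Ioc A (N / b))]
  · exact sum_congr rfl fun _ _ => sum_congr rfl fun _ _ => mul_comm _ _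
  · intro a b
    simp only [mem_Ioc]
    constructor
    · rintro ⟨⟨h1, h2⟩, h3, h4⟩
      have h5 : b * a ≤ N := (Nat.le_div_iff_mul_le (by omega)).1 h4
      refine ⟨⟨h1, (Nat.le_div_iff_mul_le h3).2 (by linarith)⟩, h3,
        (Nat.le_div_iff_mul_le hA).2 (by nlinarith)⟩
    · rintro ⟨⟨h1, h2⟩, h3, h4⟩
      have h5 : a * b ≤ N := (Nat.le_div_iff_mul_le h3).1 h2
      exact ⟨⟨h1, by nlinarith⟩, h3, (Nat.le_div_iff_mul_le (by omega)).2 (by linarith)⟩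

theorem sum_Ioc_eq_sub {R : Type*} [AddCommGroup R] (f : ℕ → R) {A B : ℕ} (h : A ≤ B) :
    ∑ a ∈ Ioc A B, f a = ∑ a ∈ Ioc 0 B, f a - ∑ a ∈ Ioc 0 A, f a := by
  rw [eq_sub_iff_add_eq', sum_Ioc_consecutive _ (Nat.zero_le A) h]

theorem sum_inv_Ioc_le (N : ℕ) : ∑ n ∈ Ioc 0 N, (n : ℝ)⁻¹ ≤ 1 + Real.log N := by
  have := harmonic_le_one_add_log N
  rw [harmonic_eq_sum_Icc] at this
  push_cast at this
  exact this

theorem one_le_one_add_log (N : ℕ) : 1 ≤ 1 + Real.log N := by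
  linarith [Real.log_natCast_nonneg N]

theorem sum_norm_prod_div_le {ι : Type*} (t : Finset ι) (f : ι → ArithmeticFunction ℂ)
    (hf : ∀ i n, ‖f i n‖ ≤ 1) (N : ℕ) :
    ∑ n ∈ Ioc 0 N, ‖(∏ i ∈ t, f i) n‖ / n ≤ (1 + Real.log N) ^ #t := by
  classical
  have hL := one_le_one_add_log N
  induction t using Finset.induction_on generalizing N with
  | empty =>
    simp only [prod_empty, card_empty, pow_zero]
    calc ∑ n ∈ Ioc 0 N, ‖(1 : ArithmeticFunction ℂ) n‖ / n
        ≤ ∑ n ∈ Ioc 0 N, if n = 1 then (1 : ℝ) else 0 := sum_le_sum fun n _ => by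
          rw [one_apply]
          split_ifs with h
          · simp [h]
          · simp
      _ ≤ 1 := by
          rw [sum_ite_eq']
          split_ifs <;> norm_num
  | insert j t hj ih =>
    rw [prod_insert hj, card_insert_of_notMem hj, pow_succ']
    set g := ∏ i ∈ t, f i
    calc ∑ n ∈ Ioc 0 N, ‖(f j * g) n‖ / n
        ≤ ∑ n ∈ Ioc 0 N, ∑ x ∈ Ioc 0 N ×ˢ Ioc 0 N with x.1 * x.2 = n,
            ‖f j x.1‖ / x.1 * (‖g x.2‖ / x.2) := sum_le_sum fun n hn => by
          rw [mul_apply]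
          calc _ ≤ (∑ x ∈ n.divisorsAntidiagonal, ‖f j x.1 * g x.2‖) / n := by
                gcongr
                exact norm_sum_le _ _
            _ = ∑ x ∈ n.divisorsAntidiagonal, ‖f j x.1‖ / x.1 * (‖g x.2‖ / x.2) := by
                rw [sum_div]
                refine sum_congr rfl fun x hx => ?_
                rw [← (Nat.mem_divisorsAntidiagonal.1 hx).1, norm_mul]
                push_cast
                rw [mul_div_mul_comm]
            _ ≤ _ := by
                refine sum_le_sum_of_subset_of_nonneg (fun x hx => ?_) fun _ _ _ => by positivity
                rw [Nat.mem_divisorsAntidiagonal] at hx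
                rw [mem_Ioc] at hn
                have h0 : x.1 * x.2 ≠ 0 := by omega
                have h1 := Nat.pos_of_ne_zero (left_ne_zero_of_mul h0)
                have h2 := Nat.pos_of_ne_zero (right_ne_zero_of_mul h0)
                simp only [mem_filter, mem_product, mem_Ioc]
                refine ⟨⟨⟨h1, ?_⟩, h2, ?_⟩, hx.1⟩ <;> nlinarith
      _ ≤ ∑ x ∈ Ioc 0 N ×ˢ Ioc 0 N, ‖f j x.1‖ / x.1 * (‖g x.2‖ / x.2) :=
          sum_fiberwise_le_sum_of_sum_fiber_nonneg fun _ _ => sum_nonneg fun _ _ => by positivity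
      _ = (∑ a ∈ Ioc 0 N, ‖f j a‖ / a) * ∑ b ∈ Ioc 0 N, ‖g b‖ / b := by
          rw [sum_mul_sum, ← sum_product']
      _ ≤ (1 + Real.log N) * (1 + Real.log N) ^ #t := by
          refine mul_le_mul ?_ (ih N hL) (sum_nonneg fun _ _ => by positivity) (by linarith)
          refine le_trans (sum_le_sum fun n _ => ?_) (sum_inv_Ioc_le N)
          rw [div_eq_mul_inv]
          exact mul_le_of_le_one_left (by positivity) (hf _ _)

theorem norm_prod_apply_le (s : ℕ) (η : ℝ) (hη : 0 < η) : ∃ K : ℝ, 1 ≤ K ∧ ∀ (ι : Type)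
    (t : Finset ι) (f : ι → ArithmeticFunction ℂ), #t = s → (∀ i n, ‖f i n‖ ≤ 1) →
      ∀ n : ℕ, n ≠ 0 → ‖(∏ i ∈ t, f i) n‖ ≤ K * (n : ℝ) ^ η := by
  classical
  induction s generalizing η with
  | zero =>
    refine ⟨1, le_rfl, fun ι t f ht _ n hn => ?_⟩
    rw [card_eq_zero] at ht
    have : 1 ≤ (n : ℝ) ^ η :=
      Real.one_le_rpow (by exact_mod_cast Nat.one_le_iff_ne_zero.2 hn) hη.le
    rw [ht, prod_empty, one_apply]
    split_ifs <;> simp <;> linarith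
  | succ s ih =>
    obtain ⟨K, hK1, hK⟩ := ih (η / 2) (by positivity)
    obtain ⟨K', hK'1, hK'⟩ := exists_card_divisors_le (η / 2) (by positivity)
    refine ⟨K' * K, one_le_mul_of_one_le_of_one_le hK'1 hK1, fun ι t f ht hf n hn => ?_⟩
    obtain ⟨j, hj⟩ := card_pos.1 (by omega : 0 < #t)
    rw [← mul_prod_erase t f hj, mul_apply]
    have hcard : #(t.erase j) = s := by
      rw [card_erase_of_mem hj]
      omega
    have hn0 : (0 : ℝ) < n := by positivity
    calc _ ≤ ∑ x ∈ n.divisorsAntidiagonal, K * (n : ℝ) ^ (η / 2) :=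
          norm_sum_le_of_le _ fun x hx => by
            rw [Nat.mem_divisorsAntidiagonal] at hx
            have h2 : x.2 ≠ 0 := right_ne_zero_of_mul (hx.1 ▸ hn)
            have h3 : (x.2 : ℝ) ≤ n := by
              exact_mod_cast Nat.le_of_dvd (Nat.pos_of_ne_zero hn) ⟨x.1, by rw [← hx.1, mul_comm]⟩
            rw [norm_mul]
            calc _ ≤ 1 * (K * (x.2 : ℝ) ^ (η / 2)) := by
                  gcongr
                  · exact hf _ _
                  · exact hK ι _ f hcard hf _ h2
              _ ≤ _ := by
                  rw [one_mul]
                  gcongr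
      _ = #n.divisors * (K * (n : ℝ) ^ (η / 2)) := by
          rw [sum_const, nsmul_eq_mul, ← Nat.map_div_right_divisors, card_map]
      _ ≤ (K' * (n : ℝ) ^ (η / 2)) * (K * (n : ℝ) ^ (η / 2)) := by
          gcongr
          exact hK' n hn
      _ = K' * K * ((n : ℝ) ^ (η / 2) * (n : ℝ) ^ (η / 2)) := by ring
      _ = _ := by rw [← Real.rpow_add hn0, add_halves]

theorem natCast_div_le (a b : ℕ) : ((a / b : ℕ) : ℝ) ≤ (a : ℝ) / b := Nat.cast_div_le

theorem exists_prod_sum_le (s : ℕ) (δ K : ℝ) (hδ : 0 < δ) (hδ1 : δ ≤ 1) (hK : 1 ≤ K) :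
    ∃ K' : ℝ, 1 ≤ K' ∧ ∀ (ι : Type) (t : Finset ι) (f : ι → ArithmeticFunction ℂ), #t = s + 1 →
      (∀ i n, ‖f i n‖ ≤ 1) → ∀ Y : ℝ, 1 ≤ Y →
      (∀ i ∈ t, ∀ N : ℕ, ‖∑ n ∈ Ioc 0 N, f i n‖ ≤ K * ((N : ℝ) ^ (1 - δ) * Y ^ δ)) →
      ∀ N : ℕ, 0 < N → ‖∑ n ∈ Ioc 0 N, (∏ i ∈ t, f i) n‖ ≤
        K' * (1 + Real.log N) ^ (s + 1) * ((N : ℝ) ^ (1 - δ / (s + 1)) * Y ^ δ) := by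
  classical
  induction s with
  | zero =>
    refine ⟨K, hK, fun ι t f ht _ Y _ hf N hN => ?_⟩
    obtain ⟨j, rfl⟩ := card_eq_one.1 ht
    rw [prod_singleton]
    refine (hf j (mem_singleton_self j) N).trans ?_
    have := one_le_one_add_log N
    simp only [Nat.cast_zero, zero_add, div_one, pow_one]
    gcongr
    nlinarith
  | succ s ih =>
    obtain ⟨K₁, hK₁, ih⟩ := ih
    refine ⟨K + 4 * K₁, by linarith, fun ι t f ht hf1 Y hY hf N hN => ?_⟩
    obtain ⟨j, hj⟩ := card_pos.1 (by omega : 0 < #t)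
    have hcard : #(t.erase j) = s + 1 := by
      rw [card_erase_of_mem hj]
      omega
    have hG := ih ι (t.erase j) f hcard hf1 Y hY fun i hi => hf i (mem_of_mem_erase hi)
    have hGabs := sum_norm_prod_div_le (t.erase j) f hf1
    rw [hcard] at hGabs
    rw [← mul_prod_erase t f hj, mul_comm]
    set g := ∏ i ∈ t.erase j, f i
    set σ : ℝ := s + 1 with hσ
    have hσ1 : 1 ≤ σ := by simp [hσ]
    have hσ0 : 0 < σ := by linarith
    have hN1 : (1 : ℝ) ≤ N := by exact_mod_cast hN
    have hN0 : (0 : ℝ) < N := by linarith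
    set x : ℝ := (N : ℝ) ^ (σ / (σ + 1)) with hx
    have hx1 : 1 ≤ x := Real.one_le_rpow hN1 (by positivity)
    set A := ⌊x⌋₊ with hA
    have hA0 : 0 < A := Nat.floor_pos.2 hx1
    have hAx : (A : ℝ) ≤ x := Nat.floor_le (by linarith)
    have hxA : x ≤ 2 * A := by
      have h1 := Nat.lt_floor_add_one x
      have h2 : (1 : ℝ) ≤ A := by exact_mod_cast hA0
      linarith
    have hxN : x ≤ N := by
      calc x ≤ (N : ℝ) ^ (1 : ℝ) := Real.rpow_le_rpow_of_exponent_le hN1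
            (by rw [div_le_one (by linarith)]; linarith)
        _ = N := Real.rpow_one _
    have hAN : A ≤ N := by exact_mod_cast hAx.trans hxN
    set L := 1 + Real.log N with hL
    have hL1 : 1 ≤ L := one_le_one_add_log N
    have hYδ : 0 < Y ^ δ := by positivity
    have hAr : (0 : ℝ) < A := by exact_mod_cast hA0
    have hlog : ∀ n : ℕ, n ≤ N → 1 + Real.log n ≤ L := fun n hn => by
      rcases Nat.eq_zero_or_pos n with rfl | h
      · simpa using hL1
      · have : Real.log n ≤ Real.log N :=
          Real.log_le_log (by exact_mod_cast h) (by exact_mod_cast hn)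
        linarith
    have hexp : 0 ≤ 1 - δ / σ := by
      rw [sub_nonneg, div_le_one hσ0]
      linarith
    rw [sum_Ioc_mul_eq_hyperbola g (f j) hA0 hAN]
    refine (norm_add_le _ _).trans ?_
    have p1 : ‖∑ a ∈ Ioc 0 A, g a * ∑ b ∈ Ioc 0 (N / a), f j b‖ ≤
        K * L ^ (s + 1) * ((N : ℝ) ^ (1 - δ / (σ + 1)) * Y ^ δ) := by
      calc _ ≤ ∑ a ∈ Ioc 0 A, ‖g a‖ / a * (K * (N ^ (1 - δ) * A ^ δ * Y ^ δ)) := by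
            refine norm_sum_le_of_le _ fun a ha => ?_
            rw [mem_Ioc] at ha
            have ha0 : (0 : ℝ) < a := by exact_mod_cast ha.1
            rw [norm_mul, div_mul_eq_mul_div, mul_div_assoc]
            gcongr
            refine (hf j hj (N / a)).trans ?_
            rw [mul_div_assoc]
            refine mul_le_mul_of_nonneg_left ?_ (by linarith)
            calc ((N / a : ℕ) : ℝ) ^ (1 - δ) * Y ^ δ ≤ ((N : ℝ) / a) ^ (1 - δ) * Y ^ δ := by
                  gcongr
                  exact natCast_div_le _ _
              _ = N ^ (1 - δ) * a ^ δ * Y ^ δ / a := by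
                  rw [Real.div_rpow hN0.le ha0.le, Real.rpow_sub ha0, Real.rpow_one]
                  field_simp
              _ ≤ _ := by
                  gcongr
                  exact_mod_cast ha.2
        _ = (∑ a ∈ Ioc 0 A, ‖g a‖ / a) * (K * (N ^ (1 - δ) * A ^ δ * Y ^ δ)) := by rw [sum_mul]
        _ ≤ L ^ (s + 1) * (K * (N ^ (1 - δ) * x ^ δ * Y ^ δ)) := by
            gcongr
            refine (hGabs A).trans ?_
            have := one_le_one_add_log A
            gcongr
            exact hlog A hAN
        _ = K * L ^ (s + 1) * ((N ^ (1 - δ) * x ^ δ) * Y ^ δ) := by ring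
        _ = _ := by
            have : 1 - δ + σ / (σ + 1) * δ = 1 - δ / (σ + 1) := by
              field_simp
              ring
            rw [hx, ← Real.rpow_mul hN0.le, ← Real.rpow_add hN0, this]
    have p2 : ‖∑ b ∈ Ioc 0 (N / A), f j b * ∑ a ∈ Ioc A (N / b), g a‖ ≤
        4 * K₁ * L ^ (s + 2) * ((N : ℝ) ^ (1 - δ / (σ + 1)) * Y ^ δ) := by
      have hNA : ((N / A : ℕ) : ℝ) ≤ 2 * (N : ℝ) ^ (1 / (σ + 1)) := by
        refine (natCast_div_le _ _).trans ?_
        rw [div_le_iff₀ hAr]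
        calc (N : ℝ) = N ^ (1 / (σ + 1)) * x := by
              rw [hx, ← Real.rpow_add hN0]
              conv_lhs => rw [← Real.rpow_one (N : ℝ)]
              congr 1
              field_simp
              ring
          _ ≤ N ^ (1 / (σ + 1)) * (2 * A) := by gcongr
          _ = _ := by ring
      have hδσ : δ / σ ≤ 1 := by
        rw [div_le_one hσ0]
        linarith
      have hδσ0 : 0 ≤ δ / σ := by positivity
      calc _ ≤ ∑ b ∈ Ioc 0 (N / A), (b : ℝ)⁻¹ * (2 * (K₁ * L ^ (s + 1) *
              (N ^ (1 - δ / σ) * ((2 : ℝ) * N ^ (δ / σ / (σ + 1))) * Y ^ δ))) := by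
            refine norm_sum_le_of_le _ fun b hb => ?_
            rw [mem_Ioc] at hb
            have hb0 : (0 : ℝ) < b := by exact_mod_cast hb.1
            have hAb : A ≤ N / b := by
              rw [Nat.le_div_iff_mul_le hb.1, mul_comm]
              exact (Nat.le_div_iff_mul_le hA0).1 hb.2
            have hG' : ∀ n : ℕ, 0 < n → n ≤ N / b → ‖∑ a ∈ Ioc 0 n, g a‖ ≤
                K₁ * L ^ (s + 1) * ((N / b : ℝ) ^ (1 - δ / σ) * Y ^ δ) := fun n h0 hn => by
              refine (hG n h0).trans ?_
              have := one_le_one_add_log n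
              gcongr
              · exact hlog n (hn.trans (Nat.div_le_self _ _))
              · exact (show (n : ℝ) ≤ ((N / b : ℕ) : ℝ) by exact_mod_cast hn).trans
                  (natCast_div_le _ _)
            rw [sum_Ioc_eq_sub _ hAb, norm_mul]
            calc _ ≤ 1 * (K₁ * L ^ (s + 1) * ((N / b : ℝ) ^ (1 - δ / σ) * Y ^ δ) +
                  K₁ * L ^ (s + 1) * ((N / b : ℝ) ^ (1 - δ / σ) * Y ^ δ)) := by
                  refine mul_le_mul (hf1 _ _) ((norm_sub_le _ _).trans (add_le_add ?_ ?_))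
                    (norm_nonneg _) zero_le_one
                  · exact hG' _ (by omega) le_rfl
                  · exact hG' _ hA0 hAb
              _ = (b : ℝ)⁻¹ * (2 * (K₁ * L ^ (s + 1) *
                    (N ^ (1 - δ / σ) * b ^ (δ / σ) * Y ^ δ))) := by
                  rw [Real.div_rpow hN0.le hb0.le, Real.rpow_sub hb0, Real.rpow_one]
                  field_simp
                  ring
              _ ≤ _ := by
                  gcongr
                  calc (b : ℝ) ^ (δ / σ) ≤ (2 * (N : ℝ) ^ (1 / (σ + 1))) ^ (δ / σ) := by
                        gcongr
                        exact (show (b : ℝ) ≤ ((N / A : ℕ) : ℝ) by exact_mod_cast hb.2).trans hNA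
                    _ = 2 ^ (δ / σ) * N ^ (δ / σ / (σ + 1)) := by
                        rw [Real.mul_rpow (by norm_num) (by positivity), ← Real.rpow_mul hN0.le]
                        congr 2
                        ring
                    _ ≤ _ := by
                        gcongr
                        calc (2 : ℝ) ^ (δ / σ) ≤ 2 ^ (1 : ℝ) :=
                              Real.rpow_le_rpow_of_exponent_le one_le_two hδσ
                          _ = 2 := Real.rpow_one _
        _ ≤ L * (2 * (K₁ * L ^ (s + 1) *
              (N ^ (1 - δ / σ) * ((2 : ℝ) * N ^ (δ / σ / (σ + 1))) * Y ^ δ))) := by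
            rw [← sum_mul]
            gcongr
            exact (sum_inv_Ioc_le _).trans (hlog _ (Nat.div_le_self _ _))
        _ = 4 * K₁ * L ^ (s + 2) * ((N ^ (1 - δ / σ) * N ^ (δ / σ / (σ + 1))) * Y ^ δ) := by ring
        _ = _ := by
            have : 1 - δ / σ + δ / σ / (σ + 1) = 1 - δ / (σ + 1) := by
              field_simp
              ring
            rw [← Real.rpow_add hN0, this]
    push_cast
    calc _ ≤ _ := add_le_add p1 p2
      _ ≤ K * L ^ (s + 2) * ((N : ℝ) ^ (1 - δ / (σ + 1)) * Y ^ δ) +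
          4 * K₁ * L ^ (s + 2) * ((N : ℝ) ^ (1 - δ / (σ + 1)) * Y ^ δ) := by
          have : L ^ (s + 1) ≤ L ^ (s + 2) := pow_le_pow_right₀ hL1 (by omega)
          gcongr
      _ = _ := by ring

end hyperbola

section partialSummation

open Finset ArithmeticFunction ArithmeticFunction.zeta

theorem exists_log_pow_le (s : ℕ) (η : ℝ) (hη : 0 < η) :
    ∃ K : ℝ, 1 ≤ K ∧ ∀ N : ℕ, 0 < N → (1 + Real.log N) ^ s ≤ K * (N : ℝ) ^ η := by
  set θ := η / (s + 1) with hθ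
  have hθ0 : 0 < θ := by positivity
  have hK : 1 ≤ 1 + 1 / θ := by
    have : 0 < 1 / θ := by positivity
    linarith
  refine ⟨(1 + 1 / θ) ^ s, one_le_pow₀ hK, fun N hN => ?_⟩
  have hN1 : (1 : ℝ) ≤ N := by exact_mod_cast hN
  have h1 : 1 + Real.log N ≤ (1 + 1 / θ) * (N : ℝ) ^ θ := by
    have h2 := Real.log_le_rpow_div (by linarith : (0 : ℝ) ≤ N) hθ0
    have h3 : 1 ≤ (N : ℝ) ^ θ := Real.one_le_rpow hN1 hθ0.le
    rw [add_mul, one_div_mul_eq_div, one_mul]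
    linarith
  calc (1 + Real.log N) ^ s ≤ ((1 + 1 / θ) * (N : ℝ) ^ θ) ^ s := by
        have := one_le_one_add_log N
        gcongr
    _ = (1 + 1 / θ) ^ s * (N : ℝ) ^ (θ * s) := by
        rw [mul_pow, ← Real.rpow_mul_natCast (by linarith)]
    _ ≤ _ := by
        gcongr
        rw [hθ, div_mul_eq_mul_div, div_le_iff₀ (by positivity)]
        nlinarith

theorem sum_Ioc_div_eq (f : ℕ → ℂ) (A : ℕ) : ∑ a ∈ Ioc 0 A, f a / a =
    (∑ a ∈ Ioc 0 A, f a) / (A + 1) +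
      ∑ a ∈ Ioc 0 A, (∑ b ∈ Ioc 0 a, f b) / (a * (a + 1)) := by
  induction A with
  | zero => simp
  | succ A ih =>
    rw [sum_Ioc_succ_top (Nat.zero_le A), ih, sum_Ioc_succ_top (Nat.zero_le A) f,
      sum_Ioc_succ_top (Nat.zero_le A) (fun a => (∑ b ∈ Ioc 0 a, f b) / ((a : ℂ) * (a + 1))),
      sum_Ioc_succ_top (Nat.zero_le A) f]
    have h1 : ((A : ℂ) + 1) ≠ 0 := by exact_mod_cast Nat.succ_ne_zero A
    have h2 : ((A : ℂ) + 1 + 1) ≠ 0 := by exact_mod_cast Nat.succ_ne_zero (A + 1)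
    push_cast
    field_simp
    ring

/-- Partial summation: if `∑ f a` saves a power then `∑ f a / a` converges with a power saving. -/
theorem exists_sum_div_tendsto {f : ℕ → ℂ} {K δ : ℝ} (hK : 0 ≤ K) (hδ : 0 < δ)
    (hf : ∀ N : ℕ, 0 < N → ‖∑ n ∈ Ioc 0 N, f n‖ ≤ K * (N : ℝ) ^ (1 - δ)) :
    ∃ (c : ℂ) (K' : ℝ), 0 ≤ K' ∧ ∀ A : ℕ, 0 < A →
      ‖∑ a ∈ Ioc 0 A, f a / a - c‖ ≤ K' * (A : ℝ) ^ (-(δ / 2)) := by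
  set t : ℕ → ℂ := fun a => (∑ b ∈ Ioc 0 a, f b) / (a * (a + 1)) with ht
  have ht1 : ∀ a : ℕ, ‖t a‖ ≤ K * (a : ℝ) ^ (-1 - δ) := fun a => by
    rcases Nat.eq_zero_or_pos a with rfl | h
    · simp only [ht, Ioc_self, sum_empty, zero_div, norm_zero]
      positivity
    have ha : (0 : ℝ) < a := by exact_mod_cast h
    have e1 : ‖(a * (a + 1) : ℂ)‖ = a * (a + 1) := by
      have : ((a * (a + 1) : ℕ) : ℂ) = a * (a + 1) := by push_cast; ring
      rw [← this, Complex.norm_natCast]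
      push_cast
      ring
    rw [ht]
    simp only
    rw [norm_div, e1, div_le_iff₀ (by positivity)]
    refine (hf a h).trans ?_
    calc K * (a : ℝ) ^ (1 - δ) = K * (a : ℝ) ^ (-1 - δ) * (a * a) := by
          rw [show 1 - δ = (-1 - δ) + (2 : ℕ) by push_cast; ring, Real.rpow_add_natCast ha.ne']
          ring
      _ ≤ _ := by
          gcongr
          linarith
  have hsum : ∀ s : ℝ, 0 < s → Summable fun a : ℕ => (a : ℝ) ^ (-1 - s) := fun s hs =>
    Real.summable_nat_rpow.2 (by linarith)
  have hts : Summable t := Summable.of_norm_bounded ((hsum δ hδ).mul_left K) ht1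
  set Z := ∑' a : ℕ, (a : ℝ) ^ (-1 - δ / 2) with hZ
  have hZ0 : 0 ≤ Z := tsum_nonneg fun _ => by positivity
  refine ⟨∑' a, t a, K + K * Z, by positivity, fun A hA => ?_⟩
  have hA1 : (1 : ℝ) ≤ A := by exact_mod_cast hA
  have hA0 : (0 : ℝ) < A := by linarith
  have e : ∑ a ∈ Ioc 0 A, t a = ∑ a ∈ range (A + 1), t a := by
    rw [range_eq_Ico, sum_eq_sum_Ico_succ_bot (by omega)]
    have : t 0 = 0 := by simp [ht]
    rw [this, zero_add]
    refine sum_congr ?_ fun _ _ => rfl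
    ext
    simp only [mem_Ioc, mem_Ico]
    omega
  have h2 := hts.sum_add_tsum_nat_add (A + 1)
  have h3 : ‖∑' i, t (i + (A + 1))‖ ≤ K * (A : ℝ) ^ (-(δ / 2)) * Z := by
    have hs1 : Summable fun i : ℕ => ((i + (A + 1) : ℕ) : ℝ) ^ (-1 - δ / 2) :=
      (summable_nat_add_iff (A + 1)).2 (hsum (δ / 2) (by positivity))
    refine (tsum_of_norm_bounded (hs1.mul_left (K * (A : ℝ) ^ (-(δ / 2)))).hasSum
      fun i => ?_).trans ?_
    · refine (ht1 _).trans ?_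
      have hi : (0 : ℝ) < ((i + (A + 1) : ℕ) : ℝ) := by positivity
      rw [show -1 - δ = -(δ / 2) + (-1 - δ / 2) by ring, Real.rpow_add hi, ← mul_assoc]
      gcongr ?_ * ?_ * ?_
      refine Real.rpow_le_rpow_of_nonpos hA0 ?_ (by linarith)
      push_cast
      have : (0 : ℝ) ≤ i := Nat.cast_nonneg i
      linarith
    · rw [tsum_mul_left]
      gcongr
      have h4 := (hsum (δ / 2) (by positivity)).sum_add_tsum_nat_add (A + 1)
      have h5 : 0 ≤ ∑ i ∈ range (A + 1), (i : ℝ) ^ (-1 - δ / 2) :=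
        sum_nonneg fun _ _ => by positivity
      rw [hZ]
      linarith
  have h4 : ‖(∑ a ∈ Ioc 0 A, f a) / ((A : ℂ) + 1)‖ ≤ K * (A : ℝ) ^ (-(δ / 2)) := by
    have e1 : ‖((A : ℂ) + 1)‖ = A + 1 := by
      rw [← Nat.cast_succ, Complex.norm_natCast]
      push_cast
      ring
    rw [norm_div, e1, div_le_iff₀ (by positivity)]
    refine (hf A hA).trans ?_
    calc K * (A : ℝ) ^ (1 - δ) ≤ K * (A : ℝ) ^ (-(δ / 2) + 1) := by
          refine mul_le_mul_of_nonneg_left (Real.rpow_le_rpow_of_exponent_le hA1 (by linarith)) hK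
      _ = K * (A : ℝ) ^ (-(δ / 2)) * A := by
          rw [Real.rpow_add hA0, Real.rpow_one]
          ring
      _ ≤ _ := by
          gcongr
          linarith
  rw [sum_Ioc_div_eq]
  change ‖_ + ∑ a ∈ Ioc 0 A, t a - _‖ ≤ _
  rw [e, ← h2, add_sub_assoc, sub_add_cancel_left]
  refine (norm_add_le _ _).trans ?_
  rw [norm_neg]
  linarith

/-- A weighted sum `∑ f n (N / n) ^ (1 - δ)` is `O(N)` under a Chebyshev-type bound. -/
theorem exists_sum_mul_rpow_le (δ : ℝ) (hδ : 0 < δ) (hδ1 : δ ≤ 1) : ∃ K : ℝ, 1 ≤ K ∧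
    ∀ (f : ℕ → ℝ) (C : ℝ), (∀ n, 0 ≤ f n) → (∀ x : ℕ, ∑ n ∈ Ioc 0 x, f n ≤ C * x) →
      ∀ N : ℕ, ∑ n ∈ Ioc 0 N, f n * ((N : ℝ) / n) ^ (1 - δ) ≤ K * C * N := by
  have hsum : Summable fun a : ℕ => (a : ℝ) ^ (-1 - δ) :=
    Real.summable_nat_rpow.2 (by linarith)
  set Z := ∑' a : ℕ, (a : ℝ) ^ (-1 - δ) with hZ
  have hZ1 : 1 ≤ Z := by
    have := hsum.sum_le_tsum {1} fun _ _ => by positivity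
    simpa using this
  refine ⟨2 * Z, by linarith, fun f C hf hC N => ?_⟩
  have hC0 : 0 ≤ C := by
    have := hC 1
    simp only [Nat.cast_one, mul_one] at this
    exact (sum_nonneg fun n _ => hf n).trans this
  calc ∑ n ∈ Ioc 0 N, f n * ((N : ℝ) / n) ^ (1 - δ)
      ≤ ∑ n ∈ Ioc 0 N, ∑ j ∈ Ioc 0 (N / n), 2 * ((j : ℝ) ^ (-δ) * f n) := by
        refine sum_le_sum fun n hn => ?_
        rw [mem_Ioc] at hn
        have hn0 : (0 : ℝ) < n := by exact_mod_cast hn.1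
        have hJ : 0 < N / n := Nat.div_pos hn.2 hn.1
        have hJ1 : (1 : ℝ) ≤ ((N / n : ℕ) : ℝ) := by exact_mod_cast hJ
        have h1 : (N : ℝ) / n ≤ 2 * ((N / n : ℕ) : ℝ) := by
          rw [div_le_iff₀ hn0]
          have h2 : N ≤ 2 * (N / n) * n := by
            have h3 := Nat.lt_div_mul_add hn.1 (a := N)
            nlinarith
          exact_mod_cast h2
        rw [← mul_sum, ← sum_mul, ← mul_assoc, mul_comm (f n)]
        refine mul_le_mul_of_nonneg_right ?_ (hf n)
        calc ((N : ℝ) / n) ^ (1 - δ) ≤ (2 * ((N / n : ℕ) : ℝ)) ^ (1 - δ) := by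
              gcongr
          _ = 2 ^ (1 - δ) * ((N / n : ℕ) : ℝ) ^ (1 - δ) :=
              Real.mul_rpow (by norm_num) (by linarith)
          _ ≤ 2 * ((N / n : ℕ) : ℝ) ^ (1 - δ) := by
              gcongr
              calc (2 : ℝ) ^ (1 - δ) ≤ 2 ^ (1 : ℝ) :=
                    Real.rpow_le_rpow_of_exponent_le one_le_two (by linarith)
                _ = 2 := Real.rpow_one _
          _ = 2 * ∑ j ∈ Ioc 0 (N / n), ((N / n : ℕ) : ℝ) ^ (-δ) := by
              rw [sum_const, Nat.card_Ioc, nsmul_eq_mul, Nat.sub_zero, sub_eq_add_neg,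
                Real.rpow_add (by linarith), Real.rpow_one]
          _ ≤ _ := by
              refine mul_le_mul_of_nonneg_left (sum_le_sum fun j hj => ?_) zero_le_two
              rw [mem_Ioc] at hj
              have h3 : (0 : ℝ) < j := by exact_mod_cast hj.1
              have h4 : (j : ℝ) ≤ ((N / n : ℕ) : ℝ) := by exact_mod_cast hj.2
              exact Real.rpow_le_rpow_of_nonpos h3 h4 (by linarith)
    _ = ∑ j ∈ Ioc 0 N, ∑ n ∈ Ioc 0 (N / j), 2 * ((j : ℝ) ^ (-δ) * f n) := by
        rw [sum_comm']
        intro a b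
        simp only [mem_Ioc]
        constructor
        · rintro ⟨⟨h1, h2⟩, h3, h4⟩
          have h5 : b * a ≤ N := (Nat.le_div_iff_mul_le (by omega)).1 h4
          exact ⟨⟨h1, (Nat.le_div_iff_mul_le h3).2 (by linarith)⟩, h3, by nlinarith⟩
        · rintro ⟨⟨h1, h2⟩, h3, h4⟩
          have h5 : a * b ≤ N := (Nat.le_div_iff_mul_le h3).1 h2
          exact ⟨⟨h1, by nlinarith⟩, h3, (Nat.le_div_iff_mul_le (by omega)).2 (by linarith)⟩
    _ ≤ ∑ j ∈ Ioc 0 N, 2 * C * N * (j : ℝ) ^ (-1 - δ) := by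
        refine sum_le_sum fun j hj => ?_
        rw [mem_Ioc] at hj
        have hj0 : (0 : ℝ) < j := by exact_mod_cast hj.1
        rw [← mul_sum, ← mul_sum]
        calc 2 * ((j : ℝ) ^ (-δ) * ∑ n ∈ Ioc 0 (N / j), f n)
            ≤ 2 * ((j : ℝ) ^ (-δ) * (C * (N / j))) := by
              gcongr
              refine (hC _).trans ?_
              gcongr
              exact natCast_div_le _ _
          _ = _ := by
              rw [show -1 - δ = -δ - 1 by ring, Real.rpow_sub hj0, Real.rpow_one]
              field_simp
    _ ≤ 2 * C * N * Z := by
        rw [← mul_sum]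
        gcongr
        exact hsum.sum_le_tsum _ fun _ _ => by positivity
    _ = _ := by ring

/-- Pointwise product of an arithmetic function with a completely multiplicative function. -/
def twistFun (φ : ℕ →* ℂ) (f : ArithmeticFunction ℂ) : ArithmeticFunction ℂ :=
  ⟨fun n => φ n * f n, by simp⟩

theorem twistFun_apply (φ : ℕ →* ℂ) (f : ArithmeticFunction ℂ) (n : ℕ) :
    twistFun φ f n = φ n * f n := rfl

/-- Twisting an arithmetic function by a completely multiplicative function. -/
noncomputable def twist (φ : ℕ →* ℂ) : ArithmeticFunction ℂ →+* ArithmeticFunction ℂ where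
  toFun := twistFun φ
  map_one' := by
    ext n
    rw [twistFun_apply, one_apply]
    split_ifs with h <;> simp [h]
  map_mul' f g := by
    ext n
    rw [twistFun_apply, mul_apply, mul_apply, mul_sum]
    refine sum_congr rfl fun x hx => ?_
    rw [← (Nat.mem_divisorsAntidiagonal.1 hx).1, map_mul, twistFun_apply, twistFun_apply]
    ring
  map_zero' := by
    ext n
    rw [twistFun_apply, ArithmeticFunction.zero_apply, mul_zero]
  map_add' f g := by
    ext n
    exact mul_add (φ n) (f n) (g n)

@[simp]
theorem twist_apply (φ : ℕ →* ℂ) (f : ArithmeticFunction ℂ) (n : ℕ) :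
    twist φ f n = φ n * f n := rfl

theorem twist_twist (φ ψ : ℕ →* ℂ) (f : ArithmeticFunction ℂ) :
    twist φ (twist ψ f) = twist (φ * ψ) f := by
  ext n
  simp [mul_assoc]

theorem isMultiplicative_twist {φ : ℕ →* ℂ} {f : ArithmeticFunction ℂ} (hf : f.IsMultiplicative) :
    (twist φ f).IsMultiplicative := by
  refine ⟨by simp [hf.1], fun {m n} h => ?_⟩
  simp only [twist_apply, map_mul, hf.2 h]
  ring

theorem isMultiplicative_finset_prod {ι : Type*} {t : Finset ι} {f : ι → ArithmeticFunction ℂ}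
    (hf : ∀ i ∈ t, (f i).IsMultiplicative) : (∏ i ∈ t, f i).IsMultiplicative := by
  classical
  induction t using Finset.induction_on with
  | empty => simpa using isMultiplicative_one
  | insert j t hj ih =>
    rw [prod_insert hj]
    exact (hf j (mem_insert_self _ _)).mul (ih fun i hi => hf i (mem_insert_of_mem hi))

theorem norm_twist_zeta_le {φ : ℕ →* ℂ} (hφ : ∀ n, ‖φ n‖ ≤ 1) (n : ℕ) :
    ‖twist φ (ζ : ArithmeticFunction ℂ) n‖ ≤ 1 := by
  rw [twist_apply, natCoe_apply, zeta_apply]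
  split_ifs <;> simp [hφ]

theorem mul_apply_prime {R : Type*} [CommSemiring R] (f g : ArithmeticFunction R) {p : ℕ}
    (hp : p.Prime) : (f * g) p = f 1 * g p + f p * g 1 := by
  rw [mul_apply, Nat.sum_divisorsAntidiagonal (fun a b => f a * g b), hp.divisors,
    sum_insert (by simp [hp.one_lt.ne]), sum_singleton, Nat.div_one, Nat.div_self hp.pos]

theorem sum_Ioc_twist_zeta (φ : ℕ →* ℂ) (N : ℕ) :
    ∑ n ∈ Ioc 0 N, twist φ (ζ : ArithmeticFunction ℂ) n = ∑ n ∈ Ioc 0 N, φ n := by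
  refine sum_congr rfl fun n hn => ?_
  rw [mem_Ioc] at hn
  rw [twist_apply, natCoe_apply, zeta_apply, if_neg (by omega)]
  simp

/-- Multiplication by the logarithm. -/
noncomputable def logMul (f : ArithmeticFunction ℂ) : ArithmeticFunction ℂ :=
  ⟨fun n => f n * (Real.log n : ℂ), by simp⟩

@[simp]
theorem logMul_apply (f : ArithmeticFunction ℂ) (n : ℕ) :
    logMul f n = f n * (Real.log n : ℂ) := rfl

theorem logMul_mul (f g : ArithmeticFunction ℂ) :
    logMul (f * g) = logMul f * g + f * logMul g := by
  ext n
  rw [ArithmeticFunction.add_apply, logMul_apply, mul_apply, mul_apply, mul_apply, sum_mul,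
    ← sum_add_distrib]
  refine sum_congr rfl fun x hx => ?_
  rw [Nat.mem_divisorsAntidiagonal] at hx
  have h1 : (x.1 : ℝ) ≠ 0 := by exact_mod_cast left_ne_zero_of_mul (hx.1 ▸ hx.2)
  have h2 : (x.2 : ℝ) ≠ 0 := by exact_mod_cast right_ne_zero_of_mul (hx.1 ▸ hx.2)
  rw [← hx.1, Nat.cast_mul, Real.log_mul h1 h2, Complex.ofReal_add, logMul_apply, logMul_apply]
  ring

theorem logMul_prod {ι : Type*} [DecidableEq ι] (t : Finset ι)
    (f l : ι → ArithmeticFunction ℂ) (h : ∀ i ∈ t, logMul (f i) = l i * f i) :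
    logMul (∏ i ∈ t, f i) = (∑ i ∈ t, l i) * ∏ i ∈ t, f i := by
  induction t using Finset.induction_on with
  | empty =>
    ext n
    rw [prod_empty, sum_empty, zero_mul, logMul_apply, one_apply]
    split_ifs with h <;> simp [h]
  | insert j t hj ih =>
    rw [prod_insert hj, sum_insert hj, logMul_mul, h j (mem_insert_self _ _),
      ih fun i hi => h i (mem_insert_of_mem hi)]
    ring

end partialSummation

section meanValue

open Finset ArithmeticFunction ArithmeticFunction.zeta

theorem exists_norm_sum_mul_sub_le {f g : ArithmeticFunction ℂ} {K δ B : ℝ} {ρ : ℂ} (hK : 0 ≤ K)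
    (hδ : 0 < δ) (hδ1 : δ ≤ 1)
    (hf : ∀ N : ℕ, 0 < N → ‖∑ n ∈ Ioc 0 N, f n‖ ≤ K * (N : ℝ) ^ (1 - δ))
    (hf1 : ∀ n : ℕ, n ≠ 0 → ‖f n‖ ≤ K * (n : ℝ) ^ (1 / 2 : ℝ)) (hg1 : ∀ n, ‖g n‖ ≤ 1)
    (hg : ∀ N : ℕ, ‖∑ n ∈ Ioc 0 N, g n - ρ * N‖ ≤ B) :
    ∃ (c : ℂ) (K' : ℝ), 0 ≤ K' ∧ ∀ N : ℕ, 0 < N →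
      ‖∑ n ∈ Ioc 0 N, (f * g) n - c * N‖ ≤ K' * (N : ℝ) ^ (1 - δ / 4) := by
  obtain ⟨c, K₁, hK₁, hc⟩ := exists_sum_div_tendsto hK hδ hf
  obtain ⟨L, hL, hlog⟩ := exists_log_pow_le 1 (δ / 4) (by positivity)
  have hB : 0 ≤ B := (norm_nonneg _).trans (hg 0)
  refine ⟨ρ * c, K * (B + ‖ρ‖) + 2 * ‖ρ‖ * K₁ + 4 * K * L, by positivity, fun N hN => ?_⟩
  have hN1 : (1 : ℝ) ≤ N := by exact_mod_cast hN
  have hN0 : (0 : ℝ) < N := by linarith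
  set A := Nat.sqrt N with hA
  have hA0 : 0 < A := Nat.sqrt_pos.2 hN
  have hA1 : (1 : ℝ) ≤ A := by exact_mod_cast hA0
  have hA2 : (A : ℝ) * A ≤ N := by exact_mod_cast Nat.sqrt_le N
  have hAN : A ≤ N := Nat.sqrt_le_self N
  have hA3 : (N : ℝ) ≤ (2 * A) * (2 * A) := by
    have h := Nat.lt_succ_sqrt N
    have h' : (N : ℝ) < (A + 1) * (A + 1) := by exact_mod_cast h
    nlinarith
  have hs : (N : ℝ) ^ (1 / 2 : ℝ) * (N : ℝ) ^ (1 / 2 : ℝ) = N := by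
    rw [← Real.rpow_add hN0]
    norm_num
  set s := (N : ℝ) ^ (1 / 2 : ℝ) with hs'
  have hs0 : 0 < s := by positivity
  have hAs : (A : ℝ) ≤ s := by nlinarith
  have hsA : s ≤ 2 * A := by nlinarith
  have hApow : ∀ t : ℝ, 0 ≤ t → t ≤ 1 → (A : ℝ) ^ (-t) ≤ 2 * (N : ℝ) ^ (-(t / 2)) := by
    intro t ht ht1
    calc (A : ℝ) ^ (-t) ≤ (s / 2) ^ (-t) :=
          Real.rpow_le_rpow_of_nonpos (by positivity) (by linarith) (by linarith)
      _ = s ^ (-t) * 2 ^ t := by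
          rw [Real.div_rpow hs0.le zero_le_two, Real.rpow_neg zero_le_two, div_inv_eq_mul]
      _ ≤ s ^ (-t) * 2 := by
          gcongr
          calc (2 : ℝ) ^ t ≤ 2 ^ (1 : ℝ) := Real.rpow_le_rpow_of_exponent_le one_le_two ht1
            _ = 2 := Real.rpow_one _
      _ = _ := by
          rw [hs', ← Real.rpow_mul hN0.le, mul_comm]
          ring_nf
  have e : ∑ n ∈ Ioc 0 N, (f * g) n - ρ * c * N =
      ∑ a ∈ Ioc 0 A, f a * (∑ b ∈ Ioc 0 (N / a), g b - ρ * (N / a)) +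
        ρ * N * (∑ a ∈ Ioc 0 A, f a / a - c) +
        ∑ b ∈ Ioc 0 (N / A), g b * ∑ a ∈ Ioc A (N / b), f a := by
    rw [sum_Ioc_mul_eq_hyperbola f g hA0 hAN]
    have : ∑ a ∈ Ioc 0 A, f a * (∑ b ∈ Ioc 0 (N / a), g b - ρ * (N / a)) =
        ∑ a ∈ Ioc 0 A, f a * ∑ b ∈ Ioc 0 (N / a), g b - ρ * N * ∑ a ∈ Ioc 0 A, f a / a := by
      rw [mul_sum, ← sum_sub_distrib]
      refine sum_congr rfl fun a _ => ?_
      ring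
    rw [this]
    ring
  have b1 : ‖∑ a ∈ Ioc 0 A, f a * (∑ b ∈ Ioc 0 (N / a), g b - ρ * (N / a))‖ ≤
      K * (B + ‖ρ‖) * (N : ℝ) ^ (1 - δ / 4) := by
    calc _ ≤ ∑ a ∈ Ioc 0 A, K * s ^ (1 / 2 : ℝ) * (B + ‖ρ‖) := by
          refine norm_sum_le_of_le _ fun a ha => ?_
          rw [mem_Ioc] at ha
          have ha0 : (0 : ℝ) < a := by exact_mod_cast ha.1
          have haA : (a : ℝ) ≤ A := by exact_mod_cast ha.2
          rw [norm_mul]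
          gcongr
          · exact (hf1 a (by omega)).trans (by gcongr; linarith)
          · have h1 : ‖ρ * (((N / a : ℕ) : ℂ) - (N : ℂ) / a)‖ ≤ ‖ρ‖ := by
              rw [norm_mul]
              refine mul_le_of_le_one_right (norm_nonneg _) ?_
              have h2 : (((N / a : ℕ) : ℂ) - (N : ℂ) / a) =
                  ((((N / a : ℕ) : ℝ) - (N : ℝ) / a : ℝ) : ℂ) := by push_cast; ring
              rw [h2, Complex.norm_real, Real.norm_eq_abs, abs_le]
              have h3 := natCast_div_le N a
              have h4 : (N : ℝ) / a ≤ ((N / a : ℕ) : ℝ) + 1 := by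
                rw [div_le_iff₀ ha0]
                have h5 := Nat.lt_div_mul_add ha.1 (a := N)
                have h6 : N ≤ (N / a + 1) * a := by nlinarith
                exact_mod_cast h6
              constructor <;> linarith
            have h2 := norm_add_le (∑ b ∈ Ioc 0 (N / a), g b - ρ * ((N / a : ℕ) : ℂ))
              (ρ * (((N / a : ℕ) : ℂ) - (N : ℂ) / a))
            have h3 := hg (N / a)
            rw [show (∑ b ∈ Ioc 0 (N / a), g b - ρ * ((N / a : ℕ) : ℂ)) +
              (ρ * (((N / a : ℕ) : ℂ) - (N : ℂ) / a)) =
                ∑ b ∈ Ioc 0 (N / a), g b - ρ * (N / a) by ring] at h2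
            linarith
      _ = (A * s ^ (1 / 2 : ℝ)) * (K * (B + ‖ρ‖)) := by
          rw [sum_const, Nat.card_Ioc, nsmul_eq_mul, Nat.sub_zero]
          ring
      _ ≤ (N : ℝ) ^ (1 - δ / 4) * (K * (B + ‖ρ‖)) := by
          gcongr
          calc A * s ^ (1 / 2 : ℝ) ≤ s * s ^ (1 / 2 : ℝ) := by gcongr
            _ = (N : ℝ) ^ (3 / 4 : ℝ) := by
              rw [hs', ← Real.rpow_mul hN0.le, ← Real.rpow_add hN0]
              norm_num
            _ ≤ _ := Real.rpow_le_rpow_of_exponent_le hN1 (by linarith)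
      _ = _ := by ring
  have b2 : ‖ρ * N * (∑ a ∈ Ioc 0 A, f a / a - c)‖ ≤
      2 * ‖ρ‖ * K₁ * (N : ℝ) ^ (1 - δ / 4) := by
    rw [norm_mul, norm_mul, Complex.norm_natCast]
    calc ‖ρ‖ * N * ‖∑ a ∈ Ioc 0 A, f a / a - c‖
        ≤ ‖ρ‖ * N * (K₁ * (2 * (N : ℝ) ^ (-(δ / 2 / 2)))) := by
          gcongr
          exact (hc A hA0).trans (by gcongr; exact hApow _ (by linarith) (by linarith))
      _ = _ := by
          rw [show 1 - δ / 4 = 1 + -(δ / 2 / 2) by ring, Real.rpow_add hN0, Real.rpow_one]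
          ring
  have b3 : ‖∑ b ∈ Ioc 0 (N / A), g b * ∑ a ∈ Ioc A (N / b), f a‖ ≤
      4 * K * L * (N : ℝ) ^ (1 - δ / 4) := by
    calc _ ≤ ∑ b ∈ Ioc 0 (N / A), 2 * K * N * (2 * (N : ℝ) ^ (-(δ / 2))) * (b : ℝ)⁻¹ := by
          refine norm_sum_le_of_le _ fun b hb => ?_
          rw [mem_Ioc] at hb
          have hb0 : (0 : ℝ) < b := by exact_mod_cast hb.1
          have hbA : b * A ≤ N := (Nat.le_div_iff_mul_le hA0).1 hb.2
          have hAb : A ≤ N / b := (Nat.le_div_iff_mul_le hb.1).2 (by linarith)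
          have hAb' : (A : ℝ) ≤ N / b := by
            rw [le_div_iff₀ hb0]
            exact_mod_cast (by linarith : A * b ≤ N)
          rw [norm_mul, sum_Ioc_eq_sub f hAb]
          calc ‖g b‖ * ‖∑ a ∈ Ioc 0 (N / b), f a - ∑ a ∈ Ioc 0 A, f a‖
              ≤ 1 * (K * ((N : ℝ) / b) ^ (1 - δ) + K * ((N : ℝ) / b) ^ (1 - δ)) := by
                gcongr
                · exact hg1 b
                · refine (norm_sub_le _ _).trans (add_le_add ?_ ?_)
                  · refine (hf _ (by omega)).trans ?_
                    have h1 := natCast_div_le N b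
                    gcongr
                  · refine (hf _ hA0).trans ?_
                    gcongr
            _ = 2 * K * (((N : ℝ) / b) * ((N : ℝ) / b) ^ (-δ)) := by
                rw [sub_eq_add_neg, Real.rpow_add (by positivity), Real.rpow_one]
                ring
            _ ≤ 2 * K * (((N : ℝ) / b) * (2 * (N : ℝ) ^ (-(δ / 2)))) := by
                gcongr
                exact (Real.rpow_le_rpow_of_nonpos (by linarith) hAb' (by linarith)).trans
                  (hApow δ hδ.le hδ1)
            _ = _ := by ring
      _ ≤ 2 * K * N * (2 * (N : ℝ) ^ (-(δ / 2))) * (L * (N : ℝ) ^ (δ / 4)) := by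
          rw [← mul_sum]
          gcongr
          calc ∑ b ∈ Ioc 0 (N / A), (b : ℝ)⁻¹ ≤ ∑ b ∈ Ioc 0 N, (b : ℝ)⁻¹ :=
                sum_le_sum_of_subset_of_nonneg
                  (Ioc_subset_Ioc_right (Nat.div_le_self _ _)) fun _ _ _ => by positivity
            _ ≤ 1 + Real.log N := sum_inv_Ioc_le N
            _ ≤ _ := by simpa using hlog N hN
      _ = _ := by
          rw [show 1 - δ / 4 = 1 + -(δ / 2) + δ / 4 by ring, Real.rpow_add hN0,
            Real.rpow_add hN0, Real.rpow_one]
          ring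
  rw [e]
  refine (norm_add₃_le ..).trans ?_
  linarith

end meanValue

section cyclotomicCoeff

open Finset ArithmeticFunction ArithmeticFunction.zeta
open scoped ComplexOrder

/-- A Dirichlet character as a completely multiplicative function on `ℕ`. -/
noncomputable def charHom {m : ℕ} (χ : DirichletCharacter ℂ m) : ℕ →* ℂ :=
  χ.toMonoidHom.comp (Nat.castRingHom (ZMod m))

@[simp]
theorem charHom_apply {m : ℕ} (χ : DirichletCharacter ℂ m) (n : ℕ) : charHom χ n = χ n := rfl

theorem norm_charHom_le {m : ℕ} (χ : DirichletCharacter ℂ m) (n : ℕ) : ‖charHom χ n‖ ≤ 1 :=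
  χ.norm_le_one _

/-- The product of the Dirichlet series of all characters mod `m`. -/
noncomputable def cycloCoeff (m : ℕ) : ArithmeticFunction ℂ :=
  ∏ χ : DirichletCharacter ℂ m, twist (charHom χ) (ζ : ArithmeticFunction ℂ)

/-- The von Mangoldt function with complex values. -/
noncomputable def complexLambda : ArithmeticFunction ℂ := ⟨fun n => (vonMangoldt n : ℂ), by simp⟩

theorem complexLambda_apply (n : ℕ) : complexLambda n = (vonMangoldt n : ℂ) := rfl

/-- `φ(m) vonMangoldt` restricted to the class `1` mod `m`. -/
noncomputable def cycloLambda (m : ℕ) : ArithmeticFunction ℂ :=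
  ∑ χ : DirichletCharacter ℂ m, twist (charHom χ) complexLambda

theorem arithmeticFunction_sum_apply {ι R : Type*} [AddCommMonoid R] (t : Finset ι)
    (f : ι → ArithmeticFunction R) (n : ℕ) : (∑ i ∈ t, f i) n = ∑ i ∈ t, f i n := by
  classical
  induction t using Finset.induction_on with
  | empty => simp
  | insert j t hj ih => rw [sum_insert hj, sum_insert hj, ArithmeticFunction.add_apply, ih]

theorem prod_apply_one {ι R : Type*} [CommSemiring R] (t : Finset ι)
    (f : ι → ArithmeticFunction R) : (∏ i ∈ t, f i) 1 = ∏ i ∈ t, f i 1 := by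
  classical
  induction t using Finset.induction_on with
  | empty => simp
  | insert j t hj ih => rw [prod_insert hj, prod_insert hj, mul_apply_one, ih]

theorem prod_apply_prime {ι R : Type*} [CommSemiring R] (t : Finset ι)
    (f : ι → ArithmeticFunction R) (hf : ∀ i ∈ t, f i 1 = 1) {p : ℕ} (hp : p.Prime) :
    (∏ i ∈ t, f i) p = ∑ i ∈ t, f i p := by
  classical
  induction t using Finset.induction_on with
  | empty => simp [one_apply, hp.ne_one]
  | insert j t hj ih =>
    rw [prod_insert hj, sum_insert hj, mul_apply_prime _ _ hp,
      ih fun i hi => hf i (mem_insert_of_mem hi), hf j (mem_insert_self _ _), prod_apply_one,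
      prod_eq_one fun i hi => hf i (mem_insert_of_mem hi)]
    ring

theorem twist_zeta_one (φ : ℕ →* ℂ) : twist φ (ζ : ArithmeticFunction ℂ) 1 = 1 := by simp

theorem twist_zeta_apply (φ : ℕ →* ℂ) {n : ℕ} (hn : n ≠ 0) :
    twist φ (ζ : ArithmeticFunction ℂ) n = φ n := by simp [hn]

theorem isMultiplicative_twist_zeta (φ : ℕ →* ℂ) :
    (twist φ (ζ : ArithmeticFunction ℂ)).IsMultiplicative :=
  isMultiplicative_twist isMultiplicative_zeta.natCast

theorem isMultiplicative_cycloCoeff (m : ℕ) : (cycloCoeff m).IsMultiplicative :=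
  isMultiplicative_finset_prod fun _ _ => isMultiplicative_twist_zeta _

theorem logMul_twist (φ : ℕ →* ℂ) (f : ArithmeticFunction ℂ) :
    logMul (twist φ f) = twist φ (logMul f) := by
  ext n
  simp [mul_assoc]

theorem logMul_zeta : logMul (ζ : ArithmeticFunction ℂ) = complexLambda * ζ := by
  ext n
  rw [coe_mul_zeta_apply, logMul_apply]
  rcases eq_or_ne n 0 with rfl | hn
  · simp
  · simp only [complexLambda_apply]
    rw [← Complex.ofReal_sum, vonMangoldt_sum]
    simp [hn]

theorem logMul_cycloCoeff (m : ℕ) : logMul (cycloCoeff m) = cycloLambda m * cycloCoeff m := by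
  classical
  refine logMul_prod _ _ _ fun χ _ => ?_
  rw [logMul_twist, logMul_zeta, map_mul]

theorem cycloLambda_apply (m : ℕ) [NeZero m] (n : ℕ) : cycloLambda m n =
    ((if (n : ZMod m) = 1 then (m.totient : ℝ) * vonMangoldt n else 0 : ℝ) : ℂ) := by
  rw [cycloLambda, arithmeticFunction_sum_apply]
  simp only [twist_apply, charHom_apply, complexLambda_apply]
  rw [← sum_mul, DirichletCharacter.sum_characters_eq]
  split_ifs <;> simp

theorem cycloCoeff_apply_prime (m : ℕ) [NeZero m] {p : ℕ} (hp : p.Prime) :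
    cycloCoeff m p = if (p : ZMod m) = 1 then (m.totient : ℂ) else 0 := by
  rw [cycloCoeff, prod_apply_prime _ _ (fun _ _ => twist_zeta_one _) hp,
    ← DirichletCharacter.sum_characters_eq ℂ (p : ZMod m)]
  exact sum_congr rfl fun χ _ => twist_zeta_apply _ hp.ne_zero

theorem cycloCoeff_one (m : ℕ) : cycloCoeff m 1 = 1 := (isMultiplicative_cycloCoeff m).1

theorem cycloLambda_nonneg (m : ℕ) [NeZero m] (n : ℕ) : 0 ≤ cycloLambda m n := by
  rw [cycloLambda_apply, ← Complex.ofReal_zero, Complex.real_le_real]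
  have := vonMangoldt_nonneg (n := n)
  split_ifs <;> positivity

theorem cycloCoeff_nonneg (m : ℕ) [NeZero m] (n : ℕ) : 0 ≤ cycloCoeff m n := by
  induction n using Nat.strong_induction_on with
  | _ n ih =>
    rcases n.eq_zero_or_pos with rfl | h0
    · simp
    rcases eq_or_ne n 1 with rfl | h1
    · simp [cycloCoeff_one]
    have h := congrArg (fun f => f n) (logMul_cycloCoeff m)
    simp only [logMul_apply, mul_apply] at h
    have hl : 0 < Real.log n := Real.log_pos (by exact_mod_cast (by omega : 1 < n))
    have h2 : 0 ≤ cycloCoeff m n * (Real.log n : ℂ) := by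
      rw [h]
      refine sum_nonneg fun x hx => ?_
      rw [Nat.mem_divisorsAntidiagonal] at hx
      rcases eq_or_ne x.1 1 with h3 | h3
      · rw [h3, cycloLambda_apply]
        simp
      · refine mul_nonneg (cycloLambda_nonneg m _) (ih _ ?_)
        have h4 : x.1 ≠ 0 := left_ne_zero_of_mul (hx.1 ▸ hx.2)
        have h5 : x.2 ≠ 0 := right_ne_zero_of_mul (hx.1 ▸ hx.2)
        have h6 : 2 ≤ x.1 := by omega
        nlinarith [hx.1, Nat.pos_of_ne_zero h5]
    have h3 : cycloCoeff m n = cycloCoeff m n * (Real.log n : ℂ) * ((Real.log n)⁻¹ : ℝ) := by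
      rw [mul_assoc, ← Complex.ofReal_mul, mul_inv_cancel₀ hl.ne']
      simp
    rw [h3]
    refine mul_nonneg h2 ?_
    rw [← Complex.ofReal_zero, Complex.real_le_real]
    positivity

/-- The real-valued version of `cycloCoeff`. -/
noncomputable def cycloReal (m n : ℕ) : ℝ := (cycloCoeff m n).re

theorem cycloCoeff_eq_cycloReal (m : ℕ) [NeZero m] (n : ℕ) :
    cycloCoeff m n = (cycloReal m n : ℂ) := by
  have h := Complex.nonneg_iff.1 (cycloCoeff_nonneg m n)
  exact Complex.ext (by simp [cycloReal]) (by simp [← h.2])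

theorem cycloReal_nonneg (m : ℕ) [NeZero m] (n : ℕ) : 0 ≤ cycloReal m n :=
  (Complex.nonneg_iff.1 (cycloCoeff_nonneg m n)).1

theorem cycloReal_mul (m : ℕ) [NeZero m] {a b : ℕ} (h : a.Coprime b) :
    cycloReal m (a * b) = cycloReal m a * cycloReal m b := by
  have := (isMultiplicative_cycloCoeff m).2 h
  simp only [cycloCoeff_eq_cycloReal] at this
  exact_mod_cast this

theorem cycloReal_prime (m : ℕ) [NeZero m] {p : ℕ} (hp : p.Prime) :
    cycloReal m p = if (p : ZMod m) = 1 then (m.totient : ℝ) else 0 := by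
  rw [cycloReal, cycloCoeff_apply_prime m hp]
  split_ifs <;> simp

theorem cycloReal_one (m : ℕ) : cycloReal m 1 = 1 := by simp [cycloReal, cycloCoeff_one]

/-- `φ(m) vonMangoldt` restricted to the class `1` mod `m`, with real values. -/
noncomputable def cycloLambdaReal (m n : ℕ) : ℝ :=
  if (n : ZMod m) = 1 then (m.totient : ℝ) * vonMangoldt n else 0

theorem cycloLambdaReal_nonneg (m n : ℕ) : 0 ≤ cycloLambdaReal m n := by
  have := vonMangoldt_nonneg (n := n)
  rw [cycloLambdaReal]
  split_ifs <;> positivity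

theorem cycloReal_mul_log (m : ℕ) [NeZero m] (n : ℕ) : cycloReal m n * Real.log n =
    ∑ x ∈ n.divisorsAntidiagonal, cycloLambdaReal m x.1 * cycloReal m x.2 := by
  have h := congrArg (fun f => f n) (logMul_cycloCoeff m)
  simp only [logMul_apply, mul_apply, cycloLambda_apply, cycloCoeff_eq_cycloReal] at h
  exact_mod_cast h

theorem cycloLambdaReal_le_mul_log (m : ℕ) [NeZero m] (n : ℕ) :
    cycloLambdaReal m n ≤ cycloReal m n * Real.log n := by
  rcases eq_or_ne n 0 with rfl | hn
  · simp [cycloLambdaReal]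
  rw [cycloReal_mul_log]
  have hmem : (n, 1) ∈ n.divisorsAntidiagonal := Nat.mem_divisorsAntidiagonal.2 ⟨mul_one n, hn⟩
  have := single_le_sum (f := fun x : ℕ × ℕ => cycloLambdaReal m x.1 * cycloReal m x.2)
    (fun x _ => mul_nonneg (cycloLambdaReal_nonneg m _) (cycloReal_nonneg m _)) hmem
  simpa [cycloReal_one] using this

theorem sum_cycloLambdaReal_le (m x : ℕ) :
    ∑ n ∈ Ioc 0 x, cycloLambdaReal m n ≤ m.totient * (Real.log 4 + 4) * x := by
  have h := Chebyshev.psi_le_const_mul_self (x := (x : ℝ)) (Nat.cast_nonneg x)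
  rw [Chebyshev.psi, Nat.floor_natCast] at h
  calc ∑ n ∈ Ioc 0 x, cycloLambdaReal m n ≤ ∑ n ∈ Ioc 0 x, (m.totient : ℝ) * vonMangoldt n := by
        refine sum_le_sum fun n _ => ?_
        have := vonMangoldt_nonneg (n := n)
        rw [cycloLambdaReal]
        split_ifs
        · exact le_rfl
        · positivity
    _ ≤ _ := by
        rw [← mul_sum, mul_assoc]
        gcongr

end cyclotomicCoeff

section cyclotomicMean

open Finset ArithmeticFunction ArithmeticFunction.zeta

theorem norm_sum_Ioc_le_of_sum_eq_zero {D : ℕ} [NeZero D] (f : ZMod D → ℂ) (hf : ∀ x, ‖f x‖ ≤ 1)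
    (h0 : ∑ x, f x = 0) (N : ℕ) : ‖∑ n ∈ Ioc 0 N, f n‖ ≤ D := by
  have h := norm_sum_range_le_of_sum_eq_zero f hf h0 N 1
  have e : ∑ n ∈ Ioc 0 N, f n = ∑ n ∈ range N, f (1 + n) := by
    have : Ioc 0 N = Ico 1 (N + 1) := by
      ext
      simp only [mem_Ioc, mem_Ico]
      omega
    rw [this, sum_Ico_eq_sum_range]
    simp
  rw [e]
  exact h

theorem norm_sum_charHom_le {m : ℕ} [NeZero m] {χ : DirichletCharacter ℂ m} (hχ : χ ≠ 1) (N : ℕ) :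
    ‖∑ n ∈ Ioc 0 N, charHom χ n‖ ≤ m :=
  norm_sum_Ioc_le_of_sum_eq_zero (fun x => χ x) (fun x => χ.norm_le_one x)
    (MulChar.sum_eq_zero_of_ne_one hχ) N

theorem norm_sum_charHom_one_sub_le (m : ℕ) [NeZero m] (N : ℕ) :
    ‖∑ n ∈ Ioc 0 N, charHom (1 : DirichletCharacter ℂ m) n - (m.totient / m : ℂ) * N‖ ≤ m := by
  have hm : (0 : ℝ) < m := by exact_mod_cast Nat.pos_of_neZero m
  have hm' : (m : ℂ) ≠ 0 := by exact_mod_cast (NeZero.ne m)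
  have h1 : ((m.totient : ℝ) / m) ≤ 1 := by
    rw [div_le_one hm]
    exact_mod_cast Nat.totient_le m
  have h2 : 0 ≤ ((m.totient : ℝ) / m) := by positivity
  have h := norm_sum_Ioc_le_of_sum_eq_zero
    (fun x : ZMod m => (1 : DirichletCharacter ℂ m) x - (m.totient / m : ℂ)) ?_ ?_ N
  · rw [sum_sub_distrib, sum_const, Nat.card_Ioc, nsmul_eq_mul, Nat.sub_zero, mul_comm (N : ℂ)] at h
    exact h
  · intro x
    have e : (m.totient / m : ℂ) = (((m.totient : ℝ) / m : ℝ) : ℂ) := by push_cast; rfl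
    by_cases hx : IsUnit x
    · rw [MulChar.one_apply hx, e, ← Complex.ofReal_one, ← Complex.ofReal_sub, Complex.norm_real,
        Real.norm_eq_abs, abs_le]
      constructor <;> linarith
    · rw [MulChar.map_nonunit _ hx, e, zero_sub, norm_neg, Complex.norm_real, Real.norm_eq_abs,
        abs_le]
      constructor <;> linarith
  · rw [sum_sub_distrib, MulChar.sum_one_eq_card_units, sum_const, card_univ, ZMod.card,
      ZMod.card_units_eq_totient, nsmul_eq_mul]
    field_simp
    simp

theorem exists_norm_sum_nonprincipal_le (m : ℕ) [NeZero m] [DecidableEq (DirichletCharacter ℂ m)] :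
    ∃ K δ : ℝ, 0 ≤ K ∧ 0 < δ ∧ δ ≤ 1 ∧ ∀ N : ℕ, 0 < N → ‖∑ n ∈ Ioc 0 N,
      (∏ χ ∈ (univ : Finset (DirichletCharacter ℂ m)).erase 1,
        twist (charHom χ) (ζ : ArithmeticFunction ℂ)) n‖ ≤ K * (N : ℝ) ^ (1 - δ) := by
  set t := (univ : Finset (DirichletCharacter ℂ m)).erase 1 with ht
  have hm1 : (1 : ℝ) ≤ m := by exact_mod_cast Nat.pos_of_neZero m
  rcases Nat.eq_zero_or_pos (#t) with h | h
  · refine ⟨1, 1, zero_le_one, one_pos, le_rfl, fun N hN => ?_⟩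
    rw [card_eq_zero.1 h, prod_empty, sub_self, Real.rpow_zero]
    have : ∑ n ∈ Ioc 0 N, (1 : ArithmeticFunction ℂ) n = 1 := by
      simp only [one_apply]
      rw [sum_ite_eq', if_pos (mem_Ioc.2 ⟨one_pos, hN⟩)]
    rw [this]
    simp
  obtain ⟨s, hs⟩ := Nat.exists_eq_succ_of_ne_zero h.ne'
  obtain ⟨K, hK, hsum⟩ := exists_prod_sum_le s (1 / 2) m (by norm_num) (by norm_num) hm1
  set δ : ℝ := 1 / 2 / (s + 1) with hδ
  have hδ0 : 0 < δ := by positivity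
  have hδ1 : δ ≤ 1 := by
    rw [hδ, div_le_one (by positivity)]
    have : (0 : ℝ) ≤ s := Nat.cast_nonneg s
    linarith
  obtain ⟨L, hL, hlog⟩ := exists_log_pow_le (s + 1) (δ / 2) (by positivity)
  refine ⟨K * L, δ / 2, by positivity, by positivity, by linarith, fun N hN => ?_⟩
  have hN0 : (0 : ℝ) < N := by exact_mod_cast hN
  have h1 := hsum _ t (fun χ => twist (charHom χ) (ζ : ArithmeticFunction ℂ)) hs
    (fun χ n => norm_twist_zeta_le (norm_charHom_le χ) n) 1 le_rfl ?_ N hN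
  · refine h1.trans ?_
    rw [Real.one_rpow, mul_one]
    calc K * (1 + Real.log N) ^ (s + 1) * (N : ℝ) ^ (1 - δ)
        ≤ K * (L * (N : ℝ) ^ (δ / 2)) * (N : ℝ) ^ (1 - δ) := by
          gcongr
          exact hlog N hN
      _ = _ := by
          rw [show 1 - δ / 2 = δ / 2 + (1 - δ) by ring, Real.rpow_add hN0]
          ring
  · intro χ hχ N
    rw [sum_Ioc_twist_zeta, Real.one_rpow, mul_one]
    rcases Nat.eq_zero_or_pos N with rfl | hN
    · simp only [Ioc_self, sum_empty, norm_zero]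
      positivity
    · refine (norm_sum_charHom_le (mem_erase.1 hχ).1 N).trans ?_
      refine le_mul_of_one_le_right (by linarith) ?_
      exact Real.one_le_rpow (by exact_mod_cast hN) (by norm_num)

/-- The coefficients `cycloReal` have a positive mean value, with a power-saving error term. -/
theorem exists_cycloReal_mean (m : ℕ) [NeZero m] : ∃ c K δ : ℝ, 0 < c ∧ 0 ≤ K ∧ 0 < δ ∧ δ ≤ 1 / 2 ∧
    ∀ N : ℕ, 0 < N → |∑ n ∈ Ioc 0 N, cycloReal m n - c * N| ≤ K * (N : ℝ) ^ (1 - δ) := by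
  classical
  obtain ⟨K₀, δ, hK₀, hδ, hδ1, hf⟩ := exists_norm_sum_nonprincipal_le m
  set t := (univ : Finset (DirichletCharacter ℂ m)).erase 1 with ht
  obtain ⟨K₁, hK₁, hb⟩ := norm_prod_apply_le (#t) (1 / 2) (by norm_num)
  have hprod : cycloCoeff m = (∏ χ ∈ t, twist (charHom χ) (ζ : ArithmeticFunction ℂ)) *
      twist (charHom 1) (ζ : ArithmeticFunction ℂ) :=
    (prod_erase_mul _ _ (mem_univ _)).symm
  obtain ⟨c, K, hK, hc⟩ := exists_norm_sum_mul_sub_le (K := max K₀ K₁) (δ := δ)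
    (g := twist (charHom (1 : DirichletCharacter ℂ m)) (ζ : ArithmeticFunction ℂ))
    (f := ∏ χ ∈ t, twist (charHom χ) (ζ : ArithmeticFunction ℂ)) (B := m)
    (ρ := (m.totient / m : ℂ))
    (le_max_of_le_left hK₀) hδ hδ1
    (fun N hN => (hf N hN).trans (by gcongr; exact le_max_left _ _))
    (fun n hn => (hb _ t _ rfl (fun χ n => norm_twist_zeta_le (norm_charHom_le χ) n) n hn).trans
      (by gcongr; exact le_max_right _ _))
    (fun n => norm_twist_zeta_le (norm_charHom_le _) n)
    (fun N => by
      rw [sum_Ioc_twist_zeta]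
      exact norm_sum_charHom_one_sub_le m N)
  rw [← hprod] at hc
  have hmain : ∀ N : ℕ, 0 < N →
      |∑ n ∈ Ioc 0 N, cycloReal m n - c.re * N| ≤ K * (N : ℝ) ^ (1 - δ / 4) := fun N hN => by
    refine le_trans ?_ (hc N hN)
    have := Complex.abs_re_le_norm (∑ n ∈ Ioc 0 N, cycloCoeff m n - c * N)
    simpa [cycloReal] using this
  refine ⟨c.re, K, δ / 4, ?_, hK, by positivity, by linarith, hmain⟩
  by_contra! hc0
  have hT : ∀ N : ℕ, 0 < N → ∑ n ∈ Ioc 0 N, cycloReal m n ≤ K * (N : ℝ) ^ (1 - δ / 4) :=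
    fun N hN => by
      have h1 := (abs_le.1 (hmain N hN)).2
      have h2 : c.re * N ≤ 0 := mul_nonpos_of_nonpos_of_nonneg hc0 (Nat.cast_nonneg N)
      linarith
  obtain ⟨L, hL, hlog⟩ := exists_log_pow_le 1 (δ / 8) (by positivity)
  have hnn : ∀ n : ℕ, 0 ≤ cycloReal m n * Real.log n := fun n =>
    mul_nonneg (cycloReal_nonneg m n) (Real.log_natCast_nonneg n)
  have hTl : ∀ N : ℕ, 0 < N → ‖∑ n ∈ Ioc 0 N, ((cycloReal m n * Real.log n : ℝ) : ℂ)‖ ≤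
      K * L * (N : ℝ) ^ (1 - δ / 8) := fun N hN => by
    have hN0 : (0 : ℝ) < N := by exact_mod_cast hN
    rw [← Complex.ofReal_sum, Complex.norm_real, Real.norm_of_nonneg (sum_nonneg fun n _ => hnn n)]
    calc ∑ n ∈ Ioc 0 N, cycloReal m n * Real.log n
        ≤ ∑ n ∈ Ioc 0 N, cycloReal m n * (L * (N : ℝ) ^ (δ / 8)) := by
          refine sum_le_sum fun n hn => ?_
          rw [mem_Ioc] at hn
          have hn0 : (0 : ℝ) < n := by exact_mod_cast hn.1
          have h1 : Real.log n ≤ Real.log N := Real.log_le_log hn0 (by exact_mod_cast hn.2)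
          have h2 := hlog N hN
          rw [pow_one] at h2
          exact mul_le_mul_of_nonneg_left (by linarith) (cycloReal_nonneg m n)
      _ ≤ K * (N : ℝ) ^ (1 - δ / 4) * (L * (N : ℝ) ^ (δ / 8)) := by
          rw [← sum_mul]
          gcongr
          exact hT N hN
      _ = _ := by
          rw [show 1 - δ / 8 = 1 - δ / 4 + δ / 8 by ring, Real.rpow_add hN0]
          ring
  obtain ⟨c', K', hK', hdiv⟩ := exists_sum_div_tendsto (by positivity) (by positivity) hTl
  have hbd : ∀ N : ℕ, 0 < N → ∑ n ∈ Ioc 0 N, cycloReal m n * Real.log n / n ≤ ‖c'‖ + K' :=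
    fun N hN => by
      have hN1 : (1 : ℝ) ≤ N := by exact_mod_cast hN
      have h1 := hdiv N hN
      have h2 : K' * (N : ℝ) ^ (-(δ / 8 / 2)) ≤ K' :=
        mul_le_of_le_one_right hK' (Real.rpow_le_one_of_one_le_of_nonpos hN1 (by linarith))
      have e : ∑ a ∈ Ioc 0 N, ((cycloReal m a * Real.log a : ℝ) : ℂ) / a =
          ((∑ n ∈ Ioc 0 N, cycloReal m n * Real.log n / n : ℝ) : ℂ) := by push_cast; rfl
      rw [e] at h1
      have h3 := norm_le_insert' ((∑ n ∈ Ioc 0 N, cycloReal m n * Real.log n / n : ℝ) : ℂ) c'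
      rw [Complex.norm_real, Real.norm_eq_abs] at h3
      have h4 := le_abs_self (∑ n ∈ Ioc 0 N, cycloReal m n * Real.log n / n)
      linarith
  refine vonMangoldt.not_summable_residueClass_prime_div (q := m) (a := 1) isUnit_one ?_
  have hk : (1 : ℝ) ≤ m.totient := by exact_mod_cast Nat.totient_pos.2 (Nat.pos_of_neZero m)
  have hle : ∀ n : ℕ, (if n.Prime then vonMangoldt.residueClass (1 : ZMod m) n else 0) / n ≤
      cycloReal m n * Real.log n / n := fun n => by
    gcongr
    refine le_trans ?_ (cycloLambdaReal_le_mul_log m n)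
    have h0 := cycloLambdaReal_nonneg m n
    split_ifs with hp
    · simp only [vonMangoldt.residueClass, Set.indicator_apply, Set.mem_ofPred_eq]
      split_ifs with h1
      · rw [cycloLambdaReal, if_pos h1]
        exact le_mul_of_one_le_left vonMangoldt_nonneg hk
      · exact h0
    · exact h0
  refine summable_of_sum_range_le (c := ‖c'‖ + K') (fun n => ?_) fun N => ?_
  · have := vonMangoldt.residueClass_nonneg (1 : ZMod m) n
    split_ifs <;> positivity
  · refine le_trans ?_ (hbd (N + 1) N.succ_pos)
    refine (sum_le_sum fun n _ => hle n).trans ?_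
    have h0 : cycloReal m 0 * Real.log (0 : ℕ) / (0 : ℕ) = 0 := by simp
    have e : ∑ n ∈ Ioc 0 (N + 1), cycloReal m n * Real.log n / n =
        ∑ n ∈ range (N + 2), cycloReal m n * Real.log n / n := by
      refine sum_subset (fun x hx => ?_) fun x hx hx' => ?_
      · rw [mem_Ioc] at hx
        rw [mem_range]
        omega
      · rw [mem_range] at hx
        rw [mem_Ioc] at hx'
        obtain rfl : x = 0 := by omega
        exact h0
    rw [e]
    exact sum_le_sum_of_subset_of_nonneg (range_mono (by omega))
      fun n _ _ => div_nonneg (hnn n) (Nat.cast_nonneg n)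

end cyclotomicMean

section mertens

open Finset ArithmeticFunction ArithmeticFunction.zeta

theorem sum_cycloReal_mul_log (m : ℕ) [NeZero m] (N : ℕ) :
    ∑ n ∈ Ioc 0 N, cycloReal m n * Real.log n =
      ∑ d ∈ Ioc 0 N, cycloLambdaReal m d * ∑ n ∈ Ioc 0 (N / d), cycloReal m n := by
  have h := sum_Ioc_mul_eq_sum_sum (cycloLambda m) (cycloCoeff m) N
  rw [← logMul_cycloCoeff] at h
  simp only [logMul_apply, cycloCoeff_eq_cycloReal, cycloLambda_apply] at h
  exact_mod_cast h

theorem abs_natCast_div_sub_le {N d : ℕ} (hd : 0 < d) :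
    |((N / d : ℕ) : ℝ) - (N : ℝ) / d| ≤ 1 := by
  have hd0 : (0 : ℝ) < d := by exact_mod_cast hd
  have h3 := natCast_div_le N d
  have h4 : (N : ℝ) / d ≤ ((N / d : ℕ) : ℝ) + 1 := by
    rw [div_le_iff₀ hd0]
    have h5 := Nat.lt_div_mul_add hd (a := N)
    have h6 : N ≤ (N / d + 1) * d := by nlinarith
    exact_mod_cast h6
  rw [abs_le]
  constructor <;> linarith

/-- Mertens' theorem for the class `1` mod `m`. -/
theorem exists_mertens (m : ℕ) [NeZero m] : ∃ C : ℝ, 0 ≤ C ∧ ∀ N : ℕ, 0 < N →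
    |∑ d ∈ Ioc 0 N, cycloLambdaReal m d / d - Real.log N| ≤ C := by
  obtain ⟨c, K, δ, hc, hK, hδ, hδ1, hT⟩ := exists_cycloReal_mean m
  obtain ⟨K₁, hK₁, h₁⟩ := exists_sum_mul_rpow_le δ hδ (by linarith)
  obtain ⟨K₂, hK₂, h₂⟩ := exists_sum_mul_rpow_le (1 / 2) (by norm_num) (by norm_num)
  set C₁ : ℝ := m.totient * (Real.log 4 + 4) with hC₁
  have hlog4 : 0 ≤ Real.log 4 := Real.log_nonneg (by norm_num)
  have hC₁0 : 0 ≤ C₁ := by positivity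
  have hTle : ∀ N : ℕ, ∑ n ∈ Ioc 0 N, cycloReal m n ≤ (c + K) * N := fun N => by
    rcases Nat.eq_zero_or_pos N with rfl | hN
    · simp
    have hN1 : (1 : ℝ) ≤ N := by exact_mod_cast hN
    have h1 := (abs_le.1 (hT N hN)).2
    have h2 : (N : ℝ) ^ (1 - δ) ≤ N := by
      calc (N : ℝ) ^ (1 - δ) ≤ (N : ℝ) ^ (1 : ℝ) :=
            Real.rpow_le_rpow_of_exponent_le hN1 (by linarith)
        _ = N := Real.rpow_one _
    have h3 := mul_le_mul_of_nonneg_left h2 hK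
    linarith
  refine ⟨((K + c) * (K₁ * C₁) + 2 * (K₂ * (c + K)) + K / δ) / c, by positivity, fun N hN => ?_⟩
  have hN1 : (1 : ℝ) ≤ N := by exact_mod_cast hN
  have hN0 : (0 : ℝ) < N := by linarith
  set S := ∑ n ∈ Ioc 0 N, cycloReal m n * Real.log n with hS
  set T := ∑ n ∈ Ioc 0 N, cycloReal m n with hT'
  have e1 : |S - c * N * ∑ d ∈ Ioc 0 N, cycloLambdaReal m d / d| ≤
      (K + c) * (K₁ * C₁) * N := by
    have e : S - c * N * ∑ d ∈ Ioc 0 N, cycloLambdaReal m d / d = ∑ d ∈ Ioc 0 N,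
        cycloLambdaReal m d * (∑ n ∈ Ioc 0 (N / d), cycloReal m n - c * (N / d)) := by
      rw [hS, sum_cycloReal_mul_log, mul_sum, ← sum_sub_distrib]
      refine sum_congr rfl fun d _ => ?_
      ring
    rw [e]
    calc _ ≤ ∑ d ∈ Ioc 0 N, (K + c) * (cycloLambdaReal m d * ((N : ℝ) / d) ^ (1 - δ)) := by
          refine (abs_sum_le_sum_abs _ _).trans (sum_le_sum fun d hd => ?_)
          rw [mem_Ioc] at hd
          have hd0 : (0 : ℝ) < d := by exact_mod_cast hd.1
          have hNd : (1 : ℝ) ≤ N / d := by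
            rw [one_le_div hd0]
            exact_mod_cast hd.2
          rw [abs_mul, abs_of_nonneg (cycloLambdaReal_nonneg m d), mul_left_comm]
          refine mul_le_mul_of_nonneg_left ?_ (cycloLambdaReal_nonneg m d)
          have h3 := hT (N / d) (Nat.div_pos hd.2 hd.1)
          have h4 : |c * (((N / d : ℕ) : ℝ) - (N : ℝ) / d)| ≤ c := by
            rw [abs_mul, abs_of_pos hc]
            exact mul_le_of_le_one_right hc.le (abs_natCast_div_sub_le hd.1)
          have h5 : K * ((N / d : ℕ) : ℝ) ^ (1 - δ) ≤ K * ((N : ℝ) / d) ^ (1 - δ) := by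
            have := natCast_div_le N d
            gcongr
            linarith
          have h6 : c ≤ c * ((N : ℝ) / d) ^ (1 - δ) :=
            le_mul_of_one_le_right hc.le (Real.one_le_rpow hNd (by linarith))
          have h7 := abs_add_le (∑ n ∈ Ioc 0 (N / d), cycloReal m n - c * ((N / d : ℕ) : ℝ))
            (c * (((N / d : ℕ) : ℝ) - (N : ℝ) / d))
          rw [show ∑ n ∈ Ioc 0 (N / d), cycloReal m n - c * ((N / d : ℕ) : ℝ) +
            c * (((N / d : ℕ) : ℝ) - (N : ℝ) / d) =
              ∑ n ∈ Ioc 0 (N / d), cycloReal m n - c * (N / d) by ring] at h7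
          linarith
      _ ≤ (K + c) * (K₁ * C₁ * N) := by
          rw [← mul_sum]
          gcongr
          exact h₁ _ C₁ (cycloLambdaReal_nonneg m) (sum_cycloLambdaReal_le m) N
      _ = _ := by ring
  have e2 : |T * Real.log N - S| ≤ 2 * (K₂ * (c + K)) * N := by
    have e : T * Real.log N - S =
        ∑ n ∈ Ioc 0 N, cycloReal m n * Real.log ((N : ℝ) / n) := by
      rw [hS, hT', sum_mul, ← sum_sub_distrib]
      refine sum_congr rfl fun n hn => ?_
      rw [mem_Ioc] at hn
      rw [Real.log_div hN0.ne' (by exact_mod_cast hn.1.ne')]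
      ring
    rw [e]
    calc _ ≤ ∑ n ∈ Ioc 0 N, 2 * (cycloReal m n * ((N : ℝ) / n) ^ (1 - 1 / 2 : ℝ)) := by
          refine (abs_sum_le_sum_abs _ _).trans (sum_le_sum fun n hn => ?_)
          rw [mem_Ioc] at hn
          have hn0 : (0 : ℝ) < n := by exact_mod_cast hn.1
          have hNn : (1 : ℝ) ≤ N / n := by
            rw [one_le_div hn0]
            exact_mod_cast hn.2
          rw [abs_mul, abs_of_nonneg (cycloReal_nonneg m n), mul_left_comm,
            abs_of_nonneg (Real.log_nonneg hNn)]
          refine mul_le_mul_of_nonneg_left ?_ (cycloReal_nonneg m n)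
          have := Real.log_le_rpow_div (by linarith : (0 : ℝ) ≤ N / n)
            (by norm_num : (0 : ℝ) < 1 / 2)
          rw [show (1 : ℝ) - 1 / 2 = 1 / 2 by norm_num]
          linarith
      _ ≤ 2 * (K₂ * (c + K) * N) := by
          rw [← mul_sum]
          gcongr
          exact h₂ _ _ (cycloReal_nonneg m) hTle N
      _ = _ := by ring
  have e3 : |T * Real.log N - c * N * Real.log N| ≤ K / δ * N := by
    have hl := Real.log_nonneg hN1
    rw [← sub_mul, abs_mul, abs_of_nonneg hl]
    calc |T - c * N| * Real.log N ≤ K * (N : ℝ) ^ (1 - δ) * ((N : ℝ) ^ δ / δ) := by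
          gcongr
          · exact hT N hN
          · exact Real.log_le_rpow_div hN0.le hδ
      _ = K / δ * ((N : ℝ) ^ (1 - δ) * (N : ℝ) ^ δ) := by ring
      _ = _ := by
          rw [← Real.rpow_add hN0, sub_add_cancel, Real.rpow_one]
  have hcN : 0 < c * N := by positivity
  have e4 : (c * N) * |∑ d ∈ Ioc 0 N, cycloLambdaReal m d / d - Real.log N| ≤
      ((K + c) * (K₁ * C₁) + 2 * (K₂ * (c + K)) + K / δ) * N := by
    rw [← abs_of_pos hcN, ← abs_mul, abs_le]
    rw [abs_le] at e1 e2 e3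
    constructor <;> linarith [e1.1, e1.2, e2.1, e2.2, e3.1, e3.2]
  rw [le_div_iff₀ hc]
  refine le_of_mul_le_mul_right ?_ hN0
  linarith

/-- The primes in `(y, N]` that are `1` mod `m`. -/
def primesIoc (m y N : ℕ) : Finset ℕ := {p ∈ Ioc y N | p.Prime ∧ (p : ZMod m) = 1}

theorem mem_primesIoc {m y N p : ℕ} :
    p ∈ primesIoc m y N ↔ (y < p ∧ p ≤ N) ∧ p.Prime ∧ (p : ZMod m) = 1 := by
  rw [primesIoc, mem_filter, mem_Ioc]

theorem cycloLambdaReal_primesIoc {m y N p : ℕ} (hp : p ∈ primesIoc m y N) :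
    cycloLambdaReal m p = m.totient * Real.log p := by
  rw [mem_primesIoc] at hp
  rw [cycloLambdaReal, if_pos hp.2.2, vonMangoldt_apply_prime hp.2.1]

theorem sum_primesIoc_consecutive {m a b c : ℕ} (f : ℕ → ℝ) (hab : a ≤ b) (hbc : b ≤ c) :
    ∑ p ∈ primesIoc m a b, f p + ∑ p ∈ primesIoc m b c, f p = ∑ p ∈ primesIoc m a c, f p := by
  simp only [primesIoc, sum_filter]
  exact sum_Ioc_consecutive _ hab hbc

theorem exists_sum_primes_log_div_le (m : ℕ) [NeZero m] : ∃ C : ℝ, 0 ≤ C ∧ ∀ y N : ℕ, 0 < y →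
    y ≤ N → ∑ p ∈ primesIoc m y N, m.totient * Real.log p / p ≤
      Real.log N - Real.log y + C := by
  obtain ⟨C, hC, h⟩ := exists_mertens m
  refine ⟨2 * C, by positivity, fun y N hy hyN => ?_⟩
  have h1 := (abs_le.1 (h N (by omega))).2
  have h2 := (abs_le.1 (h y hy)).1
  have h3 := sum_Ioc_eq_sub (fun d : ℕ => cycloLambdaReal m d / d) hyN
  have h4 : ∑ p ∈ primesIoc m y N, m.totient * Real.log p / p ≤
      ∑ d ∈ Ioc y N, cycloLambdaReal m d / d := by
    calc _ = ∑ p ∈ primesIoc m y N, cycloLambdaReal m p / p :=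
          sum_congr rfl fun p hp => by rw [cycloLambdaReal_primesIoc hp]
      _ ≤ _ := sum_le_sum_of_subset_of_nonneg (filter_subset _ _)
          fun d _ _ => div_nonneg (cycloLambdaReal_nonneg m d) (Nat.cast_nonneg d)
  linarith

theorem exists_sum_primes_rpow_le (m : ℕ) [NeZero m] (δ : ℝ) (hδ : 0 < δ) (hδ1 : δ ≤ 1) :
    ∃ C : ℝ, 0 ≤ C ∧ ∀ y N : ℕ, 1 < y →
      ∑ p ∈ primesIoc m y N, (m.totient : ℝ) * ((N : ℝ) / p) ^ (1 - δ) ≤ C * N / Real.log y := by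
  obtain ⟨K₁, hK₁, h₁⟩ := exists_sum_mul_rpow_le δ hδ hδ1
  have hlog4 : 0 ≤ Real.log 4 := Real.log_nonneg (by norm_num)
  refine ⟨K₁ * (m.totient * (Real.log 4 + 4)), by positivity, fun y N hy => ?_⟩
  have hy1 : (1 : ℝ) < y := by exact_mod_cast hy
  have hl := Real.log_pos hy1
  rw [le_div_iff₀ hl, sum_mul]
  refine le_trans ?_ (h₁ _ _ (cycloLambdaReal_nonneg m) (sum_cycloLambdaReal_le m) N)
  calc _ ≤ ∑ p ∈ primesIoc m y N, cycloLambdaReal m p * ((N : ℝ) / p) ^ (1 - δ) := by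
        refine sum_le_sum fun p hp => ?_
        rw [cycloLambdaReal_primesIoc hp]
        rw [mem_primesIoc] at hp
        have h2 : Real.log y ≤ Real.log p :=
          Real.log_le_log (by linarith) (by exact_mod_cast hp.1.1.le)
        have h3 := mul_le_mul_of_nonneg_left h2
          (by positivity : (0 : ℝ) ≤ (m.totient : ℝ) * ((N : ℝ) / p) ^ (1 - δ))
        linarith
    _ ≤ _ := by
        refine sum_le_sum_of_subset_of_nonneg (fun p hp => ?_) fun d _ _ =>
          mul_nonneg (cycloLambdaReal_nonneg m d) (by positivity)
        rw [mem_primesIoc] at hp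
        exact mem_Ioc.2 ⟨by omega, hp.1.2⟩

end mertens

section primeSums

open Finset ArithmeticFunction

theorem half_le_floor {x : ℝ} (hx : 1 ≤ x) : x / 2 ≤ (⌊x⌋₊ : ℝ) := by
  have h1 := Nat.lt_floor_add_one x
  have h2 : (1 : ℝ) ≤ (⌊x⌋₊ : ℝ) := by exact_mod_cast Nat.le_floor (by simpa using hx)
  linarith

theorem exists_sum_primes_inv_piece_le (m : ℕ) [NeZero m] : ∃ C : ℝ, 0 ≤ C ∧
    ∀ x w μ : ℝ, 1 < x → 1 ≤ w → 1 ≤ μ →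
      ∑ p ∈ primesIoc m ⌊x ^ w⌋₊ ⌊x ^ (w * μ)⌋₊, (m.totient : ℝ) / p ≤
        μ - 1 + C / Real.log x := by
  obtain ⟨C, hC, h⟩ := exists_sum_primes_log_div_le m
  have hlog2 : 0 ≤ Real.log 2 := Real.log_nonneg one_le_two
  refine ⟨Real.log 2 + C, by positivity, fun x w μ hx hw hμ => ?_⟩
  have hx0 : 0 < x := by linarith
  have hl : 0 < Real.log x := Real.log_pos hx
  have hwl : 0 < w * Real.log x := by positivity
  have ha1 : 1 ≤ x ^ w := Real.one_le_rpow hx.le (by linarith)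
  have hab : x ^ w ≤ x ^ (w * μ) := Real.rpow_le_rpow_of_exponent_le hx.le (by nlinarith)
  have ha0 : 0 < ⌊x ^ w⌋₊ := Nat.floor_pos.2 ha1
  have hb0 : 0 < ⌊x ^ (w * μ)⌋₊ := Nat.floor_pos.2 (ha1.trans hab)
  have h1 := h _ _ ha0 (Nat.floor_le_floor hab)
  have h2 : Real.log ⌊x ^ (w * μ)⌋₊ ≤ w * μ * Real.log x := by
    rw [← Real.log_rpow hx0]
    exact Real.log_le_log (by exact_mod_cast hb0) (Nat.floor_le (by positivity))
  have h3 : w * Real.log x - Real.log 2 ≤ Real.log ⌊x ^ w⌋₊ := by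
    rw [← Real.log_rpow hx0, ← Real.log_div (by positivity) two_ne_zero]
    exact Real.log_le_log (by positivity) (half_le_floor ha1)
  have h4 : (w * Real.log x) * ∑ p ∈ primesIoc m ⌊x ^ w⌋₊ ⌊x ^ (w * μ)⌋₊, (m.totient : ℝ) / p ≤
      (w * Real.log x) * (μ - 1) + (Real.log 2 + C) := by
    calc _ ≤ ∑ p ∈ primesIoc m ⌊x ^ w⌋₊ ⌊x ^ (w * μ)⌋₊, (m.totient : ℝ) * Real.log p / p := by
          rw [mul_sum]
          refine sum_le_sum fun p hp => ?_
          rw [mem_primesIoc] at hp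
          have h5 : w * Real.log x ≤ Real.log p := by
            rw [← Real.log_rpow hx0]
            exact Real.log_le_log (by positivity) (Nat.lt_of_floor_lt hp.1.1).le
          rw [mul_div_assoc', mul_comm]
          gcongr
      _ ≤ _ := by linarith
  have h6 : ∑ p ∈ primesIoc m ⌊x ^ w⌋₊ ⌊x ^ (w * μ)⌋₊, (m.totient : ℝ) / p ≤
      μ - 1 + (Real.log 2 + C) / (w * Real.log x) := by
    rw [← mul_le_mul_iff_right₀ hwl]
    refine h4.trans_eq ?_
    field_simp
  refine h6.trans ?_
  gcongr
  nlinarith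

theorem exists_sum_primes_inv_le (m : ℕ) [NeZero m] (l : ℝ) (hl0 : 0 < l) (hl : l < 1 / 2) :
    ∃ (κ : ℝ) (y₀ : ℕ), 0 < κ ∧ ∀ y N : ℕ, y₀ ≤ y → (N : ℝ) ≤ (y : ℝ) ^ Real.exp l →
      ∑ p ∈ primesIoc m y N, (m.totient : ℝ) / p ≤ 1 / 2 - κ := by
  obtain ⟨C, hC, h⟩ := exists_sum_primes_inv_piece_le m
  obtain ⟨J, hJ⟩ := exists_nat_gt (1 / (1 / 2 - l))
  have hg : 0 < 1 / 2 - l := by linarith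
  have hJ0 : (0 : ℝ) < J := lt_trans (by positivity) hJ
  have hJ1 : (1 : ℝ) ≤ J := by
    have : 0 < J := by exact_mod_cast hJ0
    exact_mod_cast this
  obtain ⟨y₁, hy₁⟩ := exists_nat_gt (Real.exp (4 * J * C / (1 / 2 - l)))
  refine ⟨(1 / 2 - l) / 2, max 2 y₁, by positivity, fun y N hy hN => ?_⟩
  have hy2 : (2 : ℝ) ≤ y := by exact_mod_cast (le_max_left _ _).trans hy
  have hyy : (y₁ : ℝ) ≤ y := by exact_mod_cast (le_max_right _ _).trans hy
  have hy0 : (0 : ℝ) < y := by linarith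
  have hly : 0 < Real.log y := Real.log_pos (by linarith)
  have hy3 : 4 * J * C / (1 / 2 - l) ≤ Real.log y := by
    rw [Real.le_log_iff_exp_le hy0]
    linarith
  set μ := Real.exp (l / J) with hμ
  have hμ1 : 1 ≤ μ := Real.one_le_exp (by positivity)
  set z : ℕ → ℕ := fun i => ⌊(y : ℝ) ^ (μ ^ i)⌋₊ with hz
  have hz0 : z 0 = y := by simp [hz]
  have hzmono : Monotone z := monotone_nat_of_le_succ fun i => by
    refine Nat.floor_le_floor (Real.rpow_le_rpow_of_exponent_le (by linarith) ?_)
    exact pow_le_pow_right₀ hμ1 i.le_succ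
  have hstep : ∀ i : ℕ, ∑ p ∈ primesIoc m y (z i), (m.totient : ℝ) / p ≤
      i * (μ - 1 + C / Real.log y) := fun i => by
    induction i with
    | zero => simp [hz0, primesIoc]
    | succ i ih =>
      rw [← sum_primesIoc_consecutive _ (b := z i) (by rw [← hz0]; exact hzmono (Nat.zero_le i))
        (hzmono i.le_succ)]
      have h1 := h y (μ ^ i) μ (by linarith) (one_le_pow₀ hμ1) hμ1
      rw [← pow_succ] at h1
      push_cast
      linarith
  have hNz : N ≤ z J := by
    refine Nat.le_floor ?_
    rw [hμ, ← Real.exp_nat_mul, mul_div_cancel₀ _ hJ0.ne']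
    exact hN
  have h1 : ∑ p ∈ primesIoc m y N, (m.totient : ℝ) / p ≤
      ∑ p ∈ primesIoc m y (z J), (m.totient : ℝ) / p := by
    refine sum_le_sum_of_subset_of_nonneg (fun p hp => ?_) fun _ _ _ => by positivity
    rw [mem_primesIoc] at hp ⊢
    exact ⟨⟨hp.1.1, hp.1.2.trans hNz⟩, hp.2⟩
  have h2 := hstep J
  have hx1 : |l / J| ≤ 1 := by
    rw [abs_of_pos (by positivity), div_le_one hJ0]
    linarith
  have h3 := (abs_le.1 (Real.abs_exp_sub_one_sub_id_le hx1)).2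
  have h4 : J * (μ - 1) ≤ l + (1 / 2 - l) / 4 := by
    have h5 : J * (l / J) = l := mul_div_cancel₀ _ hJ0.ne'
    have h6 : J * (l / J) ^ 2 = l ^ 2 / J := by field_simp
    have h7 : l ^ 2 / J ≤ (1 / 2 - l) / 4 := by
      rw [div_lt_iff₀ hg] at hJ
      rw [div_le_iff₀ hJ0]
      nlinarith
    have h8 : J * (μ - 1) ≤ J * (l / J + (l / J) ^ 2) := by
      gcongr
      linarith
    linarith
  have h5 : J * (C / Real.log y) ≤ (1 / 2 - l) / 4 := by
    rw [div_le_iff₀ hg] at hy3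
    rw [mul_div_assoc', div_le_iff₀ hly]
    linarith
  rw [mul_add] at h2
  linarith

theorem eq_one_of_forall_prime (g : ℕ →* ℂ) {n : ℕ} (hn : n ≠ 0)
    (h : ∀ p, p.Prime → p ∣ n → g p = 1) : g n = 1 := by
  induction n using induction_on_primes with
  | zero => exact absurd rfl hn
  | one => exact map_one g
  | prime_mul p a hp ih =>
    rw [map_mul, h p hp (dvd_mul_right _ _), one_mul]
    exact ih (right_ne_zero_of_mul hn) fun q hq hqa => h q hq (hqa.mul_left _)

theorem sum_cycloReal_dvd_eq (m : ℕ) [NeZero m] {p N : ℕ} (hp : p.Prime) (hpm : (p : ZMod m) = 1)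
    (hN : N < p ^ 2) : ∑ n ∈ Ioc 0 N with p ∣ n, cycloReal m n =
      m.totient * ∑ n ∈ Ioc 0 (N / p), cycloReal m n := by
  rw [mul_sum]
  symm
  refine sum_nbij (fun n => p * n) (fun n hn => ?_) (fun a _ b _ h => ?_) (fun n hn => ?_)
    fun n hn => ?_
  · rw [mem_Ioc] at hn
    rw [mem_filter, mem_Ioc]
    have := (Nat.le_div_iff_mul_le hp.pos).1 hn.2
    exact ⟨⟨Nat.mul_pos hp.pos hn.1, by linarith⟩, dvd_mul_right _ _⟩
  · exact Nat.eq_of_mul_eq_mul_left hp.pos h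
  · rw [mem_coe, mem_filter, mem_Ioc] at hn
    obtain ⟨⟨h1, h2⟩, a, rfl⟩ := hn
    refine ⟨a, ?_, rfl⟩
    rw [mem_coe, mem_Ioc]
    exact ⟨Nat.pos_of_mul_pos_left h1, (Nat.le_div_iff_mul_le hp.pos).2 (by linarith)⟩
  · rw [mem_Ioc] at hn
    have h1 := (Nat.le_div_iff_mul_le hp.pos).1 hn.2
    have h2 : n < p := by nlinarith
    rw [cycloReal_mul m ((Nat.Prime.coprime_iff_not_dvd hp).2 (Nat.not_dvd_of_pos_of_lt hn.1 h2)),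
      cycloReal_prime m hp, if_pos hpm]

/-- If a completely multiplicative function is `1` at all primes up to `y` and at all primes
outside the class `1` mod `m`, then its twist of `cycloReal` has a large mean value up to
`y ^ λ`, for `λ < √e`. -/
theorem exists_le_norm_sum_cycloReal_mul (m : ℕ) [NeZero m] (l : ℝ) (hl0 : 0 < l)
    (hl : l < 1 / 2) : ∃ (κ : ℝ) (y₀ : ℕ), 0 < κ ∧ ∀ y N : ℕ, y₀ ≤ y → y ≤ N →
      (N : ℝ) ≤ (y : ℝ) ^ Real.exp l → ∀ g : ℕ →* ℂ, (∀ n, ‖g n‖ ≤ 1) →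
        (∀ p, p.Prime → (p ≤ y ∨ (p : ZMod m) ≠ 1) → g p = 1) →
          κ * N ≤ ‖∑ n ∈ Ioc 0 N, (cycloReal m n : ℂ) * g n‖ := by
  obtain ⟨κ, y₀, hκ, hsum⟩ := exists_sum_primes_inv_le m l hl0 hl
  obtain ⟨c, K, δ, hc, hK, hδ, hδ1, hT⟩ := exists_cycloReal_mean m
  obtain ⟨C, hC, hpow⟩ := exists_sum_primes_rpow_le m δ hδ (by linarith)
  obtain ⟨y₁, hy₁⟩ := exists_nat_gt (Real.exp (4 * (K * C) / (c * κ)))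
  obtain ⟨y₂, hy₂⟩ := exists_nat_gt ((2 * K / (c * κ)) ^ (1 / δ))
  refine ⟨c * κ, max 2 (max y₀ (max y₁ y₂)), by positivity,
    fun y N hy hyN hN g hg1 hg => ?_⟩
  have hy2 : 2 ≤ y := (le_max_left _ _).trans hy
  have hyy₀ : y₀ ≤ y := ((le_max_left _ _).trans (le_max_right _ _)).trans hy
  have hyy₁ : (y₁ : ℝ) ≤ y := by
    exact_mod_cast (((le_max_left _ _).trans (le_max_right _ _)).trans (le_max_right _ _)).trans hy
  have hyy₂ : (y₂ : ℝ) ≤ y := by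
    exact_mod_cast (((le_max_right _ _).trans (le_max_right _ _)).trans (le_max_right _ _)).trans hy
  have hyR : (2 : ℝ) ≤ y := by exact_mod_cast hy2
  have hNy : (y : ℝ) ≤ N := by exact_mod_cast hyN
  have hN0 : (0 : ℝ) < N := by linarith
  have hly : 0 < Real.log y := Real.log_pos (by linarith)
  have hcκ : 0 < c * κ := by positivity
  have hNy2 : N < y ^ 2 := by
    have h1 : Real.exp l < 2 := by
      have h2 : Real.exp l ≤ 1 / (1 - l) := by
        have := Real.one_sub_le_exp_neg l
        rw [Real.exp_neg] at this
        rw [le_div_iff₀ (by linarith)]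
        calc Real.exp l * (1 - l) ≤ Real.exp l * (Real.exp l)⁻¹ := by gcongr
          _ = 1 := mul_inv_cancel₀ (Real.exp_ne_zero l)
      refine h2.trans_lt ?_
      rw [div_lt_iff₀ (by linarith)]
      linarith
    have h2 : (N : ℝ) < (y : ℝ) ^ (2 : ℝ) :=
      hN.trans_lt (Real.rpow_lt_rpow_of_exponent_lt (by linarith) h1)
    rw [Real.rpow_two] at h2
    exact_mod_cast h2
  set T := ∑ n ∈ Ioc 0 N, cycloReal m n with hTdef
  have hTN := (abs_le.1 (hT N (by omega))).1
  have herr1 : K * (N : ℝ) ^ (1 - δ) ≤ c * κ / 2 * N := by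
    have h1 : 2 * K / (c * κ) ≤ (N : ℝ) ^ δ := by
      have h2 : 0 ≤ 2 * K / (c * κ) := by positivity
      calc 2 * K / (c * κ) = ((2 * K / (c * κ)) ^ (1 / δ)) ^ δ := by
            rw [← Real.rpow_mul h2, one_div_mul_cancel hδ.ne', Real.rpow_one]
        _ ≤ (N : ℝ) ^ δ := by
            gcongr
            linarith
    rw [div_le_iff₀ hcκ] at h1
    calc K * (N : ℝ) ^ (1 - δ) = 2 * K * (N : ℝ) ^ (1 - δ) / 2 := by ring
      _ ≤ (N : ℝ) ^ δ * (c * κ) * (N : ℝ) ^ (1 - δ) / 2 := by gcongr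
      _ = c * κ / 2 * ((N : ℝ) ^ δ * (N : ℝ) ^ (1 - δ)) := by ring
      _ = _ := by
          rw [← Real.rpow_add hN0, add_sub_cancel, Real.rpow_one]
  have herr2 : 2 * (K * (C * N / Real.log y)) ≤ c * κ / 2 * N := by
    have h1 : 4 * (K * C) / (c * κ) ≤ Real.log y := by
      rw [Real.le_log_iff_exp_le (by linarith)]
      linarith
    rw [div_le_iff₀ hcκ] at h1
    rw [mul_div_assoc', mul_div_assoc', div_le_iff₀ hly]
    nlinarith
  have hdiff : ‖(T : ℂ) - ∑ n ∈ Ioc 0 N, (cycloReal m n : ℂ) * g n‖ ≤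
      2 * (c * N * (1 / 2 - κ) + K * (C * N / Real.log y)) := by
    calc ‖(T : ℂ) - ∑ n ∈ Ioc 0 N, (cycloReal m n : ℂ) * g n‖
        = ‖∑ n ∈ Ioc 0 N, (cycloReal m n : ℂ) * (1 - g n)‖ := by
          rw [hTdef, Complex.ofReal_sum, ← sum_sub_distrib]
          congr 1
          exact sum_congr rfl fun n _ => by ring
      _ ≤ ∑ n ∈ Ioc 0 N, ∑ p ∈ primesIoc m y N with p ∣ n, 2 * cycloReal m n := by
          refine norm_sum_le_of_le _ fun n hn => ?_
          rw [mem_Ioc] at hn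
          have hr := cycloReal_nonneg m n
          rw [norm_mul, Complex.norm_real, Real.norm_of_nonneg hr]
          by_cases hgn : g n = 1
          · rw [hgn, sub_self, norm_zero, mul_zero]
            positivity
          · have : ∃ p, p.Prime ∧ p ∣ n ∧ g p ≠ 1 := by
              by_contra! h
              exact hgn (eq_one_of_forall_prime g hn.1.ne' h)
            obtain ⟨p, hp, hpn, hgp⟩ := this
            have hp' : ¬(p ≤ y ∨ (p : ZMod m) ≠ 1) := fun h => hgp (hg p hp h)
            push Not at hp'
            have hmem : p ∈ {p ∈ primesIoc m y N | p ∣ n} := by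
              rw [mem_filter, mem_primesIoc]
              exact ⟨⟨⟨hp'.1, (Nat.le_of_dvd hn.1 hpn).trans hn.2⟩, hp, hp'.2⟩, hpn⟩
            refine le_trans ?_ (single_le_sum (f := fun _ => 2 * cycloReal m n)
              (fun _ _ => by positivity) hmem)
            have h1 : ‖1 - g n‖ ≤ 2 := by
              have := norm_sub_le 1 (g n)
              rw [norm_one] at this
              linarith [hg1 n]
            nlinarith
      _ = ∑ p ∈ primesIoc m y N, 2 * ∑ n ∈ Ioc 0 N with p ∣ n, cycloReal m n := by
          simp only [sum_filter, mul_sum]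
          rw [sum_comm]
          refine sum_congr rfl fun p _ => sum_congr rfl fun n _ => ?_
          split_ifs <;> simp
      _ ≤ ∑ p ∈ primesIoc m y N, 2 * (c * N * (m.totient / p) +
            K * (m.totient * ((N : ℝ) / p) ^ (1 - δ))) := by
          refine sum_le_sum fun p hp => ?_
          rw [mem_primesIoc] at hp
          rw [sum_cycloReal_dvd_eq m hp.2.1 hp.2.2 (by nlinarith [hp.1.1])]
          have h1 := (abs_le.1 (hT (N / p) (Nat.div_pos hp.1.2 hp.2.1.pos))).2
          have h2 := natCast_div_le N p
          have h3 : K * ((N / p : ℕ) : ℝ) ^ (1 - δ) ≤ K * ((N : ℝ) / p) ^ (1 - δ) := by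
            gcongr
            linarith
          have h4 : c * ((N / p : ℕ) : ℝ) ≤ c * ((N : ℝ) / p) := by gcongr
          calc 2 * ((m.totient : ℝ) * ∑ n ∈ Ioc 0 (N / p), cycloReal m n)
              ≤ 2 * ((m.totient : ℝ) * (c * ((N : ℝ) / p) + K * ((N : ℝ) / p) ^ (1 - δ))) := by
                gcongr
                linarith
            _ = _ := by ring
      _ ≤ _ := by
          rw [← mul_sum, sum_add_distrib, ← mul_sum, ← mul_sum]
          gcongr
          · exact hsum y N hyy₀ hN
          · exact hpow y N (by omega)
  have h1 := norm_sub_norm_le (T : ℂ) (∑ n ∈ Ioc 0 N, (cycloReal m n : ℂ) * g n)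
  rw [Complex.norm_real, Real.norm_of_nonneg (sum_nonneg fun n _ => cycloReal_nonneg m n)] at h1
  nlinarith

end primeSums

section primeValues

open Finset ArithmeticFunction ArithmeticFunction.zeta

/-- The completely multiplicative function with prescribed values at primes. -/
noncomputable def ofPrimes (h : ℕ → ℂ) : ℕ →* ℂ where
  toFun n := if n = 0 then 0 else n.factorization.prod fun p k => h p ^ k
  map_one' := by simp
  map_mul' a b := by
    rcases eq_or_ne a 0 with rfl | ha
    · simp
    rcases eq_or_ne b 0 with rfl | hb
    · simp
    simp only [mul_eq_zero, ha, hb, or_self, if_false]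
    rw [Nat.factorization_mul ha hb, Finsupp.prod_add_index' (fun _ => pow_zero _)
      fun _ _ _ => pow_add _ _ _]

theorem ofPrimes_apply_prime (h : ℕ → ℂ) {p : ℕ} (hp : p.Prime) : ofPrimes h p = h p := by
  change (if p = 0 then 0 else p.factorization.prod fun p k => h p ^ k) = h p
  rw [if_neg hp.ne_zero, hp.factorization, Finsupp.prod_single_index (h := fun p k => h p ^ k) (pow_zero _),
    pow_one]

theorem norm_ofPrimes_le {h : ℕ → ℂ} (hh : ∀ p, ‖h p‖ ≤ 1) (n : ℕ) : ‖ofPrimes h n‖ ≤ 1 := by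
  change ‖if n = 0 then 0 else n.factorization.prod fun p k => h p ^ k‖ ≤ 1
  split_ifs
  · simp
  · rw [Finsupp.prod, norm_prod]
    refine prod_le_one (fun _ _ => norm_nonneg _) fun p _ => ?_
    rw [norm_pow]
    exact pow_le_one₀ (norm_nonneg _) (hh p)

end primeValues

section twistComparison

open Finset ArithmeticFunction ArithmeticFunction.zeta

/-- The Dirichlet quotient of `twist g (cycloCoeff m)` by `twist φ (cycloCoeff m)`. -/
noncomputable def twistQuotient (m : ℕ) (g φ : ℕ →* ℂ) : ArithmeticFunction ℂ :=
  twist g (cycloCoeff m) *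
    ∏ χ : DirichletCharacter ℂ m, twist φ (twist (charHom χ) (moebius : ArithmeticFunction ℂ))

theorem twist_cycloCoeff (m : ℕ) (φ : ℕ →* ℂ) : twist φ (cycloCoeff m) =
    ∏ χ : DirichletCharacter ℂ m, twist φ (twist (charHom χ) (ζ : ArithmeticFunction ℂ)) := by
  rw [cycloCoeff, map_prod]

theorem twist_mul_twistQuotient (m : ℕ) (g φ : ℕ →* ℂ) :
    twistQuotient m g φ * twist φ (cycloCoeff m) = twist g (cycloCoeff m) := by
  rw [twistQuotient, mul_assoc, twist_cycloCoeff m φ, ← prod_mul_distrib]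
  simp only [← map_mul, coe_moebius_mul_coe_zeta, map_one, prod_const_one, mul_one]

theorem isMultiplicative_twistQuotient (m : ℕ) (g φ : ℕ →* ℂ) :
    (twistQuotient m g φ).IsMultiplicative :=
  (isMultiplicative_twist (isMultiplicative_cycloCoeff m)).mul
    (isMultiplicative_finset_prod fun _ _ => isMultiplicative_twist
      (isMultiplicative_twist isMultiplicative_moebius.intCast))

theorem twistQuotient_apply_prime (m : ℕ) [NeZero m] (g φ : ℕ →* ℂ) {p : ℕ} (hp : p.Prime)
    (h : (p : ZMod m) = 1 → g p = φ p) : twistQuotient m g φ p = 0 := by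
  have h2 : ∀ χ : DirichletCharacter ℂ m,
      twist φ (twist (charHom χ) (moebius : ArithmeticFunction ℂ)) p = -(φ p * χ p) := fun χ => by
    simp [moebius_apply_prime hp]
  rw [twistQuotient, mul_apply_prime _ _ hp, prod_apply_one, prod_apply_prime _ _ (by simp) hp,
    sum_congr rfl fun χ _ => h2 χ, sum_neg_distrib, ← mul_sum,
    DirichletCharacter.sum_characters_eq, twist_apply, twist_apply, cycloCoeff_one,
    cycloCoeff_apply_prime m hp]
  split_ifs with h1
  · simp [h h1]
  · simp

theorem exists_norm_twistQuotient_le (m : ℕ) (η : ℝ) (hη : 0 < η) : ∃ K : ℝ, 1 ≤ K ∧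
    ∀ g φ : ℕ →* ℂ, (∀ n, ‖g n‖ ≤ 1) → (∀ n, ‖φ n‖ ≤ 1) → ∀ n : ℕ, n ≠ 0 →
      ‖twistQuotient m g φ n‖ ≤ K * (n : ℝ) ^ η := by
  obtain ⟨K, hK, h⟩ := norm_prod_apply_le
    #(univ : Finset (DirichletCharacter ℂ m ⊕ DirichletCharacter ℂ m)) η hη
  refine ⟨K, hK, fun g φ hg hφ n hn => ?_⟩
  have := h _ univ (Sum.elim
    (fun χ : DirichletCharacter ℂ m => twist g (twist (charHom χ) (ζ : ArithmeticFunction ℂ)))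
    fun χ : DirichletCharacter ℂ m =>
      twist φ (twist (charHom χ) (moebius : ArithmeticFunction ℂ))) rfl ?_ n hn
  · rw [Fintype.prod_sum_type] at this
    simp only [Sum.elim_inl, Sum.elim_inr] at this
    rwa [← twist_cycloCoeff] at this
  · rintro (χ | χ) n
    · simp only [Sum.elim_inl]
      rw [twist_apply, norm_mul]
      exact mul_le_one₀ (hg n) (norm_nonneg _) (norm_twist_zeta_le (norm_charHom_le χ) n)
    · simp only [Sum.elim_inr]
      rw [twist_apply, norm_mul, twist_apply, norm_mul, intCoe_apply]
      refine mul_le_one₀ (hφ n) (by positivity) (mul_le_one₀ (norm_charHom_le χ n)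
        (by positivity) ?_)
      rw [Complex.norm_intCast]
      exact_mod_cast abs_moebius_le_one

theorem exists_sq_mul_of_isMultiplicative {v : ArithmeticFunction ℂ} (hv : v.IsMultiplicative)
    {B : ℕ} (hB : B ≠ 0) (h : ∀ p, p.Prime → ¬p ∣ B → v p = 0) {d : ℕ} (hd : d ≠ 0)
    (hvd : v d ≠ 0) : ∃ a b : ℕ, a ≠ 0 ∧ b ∣ a * B ∧ a ^ 2 * b = d := by
  obtain ⟨b, a, hba, hb⟩ := Nat.sq_mul_squarefree d
  rw [mul_comm] at hba
  have ha : a ≠ 0 := by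
    rintro rfl
    simp at hba
    omega
  refine ⟨a, b, ha, ?_, by rw [← hba, mul_comm]⟩
  rw [← Nat.prod_primeFactors_of_squarefree hb]
  refine dvd_trans (prod_dvd_prod_of_subset _ _ _ fun p hpm => ?_)
    (Nat.prod_primeFactors_dvd (a * B))
  obtain ⟨hp, hpb⟩ := (Nat.mem_primeFactors.1 hpm).imp_right And.left
  refine Nat.mem_primeFactors.2 ⟨hp, hp.dvd_mul.2 ?_, mul_ne_zero ha hB⟩
  by_contra! hpab
  obtain ⟨c, rfl⟩ := hpb
  have hpc : p.Coprime (a ^ 2 * c) := by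
    refine Nat.Coprime.mul_right ((hp.coprime_iff_not_dvd.2 hpab.1).pow_right 2) ?_
    exact (Nat.squarefree_mul_iff.1 hb).1
  apply hvd
  rw [← hba, show p * c * a ^ 2 = p * (a ^ 2 * c) by ring, hv.2 hpc, h p hp hpab.2, zero_mul]

theorem sum_le_of_eq_zero {v : ArithmeticFunction ℂ} (hv : v.IsMultiplicative)
    {B : ℕ} (hB : B ≠ 0) (h : ∀ p, p.Prime → ¬p ∣ B → v p = 0) {K η : ℝ} (hK : 0 ≤ K)
    {K₁ : ℝ} (hK₁ : ∀ n : ℕ, n ≠ 0 → (#n.divisors : ℝ) ≤ K₁ * (n : ℝ) ^ η)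
    (hη : 0 < η) (hη1 : η ≤ 1 / 12) (hv' : ∀ n : ℕ, n ≠ 0 → ‖v n‖ ≤ K * (n : ℝ) ^ η)
    {σ : ℝ} (hσ : 3 / 4 ≤ σ) (N : ℕ) :
    ∑ d ∈ Ioc 0 N, ‖v d‖ * (d : ℝ) ^ (-σ) ≤
      K * K₁ * (B : ℝ) ^ η * ∑' a : ℕ, (a : ℝ) ^ (-(5 / 4) : ℝ) := by
  have h1 : ∀ d ∈ Ioc 0 N, ‖v d‖ * (d : ℝ) ^ (-σ) ≤ ∑ a ∈ Ioc 0 N, ∑ b ∈ (a * B).divisors,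
      if a ^ 2 * b = d then K * (a : ℝ) ^ (-(4 / 3) : ℝ) else 0 := by
    intro d hd
    rw [mem_Ioc] at hd
    by_cases hvd : v d = 0
    · rw [hvd, norm_zero, zero_mul]
      exact sum_nonneg fun a _ => sum_nonneg fun b _ => by split_ifs <;> positivity
    obtain ⟨a, b, ha, hb, hab⟩ := exists_sq_mul_of_isMultiplicative hv hB h hd.1.ne' hvd
    have hb0 : 0 < b := Nat.pos_of_ne_zero (by rintro rfl; simp at hab; omega)
    have haN : a ∈ Ioc 0 N := by
      rw [mem_Ioc]
      refine ⟨Nat.pos_of_ne_zero ha, le_trans ?_ hd.2⟩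
      rw [← hab]
      nlinarith [Nat.pos_of_ne_zero ha, Nat.mul_pos (Nat.pos_of_ne_zero ha) hb0]
    refine le_trans ?_ (single_le_sum (f := fun a => ∑ b ∈ (a * B).divisors,
      if a ^ 2 * b = d then K * (a : ℝ) ^ (-(4 / 3) : ℝ) else 0)
      (fun a _ => sum_nonneg fun b _ => by split_ifs <;> positivity) haN)
    refine le_trans ?_ (single_le_sum (f := fun b =>
      if a ^ 2 * b = d then K * (a : ℝ) ^ (-(4 / 3) : ℝ) else 0)
      (fun b _ => by split_ifs <;> positivity)
      (Nat.mem_divisors.2 ⟨hb, mul_ne_zero ha hB⟩))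
    rw [if_pos hab]
    have hd1 : (1 : ℝ) ≤ d := by exact_mod_cast hd.1
    have had : (a : ℝ) ^ (2 : ℝ) ≤ d := by
      rw [← hab]
      push_cast
      rw [Real.rpow_two]
      exact le_mul_of_one_le_right (by positivity) (by exact_mod_cast hb0)
    calc ‖v d‖ * (d : ℝ) ^ (-σ) ≤ K * (d : ℝ) ^ η * (d : ℝ) ^ (-σ) := by
          gcongr
          exact hv' d (by omega)
      _ = K * (d : ℝ) ^ (η - σ) := by
          rw [mul_assoc, ← Real.rpow_add (by linarith), sub_eq_add_neg]
      _ ≤ K * (d : ℝ) ^ (-(2 / 3) : ℝ) := by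
          gcongr
          linarith
      _ ≤ K * ((a : ℝ) ^ (2 : ℝ)) ^ (-(2 / 3) : ℝ) := by
          refine mul_le_mul_of_nonneg_left ?_ hK
          exact Real.rpow_le_rpow_of_nonpos (by positivity) had (by norm_num)
      _ = _ := by
          rw [← Real.rpow_mul (by positivity)]
          norm_num
  have hsum : Summable fun a : ℕ => (a : ℝ) ^ (-(5 / 4) : ℝ) :=
    Real.summable_nat_rpow.2 (by norm_num)
  calc ∑ d ∈ Ioc 0 N, ‖v d‖ * (d : ℝ) ^ (-σ)
      ≤ ∑ d ∈ Ioc 0 N, ∑ a ∈ Ioc 0 N, ∑ b ∈ (a * B).divisors,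
        if a ^ 2 * b = d then K * (a : ℝ) ^ (-(4 / 3) : ℝ) else 0 := sum_le_sum h1
    _ = ∑ a ∈ Ioc 0 N, ∑ b ∈ (a * B).divisors, ∑ d ∈ Ioc 0 N,
        if a ^ 2 * b = d then K * (a : ℝ) ^ (-(4 / 3) : ℝ) else 0 := by
        rw [sum_comm]
        exact sum_congr rfl fun a _ => sum_comm
    _ ≤ ∑ a ∈ Ioc 0 N, ∑ b ∈ (a * B).divisors, K * (a : ℝ) ^ (-(4 / 3) : ℝ) := by
        refine sum_le_sum fun a _ => sum_le_sum fun b _ => ?_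
        rw [sum_ite_eq]
        split_ifs
        · rfl
        · positivity
    _ ≤ ∑ a ∈ Ioc 0 N, K * K₁ * (B : ℝ) ^ η * (a : ℝ) ^ (-(5 / 4) : ℝ) := by
        refine sum_le_sum fun a ha => ?_
        rw [mem_Ioc] at ha
        have ha1 : (1 : ℝ) ≤ a := by exact_mod_cast ha.1
        have h2 := hK₁ (a * B) (mul_ne_zero ha.1.ne' hB)
        have hK₁0 : 0 ≤ K₁ := by
          have := hK₁ 1 one_ne_zero
          simp at this
          linarith
        rw [sum_const, nsmul_eq_mul]
        push_cast at h2
        rw [Real.mul_rpow (by positivity) (by positivity)] at h2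
        have h3 : (a : ℝ) ^ η * (a : ℝ) ^ (-(4 / 3) : ℝ) ≤ (a : ℝ) ^ (-(5 / 4) : ℝ) := by
          rw [← Real.rpow_add (by linarith)]
          exact Real.rpow_le_rpow_of_exponent_le ha1 (by linarith)
        calc (#(a * B).divisors : ℝ) * (K * (a : ℝ) ^ (-(4 / 3) : ℝ))
            ≤ K₁ * ((a : ℝ) ^ η * (B : ℝ) ^ η) * (K * (a : ℝ) ^ (-(4 / 3) : ℝ)) := by gcongr
          _ = K * K₁ * (B : ℝ) ^ η * ((a : ℝ) ^ η * (a : ℝ) ^ (-(4 / 3) : ℝ)) := by ring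
          _ ≤ _ := by gcongr
    _ ≤ _ := by
        have hK₁0 : 0 ≤ K₁ := by
          have := hK₁ 1 one_ne_zero
          simp at this
          linarith
        rw [← mul_sum]
        gcongr
        exact hsum.sum_le_tsum _ fun _ _ => by positivity

end twistComparison

section transfer

open Finset ArithmeticFunction ArithmeticFunction.zeta

theorem exists_norm_sum_twist_cycloCoeff_le (m : ℕ) [NeZero m] (δ K η : ℝ) (hδ : 0 < δ)
    (hδ1 : δ ≤ 1) (hK : 1 ≤ K) (hη : 0 < η) : ∃ K' : ℝ, 1 ≤ K' ∧ ∀ φ : ℕ →* ℂ,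
      (∀ n, ‖φ n‖ ≤ 1) → ∀ Y : ℝ, 1 ≤ Y → (∀ (χ : DirichletCharacter ℂ m) (N : ℕ),
        ‖∑ n ∈ Ioc 0 N, φ n * χ n‖ ≤ K * ((N : ℝ) ^ (1 - δ) * Y ^ δ)) →
      ∀ N : ℕ, 0 < N → ‖∑ n ∈ Ioc 0 N, twist φ (cycloCoeff m) n‖ ≤
        K' * ((N : ℝ) ^ (1 - δ / m.totient + η) * Y ^ δ) := by
  have hcard : #(univ : Finset (DirichletCharacter ℂ m)) = m.totient - 1 + 1 := by
    rw [card_univ, ← Nat.card_eq_fintype_card,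
      DirichletCharacter.card_eq_totient_of_hasEnoughRootsOfUnity]
    have := Nat.totient_pos.2 (Nat.pos_of_ne_zero (NeZero.ne m))
    omega
  have hcast : ((m.totient - 1 : ℕ) : ℝ) + 1 = m.totient := by
    rw [← Nat.cast_succ]
    congr 1
    have := Nat.totient_pos.2 (Nat.pos_of_ne_zero (NeZero.ne m))
    omega
  obtain ⟨K₁, hK₁, h₁⟩ := exists_prod_sum_le (m.totient - 1) δ K hδ hδ1 hK
  obtain ⟨K₂, hK₂, h₂⟩ := exists_log_pow_le (m.totient - 1 + 1) η hη
  refine ⟨K₁ * K₂, by nlinarith, fun φ hφ Y hY hsum N hN => ?_⟩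
  have h := h₁ _ univ (fun χ : DirichletCharacter ℂ m =>
    twist φ (twist (charHom χ) (ζ : ArithmeticFunction ℂ))) hcard (fun χ n => ?_) Y hY
    (fun χ _ N => ?_) N hN
  · rw [← twist_cycloCoeff, hcast] at h
    refine h.trans ?_
    have hN0 : (0 : ℝ) < N := by exact_mod_cast hN
    calc K₁ * (1 + Real.log N) ^ (m.totient - 1 + 1) *
          ((N : ℝ) ^ (1 - δ / m.totient) * Y ^ δ)
        ≤ K₁ * (K₂ * (N : ℝ) ^ η) * ((N : ℝ) ^ (1 - δ / m.totient) * Y ^ δ) := by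
          gcongr
          exact h₂ N hN
      _ = _ := by
          rw [Real.rpow_add hN0]
          ring
  · rw [twist_apply, norm_mul]
    exact mul_le_one₀ (hφ n) (norm_nonneg _) (norm_twist_zeta_le (norm_charHom_le χ) n)
  · simp only [twist_twist]
    rw [sum_Ioc_twist_zeta]
    exact hsum χ N

theorem exists_norm_sum_cycloReal_mul_le (m : ℕ) [NeZero m] (δ K η : ℝ) (hδ : 0 < δ)
    (hδ1 : δ ≤ 1 / 4) (hK : 1 ≤ K) (hη : 0 < η) (hη1 : η ≤ 1 / 12) : ∃ K' : ℝ, 0 < K' ∧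
      ∀ g φ : ℕ →* ℂ, (∀ n, ‖g n‖ ≤ 1) → (∀ n, ‖φ n‖ ≤ 1) → ∀ B : ℕ, B ≠ 0 →
      (∀ p : ℕ, p.Prime → ¬p ∣ B → (p : ZMod m) = 1 → g p = φ p) → ∀ Y : ℝ, 1 ≤ Y →
      (∀ (χ : DirichletCharacter ℂ m) (N : ℕ),
        ‖∑ n ∈ Ioc 0 N, φ n * χ n‖ ≤ K * ((N : ℝ) ^ (1 - δ) * Y ^ δ)) →
      ∀ N : ℕ, 0 < N → ‖∑ n ∈ Ioc 0 N, (cycloReal m n : ℂ) * g n‖ ≤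
        K' * ((B : ℝ) ^ η * ((N : ℝ) ^ (1 - δ / m.totient + η) * Y ^ δ)) := by
  obtain ⟨K₁, hK₁, h₁⟩ := exists_norm_sum_twist_cycloCoeff_le m δ K η hδ (by linarith) hK hη
  obtain ⟨K₂, hK₂, h₂⟩ := exists_norm_twistQuotient_le m η hη
  obtain ⟨K₃, hK₃, h₃⟩ := exists_card_divisors_le η hη
  have hsum : Summable fun a : ℕ => (a : ℝ) ^ (-(5 / 4) : ℝ) :=
    Real.summable_nat_rpow.2 (by norm_num)
  set Z := ∑' a : ℕ, (a : ℝ) ^ (-(5 / 4) : ℝ) with hZ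
  have hZ0 : 0 < Z := by
    have := hsum.sum_le_tsum {1} fun _ _ => by positivity
    simp only [sum_singleton, Nat.cast_one, Real.one_rpow] at this
    linarith
  refine ⟨K₁ * (K₂ * K₃ * Z), by positivity,
    fun g φ hg hφ B hB hgφ Y hY hχ N hN => ?_⟩
  set σ := 1 - δ / m.totient + η with hσ
  have htot : (1 : ℝ) ≤ m.totient := by
    exact_mod_cast Nat.totient_pos.2 (Nat.pos_of_ne_zero (NeZero.ne m))
  have hσ1 : 3 / 4 ≤ σ := by
    have : δ / m.totient ≤ δ := div_le_self hδ.le htot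
    linarith
  have h₄ := sum_le_of_eq_zero (isMultiplicative_twistQuotient m g φ) hB
    (fun p hp hpB => twistQuotient_apply_prime m g φ hp (hgφ p hp hpB)) (by linarith : 0 ≤ K₂) h₃
    hη hη1 (h₂ g φ hg hφ) hσ1 N
  have hN0 : (0 : ℝ) < N := by exact_mod_cast hN
  have h₅ : ∑ n ∈ Ioc 0 N, (cycloReal m n : ℂ) * g n =
      ∑ d ∈ Ioc 0 N, twistQuotient m g φ d * ∑ n ∈ Ioc 0 (N / d), twist φ (cycloCoeff m) n := by
    rw [← sum_Ioc_mul_eq_sum_sum, twist_mul_twistQuotient]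
    refine sum_congr rfl fun n _ => ?_
    rw [twist_apply, cycloCoeff_eq_cycloReal, mul_comm]
  rw [h₅]
  calc ‖∑ d ∈ Ioc 0 N, twistQuotient m g φ d *
        ∑ n ∈ Ioc 0 (N / d), twist φ (cycloCoeff m) n‖
      ≤ ∑ d ∈ Ioc 0 N, K₁ * ((N : ℝ) ^ σ * Y ^ δ) *
          (‖twistQuotient m g φ d‖ * (d : ℝ) ^ (-σ)) := by
        refine norm_sum_le_of_le _ fun d hd => ?_
        rw [mem_Ioc] at hd
        rw [norm_mul]
        calc ‖twistQuotient m g φ d‖ * ‖∑ n ∈ Ioc 0 (N / d), twist φ (cycloCoeff m) n‖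
            ≤ ‖twistQuotient m g φ d‖ * (K₁ * (((N / d : ℕ) : ℝ) ^ σ * Y ^ δ)) := by
              gcongr
              exact h₁ φ hφ Y hY hχ _ (Nat.div_pos hd.2 hd.1)
          _ ≤ ‖twistQuotient m g φ d‖ * (K₁ * (((N : ℝ) / d) ^ σ * Y ^ δ)) := by
              gcongr
              exact natCast_div_le N d
          _ = _ := by
              rw [Real.div_rpow (by positivity) (by positivity), Real.rpow_neg (by positivity)]
              ring
    _ ≤ K₁ * ((N : ℝ) ^ σ * Y ^ δ) * (K₂ * K₃ * (B : ℝ) ^ η * Z) := by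
        rw [← mul_sum]
        gcongr
    _ = _ := by ring

end transfer

section primeNonvalue

open Finset ArithmeticFunction ArithmeticFunction.zeta

/-- The Jacobi symbol `n ↦ (n / D)` with complex values. -/
noncomputable def jacobiNatHom (D : ℕ) : ℕ →* ℂ where
  toFun n := (jacobiSym n D : ℂ)
  map_one' := by simp
  map_mul' a b := by
    rw [Nat.cast_mul, jacobiSym.mul_left, Int.cast_mul]

theorem jacobiNatHom_apply (D n : ℕ) : jacobiNatHom D n = (jacobiSym n D : ℂ) := rfl

theorem changeLevel_mul_natCast {m M : ℕ} (h : m ∣ M) (χ : DirichletCharacter ℂ m)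
    (ψ : DirichletCharacter ℂ M) (n : ℕ) :
    (DirichletCharacter.changeLevel h χ * ψ) n = χ n * ψ n := by
  rw [MulChar.mul_apply]
  by_cases hn : IsUnit (n : ZMod M)
  · obtain ⟨u, hu⟩ := hn
    rw [← hu, DirichletCharacter.changeLevel_eq_cast_of_dvd χ h, hu, ZMod.cast_natCast h]
  · rw [ψ.map_nonunit hn, mul_zero, mul_zero]

theorem exists_exponents (k ε : ℝ) (hk : 0 < k) (hε : 0 < ε) : ∃ l : ℝ, 0 < l ∧ l < 1 / 2 ∧
    k / 4 + ε / 2 ≤ (k / (4 * Real.sqrt (Real.exp 1)) + ε) * Real.exp l := by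
  set s := Real.sqrt (Real.exp 1) with hs
  have hs' : s = Real.exp (1 / 2) := (Real.exp_half 1).symm
  have hs1 : 1 < s := by rw [hs']; exact Real.one_lt_exp_iff.2 (by norm_num)
  have h1 : k / 4 + ε / 2 < (k / (4 * s) + ε) * Real.exp (1 / 2) := by
    rw [← hs', add_mul]
    have : k / (4 * s) * s = k / 4 := by field_simp
    nlinarith
  have h2 : ∀ᶠ l in nhdsWithin (1 / 2 : ℝ) (Set.Iio (1 / 2)),
      k / 4 + ε / 2 < (k / (4 * s) + ε) * Real.exp l := by
    refine Filter.Eventually.filter_mono nhdsWithin_le_nhds ?_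
    refine ContinuousAt.eventually_lt (by fun_prop) (by fun_prop) h1
  have h3 : ∀ᶠ l in nhdsWithin (1 / 2 : ℝ) (Set.Iio (1 / 2)), 0 < l :=
    Filter.Eventually.filter_mono nhdsWithin_le_nhds (lt_mem_nhds (by norm_num))
  obtain ⟨l, ⟨h4, h5⟩, h6⟩ := ((h2.and h3).and self_mem_nhdsWithin).exists
  exact ⟨l, h5, h6, h4.le⟩

set_option maxHeartbeats 1000000 in
/-- A bound for the least prime `p ≡ 1 (mod m)` at which a quadratic character is not `1`. -/
theorem exists_prime_jacobiSym_ne_one (m M : ℕ) [NeZero m] (hM : 0 < M) (hmM : m ∣ M) (ε : ℝ)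
    (hε : 0 < ε) : ∃ C : ℝ, 0 < C ∧ ∀ Q D : ℕ, 0 < Q → D ≤ Q → Squarefree D → Odd D →
      D.Coprime M → ∀ ψ : DirichletCharacter ℂ M,
      (D = 1 → ∀ χ : DirichletCharacter ℂ m, DirichletCharacter.changeLevel hmM χ * ψ ≠ 1) →
      ∃ p : ℕ, p.Prime ∧ (p : ZMod m) = 1 ∧ ¬p ∣ M * Q ∧
        (p : ℝ) ≤ C * (Q : ℝ) ^ ((m.totient : ℝ) / (4 * Real.sqrt (Real.exp 1)) + ε) ∧
        ψ p * (jacobiSym p D : ℂ) ≠ 1 := by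
  set k := (m.totient : ℝ) with hk
  have hk1 : 1 ≤ k := by
    rw [hk]
    exact_mod_cast Nat.totient_pos.2 (Nat.pos_of_ne_zero (NeZero.ne m))
  obtain ⟨l, hl0, hl1, hl⟩ := exists_exponents k ε (by linarith) hε
  set β := k / (4 * Real.sqrt (Real.exp 1)) + ε with hβ
  have hβ0 : 0 < β := by positivity
  set L := Real.exp l with hL
  have hL1 : 1 < L := Real.one_lt_exp_iff.2 hl0
  obtain ⟨ε₁, hε₁, hε₁8, hε₁k⟩ : ∃ ε₁ : ℝ, 0 < ε₁ ∧ ε₁ ≤ 1 / 8 ∧ ε₁ ≤ ε / (4 * k) :=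
    ⟨min (1 / 8) (ε / (4 * k)), by positivity, min_le_left _ _, min_le_right _ _⟩
  obtain ⟨δ, K, hδ, hδ1, hK, hburgess⟩ := exists_twisted_jacobi_sum_le M hM ε₁ hε₁ hε₁8
  obtain ⟨η, hη, hη1, hη2, hη3⟩ : ∃ η : ℝ, 0 < η ∧ η ≤ 1 / 12 ∧ η ≤ δ / (2 * k) ∧
      η ≤ δ * ε / (4 * k) / (1 + k / 4 + ε / 2) :=
    ⟨min (1 / 12) (min (δ / (2 * k)) (δ * ε / (4 * k) / (1 + k / 4 + ε / 2))),
      by positivity, min_le_left _ _, (min_le_right _ _).trans (min_le_left _ _),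
      (min_le_right _ _).trans (min_le_right _ _)⟩
  obtain ⟨K', hK', htransfer⟩ := exists_norm_sum_cycloReal_mul_le m δ K η hδ hδ1 hK hη hη1
  obtain ⟨κ, y₀, hκ, hlower⟩ := exists_le_norm_sum_cycloReal_mul m l hl0 hl1
  set θ := δ / k - η with hθ
  have hθ0 : 0 < θ := by
    have : δ / k = 2 * (δ / (2 * k)) := by field_simp
    have : 0 < δ / (2 * k) := by positivity
    linarith
  have hexp : η + (1 / 4 + ε₁) * δ ≤ β * L * θ := by
    have h1 : (k / 4 + ε / 2) * θ ≤ β * L * θ := by gcongr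
    have h2 : (k / 4 + ε / 2) * θ = δ / 4 + 2 * (δ * ε / (4 * k)) - η * (k / 4 + ε / 2) := by
      rw [hθ]
      field_simp
      ring
    have h3 : η * (1 + k / 4 + ε / 2) ≤ δ * ε / (4 * k) := by
      rwa [le_div_iff₀ (by positivity)] at hη3
    have h4 : ε₁ * δ ≤ δ * ε / (4 * k) := by
      calc ε₁ * δ ≤ ε / (4 * k) * δ := by gcongr
        _ = _ := by ring
    linarith
  obtain ⟨x, ⟨hx1, hx2⟩, hx3⟩ := (((tendsto_rpow_atTop hθ0).eventually_gt_atTop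
    (K' * (M : ℝ) ^ η / κ)).and (Filter.eventually_ge_atTop (1 : ℝ))).and
    (Filter.eventually_ge_atTop (y₀ : ℝ)) |>.exists
  refine ⟨4 * x, by positivity, fun Q D hQ hDQ hsq hodd hcop ψ hψ => ?_⟩
  by_contra! hno
  have hQ1 : (1 : ℝ) ≤ Q := by exact_mod_cast hQ
  have hQβ : 1 ≤ (Q : ℝ) ^ β := Real.one_le_rpow hQ1 hβ0.le
  set y := ⌊4 * x * (Q : ℝ) ^ β⌋₊ with hy
  have hyl : 2 * x * (Q : ℝ) ^ β ≤ y := by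
    have := half_le_floor (x := 4 * x * (Q : ℝ) ^ β) (by nlinarith)
    linarith
  have hy1 : (1 : ℝ) ≤ y := by nlinarith
  set N := ⌊(y : ℝ) ^ L⌋₊ with hN
  have hNl : x * (Q : ℝ) ^ (β * L) ≤ N := by
    have h1 := half_le_floor (x := (y : ℝ) ^ L) (Real.one_le_rpow hy1 (by linarith))
    have h2 : (2 : ℝ) ≤ 2 ^ L := by
      simpa using Real.rpow_le_rpow_of_exponent_le (x := 2) one_le_two hL1.le
    have h3 : x ≤ x ^ L := by
      simpa using Real.rpow_le_rpow_of_exponent_le hx2 hL1.le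
    have h4 : (2 * x * (Q : ℝ) ^ β) ^ L = 2 ^ L * x ^ L * (Q : ℝ) ^ (β * L) := by
      rw [Real.mul_rpow (by positivity) (by positivity), Real.mul_rpow (by norm_num)
        (by positivity), ← Real.rpow_mul (by positivity)]
    have h5 : (2 * x * (Q : ℝ) ^ β) ^ L ≤ (y : ℝ) ^ L := by gcongr
    have h6 : 2 * x * (Q : ℝ) ^ (β * L) ≤ 2 ^ L * x ^ L * (Q : ℝ) ^ (β * L) := by gcongr
    linarith
  have hyN : y ≤ N := by
    refine Nat.le_floor ?_
    simpa using Real.rpow_le_rpow_of_exponent_le hy1 hL1.le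
  have hNpos : 0 < N := by
    have : 0 < y := by exact_mod_cast hy1
    omega
  have hNR : (0 : ℝ) < N := by exact_mod_cast hNpos
  have hφ1 : ∀ n, ‖(charHom ψ * jacobiNatHom D) n‖ ≤ 1 := fun n => by
    rw [MonoidHom.mul_apply, norm_mul, jacobiNatHom_apply]
    exact mul_le_one₀ (norm_charHom_le ψ n) (norm_nonneg _) (norm_jacobiSym_le_one _ _)
  set φ := charHom ψ * jacobiNatHom D with hφ
  have hφapp : ∀ n, φ n = ψ n * (jacobiSym n D : ℂ) := fun n => rfl
  classical
  set h : ℕ → ℂ := fun p => if (p : ZMod m) = 1 ∧ ¬p ∣ M * Q then φ p else 1 with hh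
  have hh1 : ∀ p, ‖h p‖ ≤ 1 := fun p => by
    simp only [hh]
    split_ifs
    · exact hφ1 p
    · simp
  have hlow := hlower y N (by exact_mod_cast (by nlinarith : (y₀ : ℝ) ≤ y)) hyN
    (Nat.floor_le (by positivity)) (ofPrimes h) (norm_ofPrimes_le hh1) fun p hp hpy => by
      rw [ofPrimes_apply_prime h hp]
      simp only [hh]
      split_ifs with hc
      · have hpy' : p ≤ y := hpy.resolve_right (not_not.2 hc.1)
        refine hno p hp hc.1 hc.2 ?_
        exact (Nat.le_floor_iff (by positivity)).1 hpy'
      · rfl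
  have hup := htransfer (ofPrimes h) φ (norm_ofPrimes_le hh1) hφ1 (M * Q) (by positivity)
    (fun p hp hpB hpm => by rw [ofPrimes_apply_prime h hp]; simp [hh, hpB, hpm])
    ((Q : ℝ) ^ (1 / 4 + ε₁)) (Real.one_le_rpow hQ1 (by positivity))
    (fun χ N => by
      have h1 := hburgess D hsq hodd hcop (DirichletCharacter.changeLevel hmM χ * ψ)
        (fun hD => hψ hD χ) ((Q : ℝ) ^ (1 / 4 + ε₁)) (by gcongr) N
      refine le_of_eq_of_le ?_ h1
      congr 1
      refine sum_congr rfl fun n _ => ?_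
      rw [changeLevel_mul_natCast, hφapp]
      ring) N hNpos
  have hfin := hlow.trans hup
  rw [show 1 - δ / m.totient + η = 1 - θ by rw [hθ, hk]; ring, Real.rpow_sub hNR, Real.rpow_one,
    ← Real.rpow_mul (by positivity)] at hfin
  push_cast at hfin
  rw [Real.mul_rpow (by positivity) (by positivity)] at hfin
  have hNθ : 0 < (N : ℝ) ^ θ := by positivity
  have h1 : κ * (N : ℝ) ^ θ ≤
      K' * (M : ℝ) ^ η * ((Q : ℝ) ^ η * (Q : ℝ) ^ ((1 / 4 + ε₁) * δ)) := by
    have h2 : κ * N * ((N : ℝ) ^ θ / N) ≤ K' * ((M : ℝ) ^ η * (Q : ℝ) ^ η *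
        (N / (N : ℝ) ^ θ * (Q : ℝ) ^ ((1 / 4 + ε₁) * δ))) * ((N : ℝ) ^ θ / N) := by gcongr
    calc κ * (N : ℝ) ^ θ = κ * N * ((N : ℝ) ^ θ / N) := by field_simp
      _ ≤ _ := h2
      _ = _ := by field_simp
  rw [← Real.rpow_add (by linarith)] at h1
  have h2 : x ^ θ * (Q : ℝ) ^ (η + (1 / 4 + ε₁) * δ) ≤ (N : ℝ) ^ θ := by
    calc x ^ θ * (Q : ℝ) ^ (η + (1 / 4 + ε₁) * δ) ≤ x ^ θ * (Q : ℝ) ^ (β * L * θ) := by gcongr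
      _ = (x * (Q : ℝ) ^ (β * L)) ^ θ := by
        rw [Real.mul_rpow (by positivity) (by positivity), ← Real.rpow_mul (by positivity)]
      _ ≤ _ := by gcongr
  rw [div_lt_iff₀ hκ] at hx1
  have h3 : 0 < (Q : ℝ) ^ (η + (1 / 4 + ε₁) * δ) := by positivity
  have h4 : x ^ θ * κ * (Q : ℝ) ^ (η + (1 / 4 + ε₁) * δ) ≤
      K' * (M : ℝ) ^ η * (Q : ℝ) ^ (η + (1 / 4 + ε₁) * δ) := by
    refine le_trans (le_of_eq_of_le ?_ (mul_le_mul_of_nonneg_left h2 hκ.le)) h1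
    ring
  exact (le_of_mul_le_mul_right h4 h3).not_gt hx1

end primeNonvalue

section quadraticCharacters

open Finset DirichletCharacter

theorem changeLevel_natCast {d L : ℕ} (h : d ∣ L) (χ : DirichletCharacter ℂ d) {n : ℕ}
    (hn : n.Coprime L) : changeLevel h χ (n : ZMod L) = χ n := by
  have := changeLevel_eq_cast_of_dvd' χ h (a := n) (Nat.isCoprime_iff_coprime.2 hn)
  exact_mod_cast this

theorem sq_apply_of_sq_eq_one {L : ℕ} {χ : DirichletCharacter ℂ L} (hχ : χ ^ 2 = 1) {x : ZMod L}
    (hx : IsUnit x) : χ x ^ 2 = 1 := by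
  rw [← MulChar.pow_apply' χ two_ne_zero, hχ, MulChar.one_apply hx]

theorem eq_one_or_neg_one_of_sq_eq_one {L : ℕ} {χ : DirichletCharacter ℂ L} (hχ : χ ^ 2 = 1)
    {n : ℕ} (hn : n.Coprime L) : χ n = 1 ∨ χ n = -1 := by
  rw [← mul_self_eq_one_iff, ← sq]
  exact sq_apply_of_sq_eq_one hχ ((ZMod.isUnit_iff_coprime n L).2 hn)

theorem exists_changeLevel_eq {d L : ℕ} [NeZero L] (hd : d ∣ L) (χ : DirichletCharacter ℂ L)
    (h : ∀ n : ℕ, n.Coprime L → (n : ZMod d) = 1 → χ n = 1) :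
    ∃ χ₀ : DirichletCharacter ℂ d, χ = changeLevel hd χ₀ := by
  have : FactorsThrough χ d := by
    refine (factorsThrough_iff_ker_unitsMap hd).2 fun u hu => ?_
    rw [MonoidHom.mem_ker] at hu ⊢
    have hval : (((u : ZMod L).val : ℕ) : ZMod L) = u := ZMod.natCast_zmod_val _
    have h1 := h (u : ZMod L).val (ZMod.val_coe_unit_coprime u) (by
      have h2 := congrArg Units.val hu
      rw [ZMod.unitsMap_val, Units.val_one] at h2
      rw [← h2, ← ZMod.natCast_val]
      )
    rw [hval] at h1
    ext
    simpa using h1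
  exact ⟨this.χ₀, this.eq_changeLevel⟩

theorem exists_sq_eq_add (T n : ℤ) (hn : ∃ s, n = 1 + 4 * T * s) (j : ℕ) :
    ∃ x s : ℤ, x ^ 2 = n + 4 * T ^ 2 ^ j * s ∧ IsCoprime x T := by
  induction j with
  | zero =>
    obtain ⟨s, rfl⟩ := hn
    exact ⟨1, -s, by ring, isCoprime_one_left⟩
  | succ j ih =>
    obtain ⟨x, s, hx, hc⟩ := ih
    set W := T ^ 2 ^ j with hW
    obtain ⟨a, b, hab⟩ : IsCoprime x W := hc.pow_right
    refine ⟨x + 2 * W * (-s * a), s * b + (s * a) ^ 2, ?_, ?_⟩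
    · rw [pow_succ 2 j, pow_mul, ← hW]
      linear_combination hx + 4 * W * s * (-hab)
    · have : T ∣ W := dvd_pow_self T (by positivity)
      obtain ⟨c, hc'⟩ := this
      rw [hc', show x + 2 * (T * c) * (-s * a) = x + T * (2 * c * (-s * a)) by ring]
      exact IsCoprime.add_mul_left_left hc _

theorem dvd_pow_of_primeFactors_subset {Q T : ℕ} (hQ : Q ≠ 0) (hT : T ≠ 0)
    (h : ∀ p, p.Prime → p ∣ Q → p ∣ T) : Q ∣ T ^ 2 ^ Q := by
  rw [← Nat.factorization_le_iff_dvd hQ (pow_ne_zero _ hT)]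
  intro p
  rw [Nat.factorization_pow, Finsupp.smul_apply, smul_eq_mul]
  by_cases hp : p.Prime ∧ p ∣ Q
  · have h1 : 1 ≤ T.factorization p := hp.1.factorization_pos_of_dvd hT (h p hp.1 hp.2)
    have h2 : Q.factorization p < Q := Nat.factorization_lt p hQ
    have h3 : Q < 2 ^ Q := Nat.lt_two_pow_self
    nlinarith
  · have : Q.factorization p = 0 := by
      rw [Nat.factorization_eq_zero_iff]
      tauto
    omega

/-- A quadratic character is trivial on integers congruent to `1` modulo `4T` if every prime
dividing its modulus divides `T`. -/
theorem apply_eq_one_of_modEq {Q T : ℕ} {χ : DirichletCharacter ℂ Q} (hχ : χ ^ 2 = 1)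
    (hQ : Q ≠ 0) (hT : T ≠ 0) (h : ∀ p, p.Prime → p ∣ Q → p ∣ T) {n : ℕ}
    (hn : (n : ZMod (4 * T)) = 1) : χ n = 1 := by
  have h1 : ∃ s : ℤ, (n : ℤ) = 1 + 4 * T * s := by
    have h2 : ((n : ℤ) : ZMod (4 * T)) = ((1 : ℤ) : ZMod (4 * T)) := by push_cast; exact hn
    rw [ZMod.intCast_eq_intCast_iff_dvd_sub] at h2
    obtain ⟨s, hs⟩ := h2
    push_cast at hs
    exact ⟨-s, by linarith⟩
  obtain ⟨x, s, hx, hc⟩ := exists_sq_eq_add T n h1 Q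
  have hdvd : (Q : ℤ) ∣ (T : ℤ) ^ 2 ^ Q := by
    exact_mod_cast dvd_pow_of_primeFactors_subset hQ hT h
  have hu : IsUnit ((x : ℤ) : ZMod Q) := by
    rw [ZMod.coe_int_isUnit_iff_isCoprime]
    exact ((hc.pow_right (n := 2 ^ Q)).of_isCoprime_of_dvd_right hdvd).symm
  have h3 : ((n : ℕ) : ZMod Q) = (x : ZMod Q) ^ 2 := by
    have h4 : (n : ℤ) = x ^ 2 - 4 * (T : ℤ) ^ 2 ^ Q * s := by rw [hx]; ring
    have h5 : (((T : ℤ) ^ 2 ^ Q : ℤ) : ZMod Q) = 0 := (ZMod.intCast_zmod_eq_zero_iff_dvd _ _).2 hdvd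
    have h6 := congrArg (Int.cast : ℤ → ZMod Q) h4
    rw [Int.cast_sub, Int.cast_mul, Int.cast_mul, h5] at h6
    simpa using h6
  rw [h3, map_pow]
  exact sq_apply_of_sq_eq_one hχ hu

/-- The Legendre symbol as a Dirichlet character. -/
noncomputable def legendreChar (p : ℕ) [Fact p.Prime] : DirichletCharacter ℂ p :=
  (quadraticChar (ZMod p)).ringHomComp (Int.castRingHom ℂ)

theorem legendreChar_natCast (p : ℕ) [Fact p.Prime] (n : ℕ) :
    legendreChar p n = (jacobiSym n p : ℂ) := by
  rw [← jacobiSym.legendreSym.to_jacobiSym, legendreSym]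
  simp [legendreChar, MulChar.ringHomComp_apply]

theorem legendreChar_sq (p : ℕ) [Fact p.Prime] : legendreChar p ^ 2 = 1 := by
  rw [legendreChar, MulChar.ringHomComp_pow, (quadraticChar_isQuadratic _).sq_eq_one,
    MulChar.ringHomComp_one]

theorem apply_eq_one_of_jacobiSym_eq_one {L N p : ℕ} [Fact p.Prime] (hL : L = N * p)
    (hNp : N.Coprime p) {χ : DirichletCharacter ℂ L} (hχ : χ ^ 2 = 1) {n : ℕ} (hn : n.Coprime L)
    (hn1 : (n : ZMod N) = 1) (hJ : jacobiSym n p = 1) : χ n = 1 := by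
  subst hL
  have hnp : ((n : ℤ) : ZMod p) ≠ 0 := by
    rw [Int.cast_natCast]
    exact ((ZMod.isUnit_iff_coprime n p).2 (Nat.Coprime.coprime_mul_left_right hn)).ne_zero
  rw [← jacobiSym.legendreSym.to_jacobiSym, legendreSym.eq_one_iff p hnp] at hJ
  obtain ⟨y, hy⟩ := hJ
  have hz := (ZMod.chineseRemainder hNp).apply_symm_apply (1, y)
  set z := (ZMod.chineseRemainder hNp).symm (1, y) with hzdef
  have h1 : (n : ZMod (N * p)) = z * z := by
    apply (ZMod.chineseRemainder hNp).injective
    rw [map_mul, hz, map_natCast]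
    refine Prod.ext ?_ ?_
    · simpa using hn1
    · simpa using hy
  have hu : IsUnit z := by
    have := (ZMod.isUnit_iff_coprime n (N * p)).2 hn
    rw [h1] at this
    exact isUnit_of_mul_isUnit_left this
  rw [h1, map_mul, ← sq]
  exact sq_apply_of_sq_eq_one hχ hu

/-- A quadratic character modulo `N * p` is induced from modulus `N`, possibly after
multiplication by the Legendre symbol modulo `p`. -/
theorem exists_changeLevel_of_prime {L N p : ℕ} [Fact p.Prime] [NeZero L] (hL : L = N * p)
    (hNp : N.Coprime p) {χ : DirichletCharacter ℂ L} (hχ : χ ^ 2 = 1) (hN : N ∣ L) (hp : p ∣ L) :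
    ∃ χ₀ : DirichletCharacter ℂ N, χ = changeLevel hN χ₀ ∨
      χ = changeLevel hN χ₀ * changeLevel hp (legendreChar p) := by
  by_cases hker : ∀ n : ℕ, n.Coprime L → (n : ZMod N) = 1 → χ n = 1
  · obtain ⟨χ₀, h⟩ := exists_changeLevel_eq hN χ hker
    exact ⟨χ₀, Or.inl h⟩
  push Not at hker
  obtain ⟨a, haL, haN, hχa⟩ := hker
  have hjac : ∀ n : ℕ, n.Coprime L → jacobiSym n p = 1 ∨ jacobiSym n p = -1 := fun n hn => by
    refine jacobiSym.eq_one_or_neg_one ?_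
    rw [Int.gcd_natCast_natCast]
    exact Nat.Coprime.coprime_dvd_right hp hn
  have hJa : jacobiSym a p = -1 := (hjac a haL).resolve_left fun h =>
    hχa (apply_eq_one_of_jacobiSym_eq_one hL hNp hχ haL haN h)
  have hχa' : χ a = -1 := (eq_one_or_neg_one_of_sq_eq_one hχ haL).resolve_left hχa
  set τ := changeLevel hp (legendreChar p) with hτ
  have hτ2 : τ * τ = 1 := by rw [hτ, ← map_mul, ← sq, legendreChar_sq, map_one]
  obtain ⟨χ₀, h⟩ := exists_changeLevel_eq hN (χ * τ) fun n hn hn1 => by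
    rw [MulChar.mul_apply, hτ, changeLevel_natCast hp _ hn, legendreChar_natCast]
    rcases hjac n hn with h | h
    · rw [apply_eq_one_of_jacobiSym_eq_one hL hNp hχ hn hn1 h, h]
      simp
    · have h1 : χ ((n * a : ℕ) : ZMod L) = 1 := by
        refine apply_eq_one_of_jacobiSym_eq_one hL hNp hχ (Nat.Coprime.mul_left hn haL)
          (by simp [hn1, haN]) ?_
        rw [Nat.cast_mul, jacobiSym.mul_left, h, hJa]
        norm_num
      rw [Nat.cast_mul, map_mul, hχa'] at h1
      rw [h]
      push_cast
      exact h1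
  exact ⟨χ₀, Or.inr (by rw [← h, mul_assoc, hτ2, mul_one])⟩

theorem sq_eq_one_of_changeLevel {d L : ℕ} [NeZero L] (hd : d ∣ L) {χ : DirichletCharacter ℂ d}
    (h : changeLevel hd χ ^ 2 = 1) : χ ^ 2 = 1 := by
  rwa [← map_pow, changeLevel_eq_one_iff] at h

/-- A quadratic character modulo `M * R`, with `R` odd and squarefree, is the product of a
character modulo `M` and a Jacobi symbol. -/
theorem exists_eq_mul_jacobiSym {M : ℕ} (hM : 0 < M) (R : ℕ) : Squarefree R → Odd R →
    R.Coprime M → ∀ χ : DirichletCharacter ℂ (M * R), χ ^ 2 = 1 → ∃ D, D ∣ R ∧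
      ∃ ψ : DirichletCharacter ℂ M, ∀ n : ℕ, n.Coprime (M * R) →
        χ n = ψ n * (jacobiSym n D : ℂ) := by
  induction R using induction_on_primes with
  | zero => intro h; simp at h
  | one =>
    intro _ _ _ χ _
    have h : M * 1 ∣ M := by simp
    refine ⟨1, dvd_rfl, changeLevel h χ, fun n hn => ?_⟩
    rw [changeLevel_natCast h χ (by simpa using hn)]
    simp
  | prime_mul p R hp ih =>
    intro hsq hodd hcop χ hχ
    have := Fact.mk hp
    have hR : R ≠ 0 := by rintro rfl; simp at hsq
    have : NeZero (M * (p * R)) := ⟨by have := hp.ne_zero; positivity⟩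
    have hsq' := Nat.squarefree_mul_iff.1 hsq
    have hL : M * (p * R) = M * R * p := by ring
    have hN : M * R ∣ M * (p * R) := ⟨p, hL⟩
    have hpL : p ∣ M * (p * R) := ⟨M * R, by ring⟩
    have hpM : p.Coprime M := Nat.Coprime.coprime_mul_right hcop
    have hNp : (M * R).Coprime p := Nat.Coprime.mul_left hpM.symm hsq'.1.symm
    obtain ⟨χ₀, h⟩ := exists_changeLevel_of_prime hL hNp hχ hN hpL
    have hτ2 : changeLevel hpL (legendreChar p) ^ 2 = 1 := by
      rw [← map_pow, legendreChar_sq, map_one]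
    have hχ₀ : χ₀ ^ 2 = 1 := by
      refine sq_eq_one_of_changeLevel hN ?_
      rcases h with h | h
      · rw [← h, hχ]
      · rw [h, mul_pow, hτ2, mul_one] at hχ
        exact hχ
    obtain ⟨D, hD, ψ, hψ⟩ := ih hsq'.2.2 (Nat.Odd.of_mul_right hodd)
      (Nat.Coprime.coprime_mul_left hcop) χ₀ hχ₀
    rcases h with h | h
    · refine ⟨D, hD.mul_left p, ψ, fun n hn => ?_⟩
      rw [h, changeLevel_natCast hN _ hn]
      exact hψ n (Nat.Coprime.coprime_dvd_right hN hn)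
    · refine ⟨D * p, by rw [mul_comm p]; exact Nat.mul_dvd_mul_right hD p, ψ, fun n hn => ?_⟩
      have hD0 : NeZero D := ⟨by rintro rfl; simp at hD; exact hR hD⟩
      rw [h, MulChar.mul_apply, changeLevel_natCast hN _ hn, changeLevel_natCast hpL _ hn,
        legendreChar_natCast, hψ n (Nat.Coprime.coprime_dvd_right hN hn), jacobiSym.mul_right]
      push_cast
      ring

end quadraticCharacters

section structureOfCharacters

open Finset DirichletCharacter

theorem exists_squarefree_part (m Q : ℕ) (hQ : Q ≠ 0) : ∃ R, R ∣ Q ∧ Squarefree R ∧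
    Odd R ∧ R.Coprime (8 * m) ∧ ∀ p, p.Prime → p ∣ Q → p ∣ 2 * m * R := by
  set s := {p ∈ Q.primeFactors | ¬p ∣ 2 * m} with hs
  have hprime : ∀ p ∈ s, p.Prime := fun p hp => Nat.prime_of_mem_primeFactors (mem_filter.1 hp).1
  have hdvd : ∀ p, p.Prime → p ∣ ∏ p ∈ s, p → ¬p ∣ 2 * m := fun p hp hpR => by
    obtain ⟨q, hq, hpq⟩ := (hp.prime.dvd_finset_prod_iff _).1 hpR
    rw [(Nat.prime_dvd_prime_iff_eq hp (hprime q hq)).1 hpq]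
    exact (mem_filter.1 hq).2
  refine ⟨∏ p ∈ s, p, (prod_dvd_prod_of_subset _ _ _ (filter_subset _ _)).trans
    (Nat.prod_primeFactors_dvd Q), ?_, ?_, ?_, fun p hp hpQ => ?_⟩
  · refine squarefree_prod_of_pairwise_isCoprime (fun p hp q hq hpq => ?_)
      fun p hp => (hprime p hp).prime.squarefree
    exact Nat.coprime_iff_isRelPrime.1 ((Nat.coprime_primes (hprime p hp) (hprime q hq)).2 hpq)
  · rw [← Nat.not_even_iff_odd, even_iff_two_dvd]
    exact fun h => hdvd 2 Nat.prime_two h (dvd_mul_right 2 m)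
  · refine Nat.coprime_of_dvd fun p hp hpR hpm => hdvd p hp hpR ?_
    rcases hp.dvd_mul.1 hpm with h | h
    · exact ((hp.dvd_of_dvd_pow (show p ∣ 2 ^ 3 by norm_num; exact h))).mul_right m
    · exact h.mul_left 2
  · by_cases h : p ∣ 2 * m
    · exact h.mul_right _
    · exact (dvd_prod_of_mem (fun p => p)
        (mem_filter.2 ⟨Nat.mem_primeFactors.2 ⟨hp, hpQ, hQ⟩, h⟩)).mul_left _

/-- A quadratic character is, away from finitely many primes, the product of a character of
modulus `8m` and a Jacobi symbol. -/
theorem exists_eq_mul_jacobiSym_of_sq_eq_one (m Q : ℕ) (hm : 0 < m) (hQ : 0 < Q)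
    (χ : DirichletCharacter ℂ Q) (hχ : χ ^ 2 = 1) : ∃ D, D ∣ Q ∧ Squarefree D ∧ Odd D ∧
      D.Coprime (8 * m) ∧ ∃ ψ : DirichletCharacter ℂ (8 * m), ∀ n : ℕ, n.Coprime (8 * m * Q) →
        χ n = ψ n * (jacobiSym n D : ℂ) := by
  obtain ⟨R, hRQ, hsq, hodd, hcop, hR⟩ := exists_squarefree_part m Q hQ.ne'
  have hR0 : R ≠ 0 := hsq.ne_zero
  have hd : 8 * m * R ∣ 8 * m * Q := Nat.mul_dvd_mul_left _ hRQ
  have hQL : Q ∣ 8 * m * Q := dvd_mul_left _ _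
  have : NeZero (8 * m * Q) := ⟨by positivity⟩
  obtain ⟨χ₀, h₀⟩ := exists_changeLevel_eq hd (changeLevel hQL χ) fun n hn hn1 => by
    rw [changeLevel_natCast hQL _ hn]
    refine apply_eq_one_of_modEq hχ hQ.ne' (T := 2 * m * R) (by positivity) hR ?_
    rw [show 4 * (2 * m * R) = 8 * m * R by ring]
    exact hn1
  have hχ₀ : χ₀ ^ 2 = 1 := by
    refine sq_eq_one_of_changeLevel hd ?_
    rw [← h₀, ← map_pow, hχ, map_one]
  obtain ⟨D, hD, ψ, hψ⟩ := exists_eq_mul_jacobiSym (by positivity) R hsq hodd hcop χ₀ hχ₀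
  refine ⟨D, hD.trans hRQ, hsq.squarefree_of_dvd hD, Odd.of_dvd_nat hodd hD,
    hcop.coprime_dvd_left hD, ψ, fun n hn => ?_⟩
  rw [← changeLevel_natCast hQL _ hn, h₀, changeLevel_natCast hd _ hn]
  exact hψ n (hn.coprime_dvd_right hd)

theorem exists_prime_char_ne_one (m : ℕ) (hm : 0 < m) (ε : ℝ) (hε : 0 < ε) :
    ∃ C : ℝ, 0 < C ∧ ∀ Q : ℕ, 0 < Q → ∀ χ : DirichletCharacter ℂ Q, χ ^ 2 = 1 →
      ¬χ.conductor ∣ m → ∃ p : ℕ, p.Prime ∧ (p : ZMod m) = 1 ∧ ¬p ∣ Q ∧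
        (p : ℝ) ≤ C * (Q : ℝ) ^ ((m.totient : ℝ) / (4 * Real.sqrt (Real.exp 1)) + ε) ∧
        χ p ≠ 1 := by
  have : NeZero m := ⟨hm.ne'⟩
  have hmM : m ∣ 8 * m := dvd_mul_left m 8
  obtain ⟨C, hC, h⟩ := exists_prime_jacobiSym_ne_one m (8 * m) (by positivity) hmM ε hε
  refine ⟨C, hC, fun Q hQ χ hχ hcond => ?_⟩
  obtain ⟨D, hDQ, hsq, hodd, hcop, ψ, hψ⟩ :=
    exists_eq_mul_jacobiSym_of_sq_eq_one m Q hm hQ χ hχ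
  obtain ⟨p, hp, hpm, hpQ, hple, hne⟩ := h Q D hQ (Nat.le_of_dvd hQ hDQ) hsq hodd hcop ψ
    fun hD ξ hξ => hcond (by
      have : NeZero (8 * m * Q) := ⟨by positivity⟩
      have hQL : Q ∣ 8 * m * Q := dvd_mul_left _ _
      have hmL : m ∣ 8 * m * Q := hmM.mul_right Q
      have heq : changeLevel hQL χ = changeLevel hmL ξ⁻¹ := by
        rw [map_inv, eq_inv_iff_mul_eq_one]
        refine MulChar.ext fun u => ?_
        have hcu : (u : ZMod (8 * m * Q)).val.Coprime (8 * m * Q) := ZMod.val_coe_unit_coprime u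
        have hval : (((u : ZMod (8 * m * Q)).val : ℕ) : ZMod (8 * m * Q)) = u :=
          ZMod.natCast_zmod_val _
        rw [MulChar.one_apply_coe, MulChar.mul_apply, ← hval, changeLevel_natCast _ _ hcu,
          changeLevel_natCast _ _ hcu, hψ _ hcu, hD, jacobiSym.one_right, Int.cast_one, mul_one,
          mul_comm, ← changeLevel_mul_natCast hmM, hξ]
        exact MulChar.one_apply ((ZMod.isUnit_iff_coprime _ _).2 (hcu.coprime_mul_right_right))
      rw [← conductor_changeLevel χ hQL, heq, conductor_changeLevel]
      exact conductor_dvd_level _)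
  refine ⟨p, hp, hpm, fun h => hpQ (h.mul_left _), hple, ?_⟩
  rwa [hψ p ((hp.coprime_iff_not_dvd).2 hpQ)]

end structureOfCharacters

section signs

open Finset

/-- The nontrivial additive character of `ZMod 2`. -/
noncomputable def signChar : AddChar (ZMod 2) ℂ where
  toFun x := if x = 0 then 1 else -1
  map_zero_eq_one' := by simp
  map_add_eq_mul' a b := by
    have key : ∀ a b : ZMod 2, a + b = 0 ↔ (a = 0 ↔ b = 0) := by decide
    simp only [key]
    by_cases ha : a = 0 <;> by_cases hb : b = 0 <;> simp [ha, hb]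

theorem signChar_apply (x : ZMod 2) : signChar x = if x = 0 then 1 else -1 := rfl

theorem signChar_ite {z : ℂ} (hz : z = 1 ∨ z = -1) :
    signChar (if z = 1 then 0 else 1) = z := by
  rw [signChar_apply]
  rcases hz with rfl | rfl
  · simp
  · norm_num

theorem signChar_sum {ι : Type*} (t : Finset ι) (f : ι → ZMod 2) :
    signChar (∑ i ∈ t, f i) = ∏ i ∈ t, signChar (f i) := by
  classical
  induction t using Finset.induction_on with
  | empty => simp
  | insert j t hj ih => rw [sum_insert hj, prod_insert hj, AddChar.map_add_eq_mul, ih]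

theorem zmod_two_eq_one_of_ne_zero : ∀ c : ZMod 2, c ≠ 0 → c = 1 := by
  decide

/-- Vectors over `ZMod 2` annihilated by no non-empty set of coordinates span the whole space, so
that every vector is a sum of few of them. -/
theorem exists_finset_sum_eq {r : ℕ} (P : Set ℕ) (w : ℕ → Fin r → ZMod 2)
    (hsep : ∀ I : Finset (Fin r), I.Nonempty → ∃ p ∈ P, ∑ i ∈ I, w p i ≠ 0)
    (t : Fin r → ZMod 2) : ∃ S : Finset ℕ, ↑S ⊆ P ∧ #S ≤ r ∧ ∑ p ∈ S, w p = t := by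
  classical
  have hspan : Submodule.span (ZMod 2) (w '' P) = ⊤ := by
    by_contra h
    obtain ⟨f, hf0, hf⟩ := Submodule.exists_le_ker_of_lt_top _ (lt_top_iff_ne_top.2 h)
    have hfx : ∀ x, f x = ∑ i with f (Pi.single i 1) ≠ 0, x i := fun x => by
      conv_lhs => rw [pi_eq_sum_univ' x, map_sum]
      rw [sum_filter]
      refine sum_congr rfl fun i _ => ?_
      rw [map_smul, smul_eq_mul]
      by_cases h : f (Pi.single i 1) = 0
      · rw [h, mul_zero, if_neg (not_not.2 rfl)]
      · rw [if_pos h, zmod_two_eq_one_of_ne_zero _ h, mul_one]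
    obtain ⟨p, hp, hne⟩ := hsep {i | f (Pi.single i 1) ≠ 0} (by
      rw [nonempty_iff_ne_empty]
      intro h0
      apply hf0
      refine LinearMap.ext fun x => ?_
      rw [hfx, h0, sum_empty, LinearMap.zero_apply])
    rw [← hfx] at hne
    exact hne (LinearMap.mem_ker.1 (hf (Submodule.subset_span ⟨p, hp, rfl⟩)))
  obtain ⟨b, hb, hbspan, hli⟩ := exists_linearIndependent (ZMod 2) (w '' P)
  have : Fintype b := Fintype.ofFinite b
  have hcard : Fintype.card b ≤ r := by
    simpa using hli.fintype_card_le_finrank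
  have ht : t ∈ Submodule.span (ZMod 2) (Set.range (Subtype.val : b → Fin r → ZMod 2)) := by
    rw [Subtype.range_coe, hbspan, hspan]
    trivial
  obtain ⟨c, hc⟩ := (Submodule.mem_span_range_iff_exists_fun _).1 ht
  choose g hgP hg using fun x : b => hb x.2
  have hginj : Function.Injective g := fun x y h => Subtype.ext (by rw [← hg x, ← hg y, h])
  refine ⟨({x | c x ≠ 0} : Finset b).image g, ?_, ?_, ?_⟩
  · intro p hp
    obtain ⟨x, _, rfl⟩ := mem_image.1 (mem_coe.1 hp)
    exact hgP x
  · exact card_image_le.trans ((card_le_univ _).trans hcard)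
  · rw [sum_image fun x _ y _ h => hginj h, ← hc, sum_filter]
    refine sum_congr rfl fun x _ => ?_
    rw [hg x]
    by_cases h : c x = 0
    · rw [h, zero_smul, if_neg (not_not.2 rfl)]
    · rw [if_pos h, zmod_two_eq_one_of_ne_zero _ h, one_smul]

end signs

section assembly

open Finset DirichletCharacter

theorem mulChar_prod_apply {ι : Type*} {L : ℕ} (I : Finset ι) (χ : ι → DirichletCharacter ℂ L)
    {n : ℕ} (hn : n.Coprime L) : (∏ i ∈ I, χ i) (n : ZMod L) = ∏ i ∈ I, χ i n := by
  classical
  induction I using Finset.induction_on with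
  | empty => simpa using MulChar.one_apply ((ZMod.isUnit_iff_coprime n L).2 hn)
  | insert j t hj ih => rw [prod_insert hj, prod_insert hj, MulChar.mul_apply, ih]

end assembly

/-- Given quadratic Dirichlet characters `χ i` mod `q i` and signs `e i ∈ {±1}` such that no
non-empty product of the `χ i` has conductor dividing `m`, there is a squarefree positive
integer `n` with at most `r` prime factors, all `≡ 1 (mod m)` and at most
`C(m,ε) (q₁⋯q_r)^{φ(m)/(4√e)+ε}`, such that `χ i (n) = e i` for all `i`. -/
theorem exists_squarefree_with_prescribed_char_values (m : ℕ) (hm : 0 < m)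
    (ε : ℝ) (hε : 0 < ε) :
    ∃ C : ℝ, 0 < C ∧
      ∀ (r : ℕ) (q : Fin r → ℕ), (∀ i, 0 < q i) →
        ∀ (χ : (i : Fin r) → DirichletCharacter ℂ (q i)), (∀ i, (χ i) ^ 2 = 1) →
          ∀ (e : Fin r → ℂ), (∀ i, e i = 1 ∨ e i = -1) →
            (∀ I : Finset (Fin r), I.Nonempty →
              ¬ (DirichletCharacter.conductor (∏ i ∈ I, DirichletCharacter.changeLevel
                  (Finset.dvd_prod_of_mem q (Finset.mem_univ i)) (χ i))) ∣ m) →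
            ∃ n : ℕ, 0 < n ∧ Squarefree n ∧ n.primeFactors.card ≤ r ∧
              (∀ p ∈ n.primeFactors, p ≡ 1 [MOD m] ∧
                (p : ℝ) ≤ C * ((∏ i, q i : ℕ) : ℝ) ^
                  ((Nat.totient m : ℝ) / (4 * Real.sqrt (Real.exp 1)) + ε)) ∧
              ∀ i, (χ i) (n : ZMod (q i)) = e i := by
  classical
  obtain ⟨C, hC, h⟩ := exists_prime_char_ne_one m hm ε hε
  refine ⟨C, hC, fun r q hq χ hχ e he hcond => ?_⟩
  have hdvd : ∀ i, q i ∣ ∏ i, q i := fun i => Finset.dvd_prod_of_mem q (Finset.mem_univ i)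
  set B : ℝ := C * ((∏ i, q i : ℕ) : ℝ) ^
    ((Nat.totient m : ℝ) / (4 * Real.sqrt (Real.exp 1)) + ε) with hB
  set P : Set ℕ := {p | p.Prime ∧ (p : ZMod m) = 1 ∧ ¬p ∣ ∏ i, q i ∧ (p : ℝ) ≤ B} with hP
  have hcop : ∀ p ∈ P, p.Coprime (∏ i, q i) := fun p hp =>
    (hp.1.coprime_iff_not_dvd).2 hp.2.2.1
  set w : ℕ → Fin r → ZMod 2 := fun p i => if χ i p = 1 then 0 else 1 with hw
  have hsign : ∀ p ∈ P, ∀ i, signChar (w p i) = χ i p := fun p hp i =>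
    signChar_ite (eq_one_or_neg_one_of_sq_eq_one (hχ i) ((hcop p hp).coprime_dvd_right (hdvd i)))
  obtain ⟨S, hSP, hSr, hS⟩ := exists_finset_sum_eq P w (fun I hI => by
    obtain ⟨p, hp, hpm, hpQ, hpB, hne⟩ := h (∏ i, q i) (Finset.prod_pos fun i _ => hq i)
      (∏ i ∈ I, DirichletCharacter.changeLevel (hdvd i) (χ i))
      (by
        rw [← Finset.prod_pow]
        exact Finset.prod_eq_one fun i _ => by rw [← map_pow, hχ i, map_one]) (hcond I hI)
    have hpP : p ∈ P := ⟨hp, hpm, hpQ, hpB⟩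
    refine ⟨p, hpP, fun h0 => hne ?_⟩
    rw [mulChar_prod_apply I _ (hcop p hpP)]
    calc ∏ i ∈ I, DirichletCharacter.changeLevel (hdvd i) (χ i) p
        = ∏ i ∈ I, signChar (w p i) := Finset.prod_congr rfl fun i _ => by
          rw [changeLevel_natCast (hdvd i) _ (hcop p hpP), hsign p hpP]
      _ = 1 := by rw [← signChar_sum, h0, AddChar.map_zero_eq_one])
    fun i => if e i = 1 then 0 else 1
  have hprime : ∀ p ∈ S, p.Prime := fun p hp => (hSP hp).1
  have hpf : (∏ p ∈ S, p).primeFactors = S := Nat.primeFactors_prod hprime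
  refine ⟨∏ p ∈ S, p, Finset.prod_pos fun p hp => (hprime p hp).pos, ?_, by rwa [hpf],
    fun p hp => ?_, fun i => ?_⟩
  · refine Finset.squarefree_prod_of_pairwise_isCoprime (fun p hp q hq hpq => ?_)
      fun p hp => (hprime p hp).prime.squarefree
    exact Nat.coprime_iff_isRelPrime.1 ((Nat.coprime_primes (hprime p hp) (hprime q hq)).2 hpq)
  · rw [hpf] at hp
    refine ⟨?_, (hSP hp).2.2.2⟩
    rw [← ZMod.natCast_eq_natCast_iff, Nat.cast_one]
    exact (hSP hp).2.1
  · rw [Nat.cast_prod, map_prod]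
    calc ∏ p ∈ S, χ i p = ∏ p ∈ S, signChar (w p i) :=
          Finset.prod_congr rfl fun p hp => (hsign p (hSP hp) i).symm
      _ = e i := by
        rw [← signChar_sum, ← Finset.sum_apply, hS]
        exact signChar_ite (he i)
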